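/- arXiv:0812.3181 — 6 statements merged into one kernel-verified Lean document; each statement's English description precedes it below -/
import Mathlib

section
/- Let n ≥ 3 and let u : ℝⁿ → ℂ be a smooth compactly supported function. Then Hardy's inequality holds: ((n−2)²/4) · ∫_{ℝⁿ} |u(x)|²/|x|² dx ≤ ∫_{ℝⁿ} |∇u(x)|² dx. -/
open MeasureTheory

/-- Squared Euclidean norm of the gradient of a (possibly complex-valued) function:
the sum over an orthonormal basis of the squared norms of the directional derivatives.
For complex-valued `u` this equals `|∇(Re u)|² + |∇(Im u)|²`. -/
noncomputable def gradNormSq {n : ℕ} (u : EuclideanSpace ℝ (Fin n) → ℂ)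
    (x : EuclideanSpace ℝ (Fin n)) : ℝ :=
  ∑ j : Fin n, ‖fderiv ℝ u x (EuclideanSpace.single j (1 : ℝ))‖ ^ 2

open scoped InnerProductSpace

/-- The integral of a directional derivative of a compactly supported `C¹` function vanishes. -/
lemma integral_fderiv_apply_eq_zero {E : Type*} [NormedAddCommGroup E] [NormedSpace ℝ E]
    [FiniteDimensional ℝ E] [MeasurableSpace E] [BorelSpace E] (μ : Measure E)
    [μ.IsAddHaarMeasure] {g : E → ℝ} (hg : ContDiff ℝ 1 g) (hc : HasCompactSupport g) (v : E) :
    Integrable (fun x ↦ fderiv ℝ g x v) μ ∧ ∫ x, fderiv ℝ g x v ∂μ = 0 := by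
  have hi : Integrable (fun x ↦ fderiv ℝ g x v) μ :=
    ((hg.continuous_fderiv one_ne_zero).clm_apply continuous_const).integrable_of_hasCompactSupport
      (hc.fderiv_apply ℝ v)
  refine ⟨hi, ?_⟩
  have h := integral_mul_fderiv_eq_neg_fderiv_mul_of_integrable (μ := μ) (f := fun _ ↦ (1 : ℝ))
    (g := g) (v := v) (by simp) (by simpa using hi)
    (by simpa using hg.continuous.integrable_of_hasCompactSupport hc)
    (fun x _ ↦ by fun_prop) (fun x _ ↦ hg.differentiable one_ne_zero x)
  simpa using h

variable {n : ℕ}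

/-- The `j`-th component of the regularized Hardy vector field `|u|² x / (|x|² + ε)`. -/
noncomputable def hardyField (u : EuclideanSpace ℝ (Fin n) → ℂ) (ε : ℝ) (j : Fin n)
    (x : EuclideanSpace ℝ (Fin n)) : ℝ :=
  x j * (‖u x‖ ^ 2 * (‖x‖ ^ 2 + ε)⁻¹)

lemma contDiff_hardyField {u : EuclideanSpace ℝ (Fin n) → ℂ} (hu : ContDiff ℝ 1 u) {ε : ℝ}
    (hε : 0 < ε) (j : Fin n) : ContDiff ℝ 1 (hardyField u ε j) := by
  unfold hardyField
  have h1 : ContDiff ℝ 1 fun x : EuclideanSpace ℝ (Fin n) ↦ x j :=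
    (EuclideanSpace.proj (𝕜 := ℝ) j).contDiff
  have h2 : ContDiff ℝ 1 fun x : EuclideanSpace ℝ (Fin n) ↦ (‖x‖ ^ 2 + ε)⁻¹ :=
    ((contDiff_norm_sq ℝ).add contDiff_const).inv fun x ↦ by positivity
  exact h1.mul ((hu.norm_sq ℝ).mul h2)

lemma hasCompactSupport_hardyField {u : EuclideanSpace ℝ (Fin n) → ℂ}
    (hc : HasCompactSupport u) (ε : ℝ) (j : Fin n) : HasCompactSupport (hardyField u ε j) := by
  refine hc.mono fun x hx ↦ ?_
  contrapose! hx
  simp_all [hardyField]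

lemma fderiv_hardyField {u : EuclideanSpace ℝ (Fin n) → ℂ} (hu : ContDiff ℝ 1 u) {ε : ℝ}
    (hε : 0 < ε) (j : Fin n) (x : EuclideanSpace ℝ (Fin n)) :
    fderiv ℝ (hardyField u ε j) x (EuclideanSpace.single j 1) =
      ‖u x‖ ^ 2 * (‖x‖ ^ 2 + ε)⁻¹ - 2 * x j ^ 2 * ‖u x‖ ^ 2 * (‖x‖ ^ 2 + ε)⁻¹ ^ 2
      + 2 * x j * (‖x‖ ^ 2 + ε)⁻¹ *
        ⟪u x, fderiv ℝ u x (EuclideanSpace.single j 1)⟫_ℝ := by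
  have hne : ‖x‖ ^ 2 + ε ≠ 0 := by positivity
  have h1 : HasFDerivAt (fun x : EuclideanSpace ℝ (Fin n) ↦ x j)
      (EuclideanSpace.proj (𝕜 := ℝ) j : EuclideanSpace ℝ (Fin n) →L[ℝ] ℝ) x :=
    (EuclideanSpace.proj (𝕜 := ℝ) j).hasFDerivAt
  have h2 := (hu.differentiable one_ne_zero x).hasFDerivAt.norm_sq
  have h3 := (hasDerivAt_inv hne).comp_hasFDerivAt x
    ((hasFDerivAt_id (𝕜 := ℝ) x).norm_sq.add_const ε)
  have h := h1.mul (h2.mul h3)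
  have he : fderiv ℝ (hardyField u ε j) x = _ := h.fderiv
  rw [he]
  simp [EuclideanSpace.inner_single_right]
  ring

lemma hardy_pointwise {u : EuclideanSpace ℝ (Fin n) → ℂ} (hu : ContDiff ℝ 1 u) (hn : 2 ≤ n)
    {ε : ℝ} (hε : 0 < ε) (x : EuclideanSpace ℝ (Fin n)) :
    ((n : ℝ) - 2) ^ 2 / 4 * (‖u x‖ ^ 2 * (‖x‖ ^ 2 + ε)⁻¹) ≤
      gradNormSq u x + ((n : ℝ) - 2) / 2 *
        ∑ j, fderiv ℝ (hardyField u ε j) x (EuclideanSpace.single j 1) := by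
  have hn' : (2 : ℝ) ≤ n := by exact_mod_cast hn
  obtain ⟨a, ha⟩ : ∃ a : ℝ, a = ((n : ℝ) - 2) / 2 := ⟨_, rfl⟩
  obtain ⟨p, hp⟩ : ∃ p : ℝ, p = (‖x‖ ^ 2 + ε)⁻¹ := ⟨_, rfl⟩
  have ha0 : 0 ≤ a := by rw [ha]; linarith
  have hp0 : 0 < p := by rw [hp]; positivity
  have hxp : ‖x‖ ^ 2 * p ≤ 1 := by
    rw [hp, ← div_eq_mul_inv, div_le_one (by positivity)]
    linarith
  have hterm (j : Fin n) : a * (‖u x‖ ^ 2 * p) - (2 * a + a ^ 2) * ‖u x‖ ^ 2 * p ^ 2 * x j ^ 2 ≤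
      ‖fderiv ℝ u x (EuclideanSpace.single j 1)‖ ^ 2 +
      a * fderiv ℝ (hardyField u ε j) x (EuclideanSpace.single j 1) := by
    rw [fderiv_hardyField hu hε, ← hp]
    have h := sq_nonneg ‖fderiv ℝ u x (EuclideanSpace.single j 1) + (a * p * x j) • u x‖
    rw [norm_add_sq_real, inner_smul_right, norm_smul, mul_pow, Real.norm_eq_abs, sq_abs,
      real_inner_comm] at h
    linarith
  have hsum := Finset.sum_le_sum fun j (_ : j ∈ Finset.univ) ↦ hterm j
  rw [Finset.sum_sub_distrib, Finset.sum_add_distrib, Finset.sum_const, Finset.card_univ,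
    Fintype.card_fin, nsmul_eq_mul, ← Finset.mul_sum, ← Finset.mul_sum,
    ← EuclideanSpace.real_norm_sq_eq] at hsum
  rw [← ha, ← hp, gradNormSq]
  refine le_trans ?_ hsum
  have hna : (n : ℝ) = 2 * a + 2 := by rw [ha]; ring
  have hk : (2 * a + a ^ 2) * (‖u x‖ ^ 2 * p) * (‖x‖ ^ 2 * p) ≤
      (2 * a + a ^ 2) * (‖u x‖ ^ 2 * p) * 1 := by gcongr
  rw [hna]
  linarith

lemma continuous_gradNormSq {u : EuclideanSpace ℝ (Fin n) → ℂ} (hu : ContDiff ℝ 1 u) :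
    Continuous (gradNormSq u) :=
  continuous_finsetSum _ fun _ _ ↦
    ((hu.continuous_fderiv one_ne_zero).clm_apply continuous_const).norm.pow 2

lemma integrable_gradNormSq {u : EuclideanSpace ℝ (Fin n) → ℂ} (hu : ContDiff ℝ 1 u)
    (hc : HasCompactSupport u) : Integrable (gradNormSq u) := by
  refine (continuous_gradNormSq hu).integrable_of_hasCompactSupport
    ((hc.fderiv ℝ).mono fun x hx ↦ ?_)
  contrapose! hx
  simp_all [gradNormSq]

lemma continuous_norm_sq_mul_inv {u : EuclideanSpace ℝ (Fin n) → ℂ} (hu : Continuous u) {ε : ℝ}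
    (hε : 0 < ε) : Continuous fun x ↦ ‖u x‖ ^ 2 * (‖x‖ ^ 2 + ε)⁻¹ := by
  have h (x : EuclideanSpace ℝ (Fin n)) : ‖x‖ ^ 2 + ε ≠ 0 := by positivity
  fun_prop (disch := exact h _)

lemma hardy_inequality_regularized {u : EuclideanSpace ℝ (Fin n) → ℂ} (hu : ContDiff ℝ 1 u)
    (hc : HasCompactSupport u) (hn : 2 ≤ n) {ε : ℝ} (hε : 0 < ε) :
    ((n : ℝ) - 2) ^ 2 / 4 * ∫ x, ‖u x‖ ^ 2 * (‖x‖ ^ 2 + ε)⁻¹ ≤ ∫ x, gradNormSq u x := by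
  have hD (j : Fin n) := integral_fderiv_apply_eq_zero volume (contDiff_hardyField hu hε j)
    (hasCompactSupport_hardyField hc ε j) (EuclideanSpace.single j 1)
  have hsum := (integrable_finsetSum Finset.univ fun j _ ↦ (hD j).1).const_mul (((n : ℝ) - 2) / 2)
  have hInt : Integrable fun x ↦ ‖u x‖ ^ 2 * (‖x‖ ^ 2 + ε)⁻¹ := by
    refine (continuous_norm_sq_mul_inv hu.continuous hε).integrable_of_hasCompactSupport (hc.mono fun x hx ↦ ?_)
    contrapose! hx
    simp_all
  have hle := integral_mono (hInt.const_mul (((n : ℝ) - 2) ^ 2 / 4))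
    ((integrable_gradNormSq hu hc).add hsum) fun x ↦ hardy_pointwise hu hn hε x
  simp only [Pi.add_apply] at hle
  rw [integral_const_mul, integral_add (integrable_gradNormSq hu hc) hsum, integral_const_mul,
    integral_finsetSum _ fun j _ ↦ (hD j).1, Finset.sum_eq_zero fun j _ ↦ (hD j).2,
    mul_zero, add_zero] at hle
  exact hle

/-- **Hardy's inequality**: for `n ≥ 3` and `u : ℝⁿ → ℂ` smooth and compactly supported,
`((n-2)²/4) ∫ |u(x)|²/|x|² dx ≤ ∫ |∇u(x)|² dx`. -/
theorem hardy_inequality (n : ℕ) (hn : 3 ≤ n)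
    (u : EuclideanSpace ℝ (Fin n) → ℂ)
    (hu : ContDiff ℝ (⊤ : ℕ∞) u) (hsupp : HasCompactSupport u) :
    ((n : ℝ) - 2) ^ 2 / 4 * ∫ x, ‖u x‖ ^ 2 / ‖x‖ ^ 2 ≤ ∫ x, gradNormSq u x := by
  have hu1 : ContDiff ℝ 1 u := hu.of_le (by exact_mod_cast le_top)
  by_cases hInt : Integrable fun x ↦ ‖u x‖ ^ 2 / ‖x‖ ^ 2
  swap
  · rw [integral_undef hInt, mul_zero]
    exact integral_nonneg fun x ↦ Finset.sum_nonneg fun j _ ↦ by positivity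
  have : Nonempty (Fin n) := ⟨⟨0, by lia⟩⟩
  have hne : ∀ᵐ x : EuclideanSpace ℝ (Fin n), x ≠ 0 := by
    simp [ae_iff]
  have hlim : Filter.Tendsto
      (fun ε : ℝ ↦ ∫ x : EuclideanSpace ℝ (Fin n), ‖u x‖ ^ 2 * (‖x‖ ^ 2 + ε)⁻¹)
      (nhdsWithin 0 (Set.Ioi 0)) (nhds (∫ x, ‖u x‖ ^ 2 / ‖x‖ ^ 2)) := by
    refine tendsto_integral_filter_of_dominated_convergence _ ?_ ?_ hInt ?_
    · filter_upwards [self_mem_nhdsWithin] with ε hε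
      exact (continuous_norm_sq_mul_inv hu.continuous hε).aestronglyMeasurable
    · filter_upwards [self_mem_nhdsWithin] with ε hε
      have hε : 0 < ε := hε
      filter_upwards [hne] with x hx
      have hx : 0 < ‖x‖ := norm_pos_iff.2 hx
      rw [Real.norm_of_nonneg (by positivity), div_eq_mul_inv]
      gcongr
      linarith
    · filter_upwards [hne] with x hx
      have hx : ‖x‖ ^ 2 + 0 ≠ 0 := by simpa using hx
      have h : ContinuousAt (fun ε : ℝ ↦ ‖u x‖ ^ 2 * (‖x‖ ^ 2 + ε)⁻¹) 0 :=
        continuousAt_const.mul ((continuousAt_const.add continuousAt_id).inv₀ hx)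
      simpa [ContinuousAt, div_eq_mul_inv] using h.tendsto.mono_left nhdsWithin_le_nhds
  refine le_of_tendsto (hlim.const_mul _) ?_
  filter_upwards [self_mem_nhdsWithin] with ε hε
  exact hardy_inequality_regularized hu1 hsupp (by lia) hε
end

section
/- Let n ≥ 1 and let f : ℝⁿ∖{0} → ℂ be smooth. Set Δf = −Σ_{j=1}^n ∂²f/∂x_j², let ∂_r denote the radial derivative, let (Af)(x) = (∂_r f)(x) + ((n−1)/(2|x|)) f(x), and define the spherical Laplacian term by (Δ_θ f)(x) = |x|² ( (Δf)(x) + (∂_r(∂_r f))(x) + ((n−1)/|x|)(∂_r f)(x) ). Then for every x ≠ 0 the Morawetz commutator identity holds: Δ(Af)(x) − A(Δf)(x) = (2/|x|³)(Δ_θ f)(x) + ((n−1)(n−3)/(2|x|³)) f(x). -/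
/-- The radial derivative `(∂_r f)(x) = ⟨x/|x|, ∇f(x)⟩`, realized as the directional
derivative of `f` at `x` in the direction `x/‖x‖` (junk value `0` at `x = 0`). -/
noncomputable def radialDeriv {n : ℕ} (f : EuclideanSpace ℝ (Fin n) → ℂ)
    (x : EuclideanSpace ℝ (Fin n)) : ℂ :=
  fderiv ℝ f x (‖x‖⁻¹ • x)

/-- The (positive) Laplacian `Δf = −Σ_j ∂²f/∂x_j²`. -/
noncomputable def negLap {n : ℕ} (f : EuclideanSpace ℝ (Fin n) → ℂ)
    (x : EuclideanSpace ℝ (Fin n)) : ℂ :=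
  -∑ j : Fin n,
    fderiv ℝ (fun y => fderiv ℝ f y (EuclideanSpace.single j (1 : ℝ))) x
      (EuclideanSpace.single j (1 : ℝ))

/-- The anti-self-adjoint Morawetz commutant `A = ∂_r + (n−1)/(2r)`. -/
noncomputable def morawetzA {n : ℕ} (f : EuclideanSpace ℝ (Fin n) → ℂ)
    (x : EuclideanSpace ℝ (Fin n)) : ℂ :=
  radialDeriv f x + ((((n : ℝ) - 1) / (2 * ‖x‖) : ℝ) : ℂ) * f x

/-- The spherical (angular) Laplacian term, defined so that
`Δ = −∂_r² − ((n−1)/r)∂_r + Δ_θ/r²`: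
`(Δ_θ f)(x) = |x|² ( Δf(x) + ∂_r(∂_r f)(x) + ((n−1)/|x|)(∂_r f)(x) )`. -/
noncomputable def sphericalLap {n : ℕ} (f : EuclideanSpace ℝ (Fin n) → ℂ)
    (x : EuclideanSpace ℝ (Fin n)) : ℂ :=
  ((‖x‖ ^ 2 : ℝ) : ℂ) *
    (negLap f x + radialDeriv (radialDeriv f) x
      + ((((n : ℝ) - 1) / ‖x‖ : ℝ) : ℂ) * radialDeriv f x)

open scoped ContDiff

section DirectionalDerivatives

variable {V F : Type*} [NormedAddCommGroup V] [NormedSpace ℝ V]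
  [NormedAddCommGroup F] [NormedSpace ℝ F]

/-- The derivative of `f` in the constant direction `v`. -/
noncomputable def dirDeriv (v : V) (f : V → F) (x : V) : F := fderiv ℝ f x v

/-- The Euler operator `x · ∇`. -/
noncomputable def euler (f : V → F) (x : V) : F := fderiv ℝ f x x

variable {s : Set V} {f g : V → F} {a : V → ℝ} {x : V}

theorem ContDiffOn.differentiableAt_of_isOpen (hf : ContDiffOn ℝ ∞ f s) (hs : IsOpen s)
    (hx : x ∈ s) : DifferentiableAt ℝ f x :=
  (hf.contDiffAt (hs.mem_nhds hx)).differentiableAt (by simp)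

theorem ContDiffOn.dirDeriv (hf : ContDiffOn ℝ ∞ f s) (hs : IsOpen s) (v : V) :
    ContDiffOn ℝ ∞ (dirDeriv v f) s :=
  (hf.fderiv_of_isOpen hs (m := ∞) (by simp)).clm_apply contDiffOn_const

theorem ContDiffOn.euler (hf : ContDiffOn ℝ ∞ f s) (hs : IsOpen s) :
    ContDiffOn ℝ ∞ (euler f) s :=
  (hf.fderiv_of_isOpen hs (m := ∞) (by simp)).clm_apply contDiffOn_id

theorem Set.EqOn.dirDeriv (h : Set.EqOn f g s) (hs : IsOpen s) (v : V) :
    Set.EqOn (dirDeriv v f) (dirDeriv v g) s := fun x hx => by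
  simp only [_root_.dirDeriv, (h.eventuallyEq_of_mem (hs.mem_nhds hx)).fderiv_eq]

theorem dirDeriv_add (hf : DifferentiableAt ℝ f x) (hg : DifferentiableAt ℝ g x) (v : V) :
    dirDeriv v (fun y => f y + g y) x = dirDeriv v f x + dirDeriv v g x := by
  simp [dirDeriv, fderiv_fun_add hf hg]

theorem dirDeriv_smul (ha : DifferentiableAt ℝ a x) (hf : DifferentiableAt ℝ f x) (v : V) :
    dirDeriv v (fun y => a y • f y) x = a x • dirDeriv v f x + dirDeriv v a x • f x := by
  simp [dirDeriv, fderiv_fun_smul ha hf]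

theorem euler_add (hf : DifferentiableAt ℝ f x) (hg : DifferentiableAt ℝ g x) :
    euler (fun y => f y + g y) x = euler f x + euler g x :=
  dirDeriv_add hf hg x

theorem euler_smul (ha : DifferentiableAt ℝ a x) (hf : DifferentiableAt ℝ f x) :
    euler (fun y => a y • f y) x = a x • euler f x + euler a x • f x :=
  dirDeriv_smul ha hf x

/-- Second-order Leibniz rule for scalar multiplication. -/
theorem dirDeriv_dirDeriv_smul (hs : IsOpen s) (ha : ContDiffOn ℝ ∞ a s)
    (hf : ContDiffOn ℝ ∞ f s) (hx : x ∈ s) (v : V) :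
    dirDeriv v (dirDeriv v fun y => a y • f y) x =
      a x • dirDeriv v (dirDeriv v f) x + (2 : ℝ) • dirDeriv v a x • dirDeriv v f x
        + dirDeriv v (dirDeriv v a) x • f x := by
  have h : Set.EqOn (dirDeriv v fun y => a y • f y)
      (fun y => a y • dirDeriv v f y + dirDeriv v a y • f y) s := fun y hy =>
    dirDeriv_smul (ha.differentiableAt_of_isOpen hs hy) (hf.differentiableAt_of_isOpen hs hy) v
  have ha₀ := ha.differentiableAt_of_isOpen hs hx
  have hf₀ := hf.differentiableAt_of_isOpen hs hx
  have ha₁ := (ha.dirDeriv hs v).differentiableAt_of_isOpen hs hx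
  have hf₁ := (hf.dirDeriv hs v).differentiableAt_of_isOpen hs hx
  rw [h.dirDeriv hs v hx, dirDeriv_add (ha₀.fun_smul hf₁) (ha₁.fun_smul hf₀),
    dirDeriv_smul ha₀ hf₁, dirDeriv_smul ha₁ hf₀]
  module

theorem dirDeriv_dirDeriv_add (hs : IsOpen s) (hf : ContDiffOn ℝ ∞ f s)
    (hg : ContDiffOn ℝ ∞ g s) (hx : x ∈ s) (v : V) :
    dirDeriv v (dirDeriv v fun y => f y + g y) x =
      dirDeriv v (dirDeriv v f) x + dirDeriv v (dirDeriv v g) x := by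
  have h : Set.EqOn (dirDeriv v fun y => f y + g y)
      (fun y => dirDeriv v f y + dirDeriv v g y) s := fun y hy =>
    dirDeriv_add (hf.differentiableAt_of_isOpen hs hy) (hg.differentiableAt_of_isOpen hs hy) v
  rw [h.dirDeriv hs v hx, dirDeriv_add ((hf.dirDeriv hs v).differentiableAt_of_isOpen hs hx)
    ((hg.dirDeriv hs v).differentiableAt_of_isOpen hs hx)]

theorem dirDeriv_euler (hs : IsOpen s) (hf : ContDiffOn ℝ ∞ f s) (hx : x ∈ s) (v : V) :
    dirDeriv v (euler f) x = euler (dirDeriv v f) x + dirDeriv v f x := by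
  have hd := (hf.fderiv_of_isOpen hs (m := ∞) (by simp)).differentiableAt_of_isOpen hs hx
  have hsymm : IsSymmSndFDerivAt ℝ f x :=
    (hf.contDiffAt (hs.mem_nhds hx)).isSymmSndFDerivAt (by simpa using ENat.LEInfty.out)
  have h₁ : fderiv ℝ (euler f) x v = fderiv ℝ (fderiv ℝ f) x v x + fderiv ℝ f x v := by
    change fderiv ℝ (fun y => fderiv ℝ f y (id y)) x v = _
    rw [fderiv_clm_apply hd differentiableAt_id]
    simp [add_comm]
  have h₂ : fderiv ℝ (dirDeriv v f) x x = fderiv ℝ (fderiv ℝ f) x x v := by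
    change fderiv ℝ (fun y => fderiv ℝ f y v) x x = _
    rw [fderiv_clm_apply hd (differentiableAt_const v)]
    simp
  change fderiv ℝ (euler f) x v = fderiv ℝ (dirDeriv v f) x x + fderiv ℝ f x v
  rw [h₁, h₂, hsymm.eq v x]

theorem dirDeriv_dirDeriv_euler (hs : IsOpen s) (hf : ContDiffOn ℝ ∞ f s) (hx : x ∈ s) (v : V) :
    dirDeriv v (dirDeriv v (euler f)) x =
      euler (dirDeriv v (dirDeriv v f)) x + (2 : ℝ) • dirDeriv v (dirDeriv v f) x := by
  have hfv := hf.dirDeriv hs v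
  have h : Set.EqOn (dirDeriv v (euler f))
      (fun y => euler (dirDeriv v f) y + dirDeriv v f y) s := fun y hy =>
    dirDeriv_euler hs hf hy v
  rw [h.dirDeriv hs v hx, dirDeriv_add ((hfv.euler hs).differentiableAt_of_isOpen hs hx)
    (hfv.differentiableAt_of_isOpen hs hx), dirDeriv_euler hs hfv hx]
  module

end DirectionalDerivatives

section InverseNorm

variable {V : Type*} [NormedAddCommGroup V] [InnerProductSpace ℝ V] {x : V}

theorem contDiffOn_norm_inv : ContDiffOn ℝ ∞ (fun y : V => ‖y‖⁻¹) {y | y ≠ 0} := fun _ hy =>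
  ((contDiffAt_norm ℝ hy).inv (norm_ne_zero_iff.2 hy)).contDiffWithinAt

theorem dirDeriv_norm_inv (hx : x ≠ 0) (v : V) :
    dirDeriv v (fun y : V => ‖y‖⁻¹) x = -(‖x‖⁻¹ ^ 3 * inner ℝ x v) := by
  have hx' : ‖x‖ ≠ 0 := norm_ne_zero_iff.2 hx
  have h := (hasDerivAt_inv (by simpa using hx')).comp_hasFDerivAt x
    ((hasStrictFDerivAt_norm_sq x).hasFDerivAt.sqrt (pow_ne_zero 2 hx'))
  simp only [Function.comp_def, Real.sqrt_sq (norm_nonneg _)] at h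
  simp only [dirDeriv, h.fderiv]
  simp
  field_simp

theorem dirDeriv_dirDeriv_norm_inv (hx : x ≠ 0) (v : V) :
    dirDeriv v (dirDeriv v fun y : V => ‖y‖⁻¹) x =
      3 * ‖x‖⁻¹ ^ 5 * inner ℝ x v ^ 2 - ‖x‖⁻¹ ^ 3 * ‖v‖ ^ 2 := by
  have hs : IsOpen {y : V | y ≠ 0} := isOpen_ne
  have h : Set.EqOn (dirDeriv v fun y : V => ‖y‖⁻¹)
      (fun y => -(‖y‖⁻¹ ^ 3 * inner ℝ y v)) {y | y ≠ 0} := fun y hy => dirDeriv_norm_inv hy v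
  have hd := (contDiffOn_norm_inv (V := V)).differentiableAt_of_isOpen hs hx
  have hi : HasFDerivAt (fun y : V => inner ℝ y v) (innerSL ℝ v) x := by
    have h := (innerSL ℝ v).hasFDerivAt (x := x)
    rwa [show ⇑(innerSL ℝ v) = fun y => inner ℝ y v from
      funext fun y => real_inner_comm y v] at h
  have hd' := dirDeriv_norm_inv hx v
  have hp := ((hd.hasFDerivAt.pow 3).fun_mul hi).fun_neg
  rw [h.dirDeriv hs v hx]
  simp only [dirDeriv] at hd' ⊢
  rw [HasFDerivAt.fderiv hp]
  simp [hd']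
  ring

theorem euler_norm_inv (hx : x ≠ 0) : euler (fun y : V => ‖y‖⁻¹) x = -‖x‖⁻¹ := by
  have hx' : ‖x‖ ≠ 0 := norm_ne_zero_iff.2 hx
  change dirDeriv x (fun y : V => ‖y‖⁻¹) x = _
  rw [dirDeriv_norm_inv hx, real_inner_self_eq_norm_sq]
  field_simp

end InverseNorm

section Laplacian

variable {n : ℕ} {f g : EuclideanSpace ℝ (Fin n) → ℂ} {x : EuclideanSpace ℝ (Fin n)}

theorem negLap_eq_sum_dirDeriv (f : EuclideanSpace ℝ (Fin n) → ℂ) (x) :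
    negLap f x = -∑ j, dirDeriv (EuclideanSpace.single j (1 : ℝ))
      (dirDeriv (EuclideanSpace.single j (1 : ℝ)) f) x := rfl

theorem sum_inner_single_smul_dirDeriv (f : EuclideanSpace ℝ (Fin n) → ℂ) (x) :
    ∑ j, inner ℝ x (EuclideanSpace.single j (1 : ℝ)) •
      dirDeriv (EuclideanSpace.single j (1 : ℝ)) f x = euler f x := by
  have h := (EuclideanSpace.basisFun (Fin n) ℝ).sum_repr x
  simp only [EuclideanSpace.basisFun_repr, EuclideanSpace.basisFun_apply] at h
  simp only [euler, dirDeriv]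
  conv_rhs => rw [← congrArg (fderiv ℝ f x) h]
  simp [EuclideanSpace.inner_single_right]

theorem sum_inner_single_sq (x : EuclideanSpace ℝ (Fin n)) :
    ∑ j, inner ℝ x (EuclideanSpace.single j (1 : ℝ)) ^ 2 = ‖x‖ ^ 2 := by
  simp [EuclideanSpace.norm_sq_eq, EuclideanSpace.inner_single_right]

theorem negLap_euler_add_const_smul {s : Set (EuclideanSpace ℝ (Fin n))} (hs : IsOpen s)
    (hf : ContDiffOn ℝ ∞ f s) (hx : x ∈ s) (c : ℝ) :
    negLap (fun y => euler f y + c • f y) x =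
      euler (negLap f) x + (2 + c) • negLap f x := by
  have hd (j : Fin n) := ((hf.dirDeriv hs (EuclideanSpace.single j (1 : ℝ))).dirDeriv hs
    (EuclideanSpace.single j (1 : ℝ))).differentiableAt_of_isOpen hs hx
  have hE : euler (negLap f) x = -∑ j, euler (dirDeriv (EuclideanSpace.single j (1 : ℝ))
      (dirDeriv (EuclideanSpace.single j (1 : ℝ)) f)) x := by
    change fderiv ℝ (fun y => -∑ j, dirDeriv (EuclideanSpace.single j (1 : ℝ))
      (dirDeriv (EuclideanSpace.single j (1 : ℝ)) f) y) x x = _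
    rw [fderiv_fun_neg, fderiv_fun_sum fun j _ => hd j]
    simp [euler]
  have hconst (v : EuclideanSpace ℝ (Fin n)) : dirDeriv v (dirDeriv v fun y => c • f y) x =
      c • dirDeriv v (dirDeriv v f) x := by
    rw [dirDeriv_dirDeriv_smul hs contDiffOn_const hf hx]
    have h : dirDeriv v (fun _ : EuclideanSpace ℝ (Fin n) => c) = fun _ => 0 := by
      ext; simp [dirDeriv]
    simp [h, dirDeriv]
  rw [hE]
  simp only [negLap_eq_sum_dirDeriv, dirDeriv_dirDeriv_add hs (hf.euler hs) (hf.const_smul c) hx,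
    dirDeriv_dirDeriv_euler hs hf hx, hconst, Finset.sum_add_distrib, ← Finset.smul_sum]
  module

theorem negLap_norm_inv_smul (hf : ContDiffOn ℝ ∞ f {y | y ≠ 0}) (hx : x ≠ 0) :
    negLap (fun y => ‖y‖⁻¹ • f y) x =
      ‖x‖⁻¹ • negLap f x + (2 * ‖x‖⁻¹ ^ 3) • euler f x + ((n - 3) * ‖x‖⁻¹ ^ 3) • f x := by
  have hx' : ‖x‖ ≠ 0 := norm_ne_zero_iff.2 hx
  simp only [negLap_eq_sum_dirDeriv, dirDeriv_dirDeriv_smul isOpen_ne contDiffOn_norm_inv hf hx,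
    dirDeriv_norm_inv hx, dirDeriv_dirDeriv_norm_inv hx, Finset.sum_add_distrib,
    ← Finset.smul_sum, ← Finset.sum_smul, Finset.sum_sub_distrib, ← Finset.mul_sum,
    sum_inner_single_sq, neg_smul, mul_smul, Finset.sum_neg_distrib,
    sum_inner_single_smul_dirDeriv]
  have hx'' : (‖x‖ : ℂ) ≠ 0 := by exact_mod_cast hx'
  simp
  field_simp
  ring

theorem radialDeriv_eq (f : EuclideanSpace ℝ (Fin n) → ℂ) :
    radialDeriv f = fun y => ‖y‖⁻¹ • euler f y := by
  ext y
  simp only [radialDeriv, euler, map_smul]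

theorem morawetzA_eq (f : EuclideanSpace ℝ (Fin n) → ℂ) :
    morawetzA f = fun y => ‖y‖⁻¹ • (euler f y + (((n : ℝ) - 1) / 2) • f y) := by
  ext y
  simp only [morawetzA, radialDeriv_eq, smul_add, Complex.real_smul]
  push_cast
  ring

end Laplacian

/-- **The Morawetz commutator identity**: for smooth `f` on `ℝⁿ ∖ {0}` and `x ≠ 0`,
`[Δ, ∂_r + (n−1)/(2r)] f (x) = (2/|x|³)(Δ_θ f)(x) + ((n−1)(n−3)/(2|x|³)) f(x)`. -/
theorem morawetz_commutator (n : ℕ) (hn : 1 ≤ n)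
    (f : EuclideanSpace ℝ (Fin n) → ℂ)
    (hf : ContDiffOn ℝ (⊤ : ℕ∞) f {x | x ≠ 0}) :
    ∀ x : EuclideanSpace ℝ (Fin n), x ≠ 0 →
      negLap (fun y => morawetzA f y) x - morawetzA (negLap f) x
        = ((2 / ‖x‖ ^ 3 : ℝ) : ℂ) * sphericalLap f x
          + (((((n : ℝ) - 1) * ((n : ℝ) - 3)) / (2 * ‖x‖ ^ 3) : ℝ) : ℂ) * f x := by
  intro x hx
  have hs : IsOpen {y : EuclideanSpace ℝ (Fin n) | y ≠ 0} := isOpen_ne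
  have hE := hf.euler hs
  have hE₀ := hE.differentiableAt_of_isOpen hs hx
  have hf₀ := hf.differentiableAt_of_isOpen hs hx
  have hr := (contDiffOn_norm_inv (V := EuclideanSpace ℝ (Fin n))).differentiableAt_of_isOpen hs hx
  have hx' : (‖x‖ : ℂ) ≠ 0 := by exact_mod_cast norm_ne_zero_iff.2 hx
  have hc : euler (fun y => (((n : ℝ) - 1) / 2) • f y) x = (((n : ℝ) - 1) / 2) • euler f x := by
    simp only [euler, fderiv_fun_const_smul hf₀, smul_apply]
  simp only [sphericalLap, morawetzA_eq, radialDeriv_eq]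
  rw [negLap_norm_inv_smul (hE.add (hf.const_smul _)) hx,
    negLap_euler_add_const_smul hs hf hx, euler_add hE₀ (hf₀.fun_const_smul _), hc,
    euler_smul hr hE₀, euler_norm_inv hx]
  simp only [Complex.real_smul]
  push_cast
  field_simp
  ring
end

section
/- Let n ≥ 3. There is a constant C (depending only on n) such that for every Schwartz function u ∈ 𝒮(ℝⁿ), | ∫_{ℝⁿ} (∂_r u)(x) · conj(u(x)) dx | ≤ C ‖u‖²_{H^{1/2}}. -/
open MeasureTheory
open scoped RealInnerProductSpace

/-- The Fourier transform `û(ξ) = (2π)^{-n/2} ∫ u(x) e^{-i x·ξ} dx`. -/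
noncomputable def fourierT {n : ℕ} (u : EuclideanSpace ℝ (Fin n) → ℂ)
    (ξ : EuclideanSpace ℝ (Fin n)) : ℂ :=
  ((2 * Real.pi) ^ (-(n : ℝ) / 2) : ℝ) *
    ∫ x, Complex.exp (-Complex.I * (⟪x, ξ⟫ : ℝ)) * u x

/-- The squared Sobolev norm `‖u‖²_{H^s} = ∫ (1+|ξ|²)^s |û(ξ)|² dξ`. -/
noncomputable def sobolevNormSq {n : ℕ} (s : ℝ) (u : EuclideanSpace ℝ (Fin n) → ℂ) : ℝ :=
  ∫ ξ, (1 + ‖ξ‖ ^ 2) ^ s * ‖fourierT u ξ‖ ^ 2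

/-- Integration by parts against the radial field `x ↦ φ x • x`. -/
theorem integral_smul_fderiv_self {n : ℕ} {φ : EuclideanSpace ℝ (Fin n) → ℝ}
    {h : EuclideanSpace ℝ (Fin n) → ℂ} (hφ : ContDiff ℝ 1 φ) (hh : Differentiable ℝ h)
    (hi : Integrable h) (hi' : Integrable (fderiv ℝ h)) {M : ℝ} (b0 : ∀ x, |φ x| ≤ M)
    (b1 : ∀ x, |φ x| * ‖x‖ ≤ M) (b2 : ∀ x, ‖fderiv ℝ φ x‖ * ‖x‖ ≤ M) :
    ∫ x, φ x • fderiv ℝ h x x = -∫ x, (n * φ x + fderiv ℝ φ x x) • h x := by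
  have hφd : Differentiable ℝ φ := hφ.differentiable one_ne_zero
  have hφ' : Continuous (fderiv ℝ φ) := hφ.continuous_fderiv one_ne_zero
  set e : Fin n → EuclideanSpace ℝ (Fin n) := fun i => EuclideanSpace.single i (1 : ℝ) with he
  have hen : ∀ i, ‖e i‖ = 1 := fun i => by simp [he]
  have hcoord : ∀ x : EuclideanSpace ℝ (Fin n), x = ∑ i, x i • e i := fun x => by
    have := (EuclideanSpace.basisFun (Fin n) ℝ).sum_repr x
    simpa [he] using this.symm
  have hproj : ∀ (i : Fin n) (x : EuclideanSpace ℝ (Fin n)),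
      HasFDerivAt (fun y : EuclideanSpace ℝ (Fin n) => φ y * y i)
        (φ x • (EuclideanSpace.proj i : EuclideanSpace ℝ (Fin n) →L[ℝ] ℝ) +
          x i • fderiv ℝ φ x) x := fun i x =>
    (hφd x).hasFDerivAt.mul (EuclideanSpace.proj (𝕜 := ℝ) i).hasFDerivAt
  have hcx : ∀ (x : EuclideanSpace ℝ (Fin n)) i, |x i| ≤ ‖x‖ := fun x i =>
    PiLp.norm_apply_le x i
  have hci : ∀ i : Fin n, Continuous fun x : EuclideanSpace ℝ (Fin n) => x i := fun i => by
    fun_prop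
  have i1 : ∀ i, Integrable fun x => (φ x * x i) • fderiv ℝ h x (e i) := fun i => by
    refine Integrable.bdd_smul (hi'.apply_continuousLinearMap (e i)) M
      (hφ.continuous.mul (hci i)).aestronglyMeasurable (.of_forall fun x => ?_)
    change |φ x * x i| ≤ M
    rw [abs_mul]
    exact (mul_le_mul_of_nonneg_left (hcx x i) (abs_nonneg _)).trans (b1 x)
  have i2 : ∀ i, Integrable fun x => (φ x + x i * fderiv ℝ φ x (e i)) • h x := fun i => by
    refine Integrable.bdd_smul hi (M + M)
      (hφ.continuous.add ((hci i).mul (hφ'.clm_apply continuous_const))).aestronglyMeasurable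
      (.of_forall fun x => ?_)
    refine (norm_add_le _ _).trans (add_le_add (b0 x) ?_)
    change ‖x i * fderiv ℝ φ x (e i)‖ ≤ M
    rw [norm_mul, mul_comm]
    refine le_trans ?_ (b2 x)
    refine mul_le_mul ?_ (hcx x i) (norm_nonneg _) (norm_nonneg _)
    simpa [hen] using (fderiv ℝ φ x).le_opNorm (e i)
  have i3 : ∀ i, Integrable fun x : EuclideanSpace ℝ (Fin n) => (φ x * x i) • h x := fun i => by
    refine Integrable.bdd_smul hi M
      (hφ.continuous.mul (hci i)).aestronglyMeasurable (.of_forall fun x => ?_)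
    change |φ x * x i| ≤ M
    rw [abs_mul]
    exact (mul_le_mul_of_nonneg_left (hcx x i) (abs_nonneg _)).trans (b1 x)
  have hd : ∀ i x, fderiv ℝ (fun y : EuclideanSpace ℝ (Fin n) => φ y * y i) x (e i) =
      φ x + x i * fderiv ℝ φ x (e i) := fun i x => by
    rw [(hproj i x).fderiv]; simp [he]
  have key : ∀ i, ∫ x, (φ x * x i) • fderiv ℝ h x (e i) =
      -∫ x, (φ x + x i * fderiv ℝ φ x (e i)) • h x := fun i => by
    have := integral_smul_fderiv_eq_neg_fderiv_smul_of_integrable (μ := volume)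
      (f := fun y : EuclideanSpace ℝ (Fin n) => φ y * y i) (g := h) (v := e i)
      (by simpa only [hd] using i2 i) (i1 i) (i3 i)
      (fun x _ => (hproj i x).differentiableAt) (fun x _ => hh x)
    simpa only [hd] using this
  have hL : ∀ x, φ x • fderiv ℝ h x x = ∑ i, (φ x * x i) • fderiv ℝ h x (e i) := fun x => by
    conv_lhs => rw [hcoord x, map_sum, ← hcoord x]
    simp [Finset.smul_sum, mul_assoc]
  have hR : ∀ x, (n * φ x + fderiv ℝ φ x x) • h x =
      ∑ i, (φ x + x i * fderiv ℝ φ x (e i)) • h x := fun x => by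
    have : fderiv ℝ φ x x = ∑ i, x i * fderiv ℝ φ x (e i) := by
      conv_lhs => rw [hcoord x, map_sum, ← hcoord x]
      simp
    rw [this, ← Finset.sum_smul, Finset.sum_add_distrib]
    simp
  simp_rw [hL, hR]
  rw [integral_finsetSum _ fun i _ => i1 i, integral_finsetSum _ fun i _ => i2 i,
    ← Finset.sum_neg_distrib]
  exact Finset.sum_congr rfl fun i _ => key i

/-- The derivative of the regularized power `(|x|² + ε) ^ r`. -/
theorem hasFDerivAt_norm_sq_add_rpow {n : ℕ} {ε : ℝ} (hε : 0 < ε) (r : ℝ)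
    (x : EuclideanSpace ℝ (Fin n)) :
    HasFDerivAt (fun y : EuclideanSpace ℝ (Fin n) => (‖y‖ ^ 2 + ε) ^ r)
      ((2 * r * (‖x‖ ^ 2 + ε) ^ (r - 1)) • innerSL ℝ x) x := by
  have hs : ‖x‖ ^ 2 + ε ≠ 0 := by positivity
  have := ((hasStrictFDerivAt_norm_sq x).hasFDerivAt.add_const ε).rpow_const (p := r) (Or.inl hs)
  have h2 : (2 * r * (‖x‖ ^ 2 + ε) ^ (r - 1)) • innerSL ℝ x =
      (r * (‖x‖ ^ 2 + ε) ^ (r - 1)) • 2 • innerSL ℝ x := by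
    ext y
    simp
    ring
  rw [h2]
  exact this

theorem integral_rpow_smul_radial_pairing {n : ℕ} {ε r : ℝ} (hε : 0 < ε) (hr : r ≤ -1 / 2)
    (u v : SchwartzMap (EuclideanSpace ℝ (Fin n)) ℂ) :
    ∫ x, (‖x‖ ^ 2 + ε) ^ r • (fderiv ℝ u x x * (starRingEnd ℂ) (v x) +
        u x * (starRingEnd ℂ) (fderiv ℝ v x x)) =
      -∫ x, (n * (‖x‖ ^ 2 + ε) ^ r + 2 * r * ‖x‖ ^ 2 * (‖x‖ ^ 2 + ε) ^ (r - 1)) •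
        (u x * (starRingEnd ℂ) (v x)) := by
  set h : EuclideanSpace ℝ (Fin n) → ℂ := fun x => u x * (starRingEnd ℂ) (v x) with hh
  have hs : ∀ x : EuclideanSpace ℝ (Fin n), 0 < ‖x‖ ^ 2 + ε := fun x => by positivity
  have hd : ∀ x, HasFDerivAt h (u x • (Complex.conjCLE.toContinuousLinearMap.comp (fderiv ℝ v x)) +
      (starRingEnd ℂ) (v x) • fderiv ℝ u x) x := fun x =>
    (u.differentiableAt.hasFDerivAt).mul
      ((Complex.conjCLE.toContinuousLinearMap.hasFDerivAt).comp x v.differentiableAt.hasFDerivAt)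
  have hcv : Continuous fun x => (starRingEnd ℂ) (v x) :=
    Complex.continuous_conj.comp v.continuous
  have hi : Integrable h := by
    refine u.integrable.mul_bdd (c := SchwartzMap.seminorm ℝ 0 0 v)
      hcv.aestronglyMeasurable (.of_forall fun x => ?_)
    simpa using v.norm_le_seminorm ℝ x
  have hDu := (SchwartzMap.fderivCLM ℝ (EuclideanSpace ℝ (Fin n)) ℂ u).integrable (μ := volume)
  have hDv := (SchwartzMap.fderivCLM ℝ (EuclideanSpace ℝ (Fin n)) ℂ v).integrable (μ := volume)
  have hi' : Integrable (fderiv ℝ h) := by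
    have : fderiv ℝ h = fun x => u x • (Complex.conjCLE.toContinuousLinearMap.comp (fderiv ℝ v x)) +
      (starRingEnd ℂ) (v x) • fderiv ℝ u x := funext fun x => (hd x).fderiv
    rw [this]
    have hDv' : Integrable fun x => Complex.conjCLE.toContinuousLinearMap.comp (fderiv ℝ v x) :=
      (ContinuousLinearMap.compL ℝ (EuclideanSpace ℝ (Fin n)) ℂ ℂ
        Complex.conjCLE.toContinuousLinearMap).integrable_comp hDv
    have hDu' : Integrable (fderiv ℝ u) := hDu
    exact (hDv'.bdd_smul (SchwartzMap.seminorm ℝ 0 0 u) u.continuous.aestronglyMeasurable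
        (.of_forall fun x => u.norm_le_seminorm ℝ x)).add
      (hDu'.bdd_smul (SchwartzMap.seminorm ℝ 0 0 v) hcv.aestronglyMeasurable
        (.of_forall fun x => by simpa using v.norm_le_seminorm ℝ x))
  have hφ : ContDiff ℝ 1 fun y : EuclideanSpace ℝ (Fin n) => (‖y‖ ^ 2 + ε) ^ r :=
    ContDiff.rpow_const_of_ne (((contDiff_norm_sq ℝ).of_le le_top).add contDiff_const) fun x => (hs x).ne'
  have hmono : ∀ (p : ℝ) (x : EuclideanSpace ℝ (Fin n)), p ≤ 0 → (‖x‖ ^ 2 + ε) ^ p ≤ ε ^ p :=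
    fun p x hp => Real.rpow_le_rpow_of_nonpos hε (by nlinarith [sq_nonneg ‖x‖]) hp
  have hnorm : ∀ x : EuclideanSpace ℝ (Fin n), ‖x‖ ≤ (‖x‖ ^ 2 + ε) ^ (1 / 2 : ℝ) := fun x => by
    rw [← Real.sqrt_eq_rpow]
    exact Real.le_sqrt_of_sq_le (by linarith)
  have e0 : 0 ≤ ε ^ r := by positivity
  have e1 : 0 ≤ ε ^ (r + 1 / 2) := by positivity
  have e2 : 0 ≤ 2 * |r| * ε ^ r := by positivity
  have main := integral_smul_fderiv_self (M := ε ^ r + ε ^ (r + 1 / 2) + 2 * |r| * ε ^ r)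
    hφ (fun x => (hd x).differentiableAt) hi hi' (fun x => ?_) (fun x => ?_) (fun x => ?_)
  · have hφx : ∀ x : EuclideanSpace ℝ (Fin n),
        fderiv ℝ (fun y : EuclideanSpace ℝ (Fin n) => (‖y‖ ^ 2 + ε) ^ r) x x =
          2 * r * ‖x‖ ^ 2 * (‖x‖ ^ 2 + ε) ^ (r - 1) := fun x => by
      rw [(hasFDerivAt_norm_sq_add_rpow hε r x).fderiv]
      simp
      ring
    have hhx : ∀ x, fderiv ℝ h x x = fderiv ℝ u x x * (starRingEnd ℂ) (v x) +
        u x * (starRingEnd ℂ) (fderiv ℝ v x x) := fun x => by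
      rw [(hd x).fderiv]
      simp
      ring
    simpa only [hφx, hhx] using main
  · rw [abs_of_pos (Real.rpow_pos_of_pos (hs x) r)]
    linarith [hmono r x (by linarith)]
  · rw [abs_of_pos (Real.rpow_pos_of_pos (hs x) r)]
    have := mul_le_mul_of_nonneg_left (hnorm x) (Real.rpow_pos_of_pos (hs x) r).le
    rw [← Real.rpow_add (hs x)] at this
    linarith [hmono (r + 1 / 2) x (by linarith)]
  · rw [(hasFDerivAt_norm_sq_add_rpow hε r x).fderiv, norm_smul, innerSL_apply_norm]
    have h1 : (‖x‖ ^ 2 + ε) ^ (r - 1) * ‖x‖ ^ 2 ≤ (‖x‖ ^ 2 + ε) ^ r := by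
      calc (‖x‖ ^ 2 + ε) ^ (r - 1) * ‖x‖ ^ 2
          ≤ (‖x‖ ^ 2 + ε) ^ (r - 1) * (‖x‖ ^ 2 + ε) := by gcongr; linarith
        _ = (‖x‖ ^ 2 + ε) ^ r := by
          rw [← Real.rpow_add_one (hs x).ne', sub_add_cancel]
    have h2 : ‖2 * r * (‖x‖ ^ 2 + ε) ^ (r - 1)‖ * ‖x‖ * ‖x‖ =
        2 * |r| * ((‖x‖ ^ 2 + ε) ^ (r - 1) * ‖x‖ ^ 2) := by
      rw [norm_mul, norm_mul, Real.norm_eq_abs, Real.norm_eq_abs, Real.norm_eq_abs, abs_two,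
        abs_of_pos (Real.rpow_pos_of_pos (hs x) _)]
      ring
    rw [h2]
    have := mul_le_mul_of_nonneg_left (h1.trans (hmono r x (by linarith)))
      (by positivity : 0 ≤ 2 * |r|)
    linarith

theorem SchwartzMap.integrable_norm_sq' {n : ℕ} {F : Type*} [NormedAddCommGroup F]
    [NormedSpace ℝ F] (u : SchwartzMap (EuclideanSpace ℝ (Fin n)) F) :
    Integrable fun x => ‖u x‖ ^ 2 :=
  (u.memLp 2).integrable_norm_pow two_ne_zero

theorem SchwartzMap.integrable_norm_fderiv_sq {n : ℕ}
    (u : SchwartzMap (EuclideanSpace ℝ (Fin n)) ℂ) :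
    Integrable fun x => ‖fderiv ℝ u x‖ ^ 2 :=
  (SchwartzMap.fderivCLM ℝ (EuclideanSpace ℝ (Fin n)) ℂ u).integrable_norm_sq'

/-- A regularized Hardy inequality. -/
theorem integral_hardy_le {n : ℕ} (hn : 3 ≤ n) {ε : ℝ} (hε : 0 < ε)
    (v : SchwartzMap (EuclideanSpace ℝ (Fin n)) ℂ) :
    Integrable (fun x => (‖x‖ ^ 2 + ε) ^ (-1 : ℝ) * ‖v x‖ ^ 2) ∧
    ∫ x, (‖x‖ ^ 2 + ε) ^ (-1 : ℝ) * ‖v x‖ ^ 2 ≤ 4 * ∫ x, ‖fderiv ℝ v x‖ ^ 2 := by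
  have hs : ∀ x : EuclideanSpace ℝ (Fin n), 0 < ‖x‖ ^ 2 + ε := fun x => by positivity
  have hc : ∀ r : ℝ, Continuous fun x : EuclideanSpace ℝ (Fin n) => (‖x‖ ^ 2 + ε) ^ r := fun r =>
    Continuous.rpow_const (by fun_prop) fun x => Or.inl (hs x).ne'
  have hn' : (3 : ℝ) ≤ n := by exact_mod_cast hn
  have hA : ∀ x : EuclideanSpace ℝ (Fin n), (‖x‖ ^ 2 + ε) ^ (-1 : ℝ) * (‖x‖ ^ 2 + ε) = 1 :=
    fun x => by rw [Real.rpow_neg_one, inv_mul_cancel₀ (hs x).ne']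
  have hB : ∀ x : EuclideanSpace ℝ (Fin n),
      (‖x‖ ^ 2 + ε) ^ (-1 - 1 : ℝ) * (‖x‖ ^ 2 + ε) = (‖x‖ ^ 2 + ε) ^ (-1 : ℝ) :=
    fun x => by rw [← Real.rpow_add_one (hs x).ne', sub_add_cancel]
  have hApos : ∀ x : EuclideanSpace ℝ (Fin n), 0 < (‖x‖ ^ 2 + ε) ^ (-1 : ℝ) :=
    fun x => Real.rpow_pos_of_pos (hs x) _
  have hBpos : ∀ x : EuclideanSpace ℝ (Fin n), 0 < (‖x‖ ^ 2 + ε) ^ (-1 - 1 : ℝ) :=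
    fun x => Real.rpow_pos_of_pos (hs x) _
  have hBx : ∀ x : EuclideanSpace ℝ (Fin n),
      (‖x‖ ^ 2 + ε) ^ (-1 - 1 : ℝ) * ‖x‖ ^ 2 ≤ (‖x‖ ^ 2 + ε) ^ (-1 : ℝ) := fun x => by
    nlinarith [hB x, hBpos x]
  have hAx : ∀ x : EuclideanSpace ℝ (Fin n), (‖x‖ ^ 2 + ε) ^ (-1 : ℝ) * ‖x‖ ^ 2 ≤ 1 := fun x => by
    nlinarith [hA x, hApos x]
  have hAle : ∀ x : EuclideanSpace ℝ (Fin n), (‖x‖ ^ 2 + ε) ^ (-1 : ℝ) ≤ ε⁻¹ := fun x => by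
    rw [Real.rpow_neg_one]
    exact inv_anti₀ hε (by nlinarith [sq_nonneg ‖x‖])
  have i0 : Integrable fun x => (‖x‖ ^ 2 + ε) ^ (-1 : ℝ) * ‖v x‖ ^ 2 :=
    v.integrable_norm_sq'.bdd_mul (c := ε⁻¹) (hc _).aestronglyMeasurable
      (.of_forall fun x => by
        rw [Real.norm_of_nonneg (hApos x).le]
        exact hAle x)
  have i1 : Integrable fun x => (n * (‖x‖ ^ 2 + ε) ^ (-1 : ℝ) +
      2 * (-1) * ‖x‖ ^ 2 * (‖x‖ ^ 2 + ε) ^ (-1 - 1 : ℝ)) * ‖v x‖ ^ 2 := by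
    refine (i0.const_mul (n + 2 : ℝ)).mono' ?_ (.of_forall fun x => ?_)
    · refine Continuous.aestronglyMeasurable (.mul (.add (continuous_const.mul (hc _))
        (.mul (by fun_prop) (hc _))) (v.continuous.norm.pow 2))
    · rw [norm_mul, Real.norm_of_nonneg (sq_nonneg ‖v x‖), ← mul_assoc]
      refine mul_le_mul_of_nonneg_right ?_ (sq_nonneg _)
      rw [Real.norm_eq_abs, abs_le]
      have := mul_nonneg (hBpos x).le (sq_nonneg ‖x‖)
      have := mul_nonneg (hApos x).le (by linarith : (0 : ℝ) ≤ n)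
      constructor <;> nlinarith [hBx x, hApos x]
  have hup := (v.integrable_norm_fderiv_sq.const_mul 2).add (i0.const_mul (1 / 2))
  refine ⟨i0, ?_⟩
  have key := integral_rpow_smul_radial_pairing (r := -1) hε (by norm_num) v v
  have hconj : ∀ x, (n * (‖x‖ ^ 2 + ε) ^ (-1 : ℝ) +
      2 * (-1) * ‖x‖ ^ 2 * (‖x‖ ^ 2 + ε) ^ (-1 - 1 : ℝ)) • (v x * (starRingEnd ℂ) (v x)) =
      (((n * (‖x‖ ^ 2 + ε) ^ (-1 : ℝ) +
      2 * (-1) * ‖x‖ ^ 2 * (‖x‖ ^ 2 + ε) ^ (-1 - 1 : ℝ)) * ‖v x‖ ^ 2 : ℝ) : ℂ) := fun x => by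
    rw [Complex.mul_conj, Complex.normSq_eq_norm_sq, Complex.real_smul, ← Complex.ofReal_mul]
  simp_rw [hconj] at key
  rw [integral_complex_ofReal] at key
  have h1 := congrArg norm key
  rw [norm_neg, Complex.norm_real] at h1
  have h2 := norm_integral_le_of_norm_le hup (f := fun x => (‖x‖ ^ 2 + ε) ^ (-1 : ℝ) •
    (fderiv ℝ v x x * (starRingEnd ℂ) (v x) + v x * (starRingEnd ℂ) (fderiv ℝ v x x)))
    (.of_forall fun x => by
      have hop := (fderiv ℝ v x).le_opNorm x
      rw [norm_smul, Real.norm_of_nonneg (hApos x).le]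
      have h3 : ‖fderiv ℝ v x x * (starRingEnd ℂ) (v x) + v x * (starRingEnd ℂ) (fderiv ℝ v x x)‖
          ≤ 2 * (‖fderiv ℝ v x‖ * ‖x‖ * ‖v x‖) := by
        refine (norm_add_le _ _).trans ?_
        rw [norm_mul, norm_mul, RCLike.norm_conj, RCLike.norm_conj]
        nlinarith [mul_le_mul_of_nonneg_right hop (norm_nonneg (v x))]
      refine (mul_le_mul_of_nonneg_left h3 (hApos x).le).trans ?_
      simp only [Pi.add_apply]
      nlinarith [mul_nonneg (hApos x).le (sq_nonneg (‖v x‖ - 2 * (‖x‖ * ‖fderiv ℝ v x‖))),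
        mul_le_mul_of_nonneg_right (hAx x) (sq_nonneg ‖fderiv ℝ v x‖)])
  rw [h1] at h2
  have h3 := integral_mono i0 i1 fun x => by
    refine mul_le_mul_of_nonneg_right ?_ (sq_nonneg ‖v x‖)
    nlinarith [hBx x, hApos x]
  have h4 := h3.trans ((le_abs_self _).trans h2)
  simp only [Pi.add_apply] at h4
  rw [integral_add (v.integrable_norm_fderiv_sq.const_mul 2) (i0.const_mul (1 / 2)),
    integral_const_mul, integral_const_mul] at h4
  linarith

theorem radialDeriv_eq_smul {n : ℕ} (f : EuclideanSpace ℝ (Fin n) → ℂ)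
    (x : EuclideanSpace ℝ (Fin n)) : radialDeriv f x = ‖x‖⁻¹ • fderiv ℝ f x x := by
  rw [radialDeriv, map_smul]

theorem norm_radialDeriv_le {n : ℕ} (f : EuclideanSpace ℝ (Fin n) → ℂ)
    (x : EuclideanSpace ℝ (Fin n)) : ‖radialDeriv f x‖ ≤ ‖fderiv ℝ f x‖ := by
  refine ((fderiv ℝ f x).le_opNorm _).trans (mul_le_of_le_one_right (norm_nonneg _) ?_)
  rw [norm_smul, norm_inv, norm_norm]
  exact inv_mul_le_one

theorem two_mul_le_weighted_sq {t : ℝ} (ht : 0 < t) (a b : ℝ) :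
    2 * (a * b) ≤ t * a ^ 2 + t⁻¹ * b ^ 2 := by
  have h : t * a ^ 2 + t⁻¹ * b ^ 2 - 2 * (a * b) = t⁻¹ * (t * a - b) ^ 2 := by
    field_simp
    ring
  have : 0 ≤ t⁻¹ * (t * a - b) ^ 2 := by positivity
  linarith

theorem SchwartzMap.continuous_fderiv_self {n : ℕ}
    (u : SchwartzMap (EuclideanSpace ℝ (Fin n)) ℂ) : Continuous fun x => fderiv ℝ u x x :=
  (SchwartzMap.fderivCLM ℝ (EuclideanSpace ℝ (Fin n)) ℂ u).continuous.clm_apply continuous_id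

theorem norm_radialDeriv_mul_conj_le {n : ℕ} (u v : EuclideanSpace ℝ (Fin n) → ℂ) {t : ℝ}
    (ht : 0 < t) (x : EuclideanSpace ℝ (Fin n)) :
    ‖radialDeriv u x * (starRingEnd ℂ) (v x)‖ ≤
      t * ‖v x‖ ^ 2 + t⁻¹ * ‖fderiv ℝ u x‖ ^ 2 := by
  rw [norm_mul, RCLike.norm_conj]
  have h1 := mul_le_mul_of_nonneg_right (norm_radialDeriv_le u x) (norm_nonneg (v x))
  have h2 := two_mul_le_weighted_sq ht ‖v x‖ ‖fderiv ℝ u x‖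
  have h3 : 0 ≤ ‖v x‖ * ‖fderiv ℝ u x‖ := by positivity
  linarith

theorem integrable_radialDeriv_mul_conj {n : ℕ}
    (u v : SchwartzMap (EuclideanSpace ℝ (Fin n)) ℂ) :
    Integrable fun x => radialDeriv u x * (starRingEnd ℂ) (v x) := by
  refine ((v.integrable_norm_sq'.const_mul 1).add
    (u.integrable_norm_fderiv_sq.const_mul 1⁻¹)).mono' ?_
    (.of_forall fun x => norm_radialDeriv_mul_conj_le u v one_pos x)
  simp_rw [radialDeriv_eq_smul]
  exact ((measurable_norm.inv.aestronglyMeasurable).smul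
    u.continuous_fderiv_self.aestronglyMeasurable).mul
    (Complex.continuous_conj.comp v.continuous).aestronglyMeasurable

theorem norm_pairing_le_right {n : ℕ} (u v : SchwartzMap (EuclideanSpace ℝ (Fin n)) ℂ) {t : ℝ}
    (ht : 0 < t) :
    ‖∫ x, radialDeriv u x * (starRingEnd ℂ) (v x)‖ ≤
      t * (∫ x, ‖v x‖ ^ 2) + t⁻¹ * ∫ x, ‖fderiv ℝ u x‖ ^ 2 := by
  rw [← integral_const_mul, ← integral_const_mul, ← integral_add
    (v.integrable_norm_sq'.const_mul _) (u.integrable_norm_fderiv_sq.const_mul _)]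
  exact norm_integral_le_of_norm_le ((v.integrable_norm_sq'.const_mul _).add
    (u.integrable_norm_fderiv_sq.const_mul _))
    (.of_forall fun x => norm_radialDeriv_mul_conj_le u v ht x)

/-- The pairing with the radial field regularized at the origin, with the derivative moved to the
second factor. -/
theorem norm_regularized_pairing_le_left {n : ℕ} (hn : 3 ≤ n) {ε : ℝ} (hε : 0 < ε)
    (u v : SchwartzMap (EuclideanSpace ℝ (Fin n)) ℂ) {t : ℝ} (ht : 0 < t) :
    ‖∫ x, (‖x‖ ^ 2 + ε) ^ (-1 / 2 : ℝ) • (fderiv ℝ u x x * (starRingEnd ℂ) (v x))‖ ≤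
      3 * n * (t * (∫ x, ‖u x‖ ^ 2) + t⁻¹ * ∫ x, ‖fderiv ℝ v x‖ ^ 2) := by
  have hs : ∀ x : EuclideanSpace ℝ (Fin n), 0 < ‖x‖ ^ 2 + ε := fun x => by positivity
  have hc : ∀ r : ℝ, Continuous fun x : EuclideanSpace ℝ (Fin n) => (‖x‖ ^ 2 + ε) ^ r := fun r =>
    Continuous.rpow_const (by fun_prop) fun x => Or.inl (hs x).ne'
  have hn' : (3 : ℝ) ≤ n := by exact_mod_cast hn
  have hApos : ∀ x : EuclideanSpace ℝ (Fin n), 0 < (‖x‖ ^ 2 + ε) ^ (-1 / 2 : ℝ) :=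
    fun x => Real.rpow_pos_of_pos (hs x) _
  have hBpos : ∀ x : EuclideanSpace ℝ (Fin n), 0 < (‖x‖ ^ 2 + ε) ^ (-1 / 2 - 1 : ℝ) :=
    fun x => Real.rpow_pos_of_pos (hs x) _
  have hB : ∀ x : EuclideanSpace ℝ (Fin n),
      (‖x‖ ^ 2 + ε) ^ (-1 / 2 - 1 : ℝ) * (‖x‖ ^ 2 + ε) = (‖x‖ ^ 2 + ε) ^ (-1 / 2 : ℝ) :=
    fun x => by rw [← Real.rpow_add_one (hs x).ne', sub_add_cancel]
  have hBx : ∀ x : EuclideanSpace ℝ (Fin n),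
      (‖x‖ ^ 2 + ε) ^ (-1 / 2 - 1 : ℝ) * ‖x‖ ^ 2 ≤ (‖x‖ ^ 2 + ε) ^ (-1 / 2 : ℝ) := fun x => by
    nlinarith [hB x, hBpos x]
  have hA2 : ∀ x : EuclideanSpace ℝ (Fin n),
      ((‖x‖ ^ 2 + ε) ^ (-1 / 2 : ℝ)) ^ 2 = (‖x‖ ^ 2 + ε) ^ (-1 : ℝ) := fun x => by
    rw [← Real.rpow_natCast, ← Real.rpow_mul (hs x).le]
    norm_num
  have hAx : ∀ x : EuclideanSpace ℝ (Fin n), (‖x‖ ^ 2 + ε) ^ (-1 / 2 : ℝ) * ‖x‖ ≤ 1 := fun x => by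
    rw [neg_div, Real.rpow_neg (hs x).le, ← Real.sqrt_eq_rpow]
    exact inv_mul_le_one_of_le₀ (Real.le_sqrt_of_sq_le (by linarith)) (Real.sqrt_nonneg _)
  obtain ⟨iH, hH⟩ := integral_hardy_le hn hε v
  have cu := u.continuous
  have cu' := u.continuous_fderiv_self
  have cv : Continuous fun x => (starRingEnd ℂ) (v x) := Complex.continuous_conj.comp v.continuous
  have cv' : Continuous fun x => (starRingEnd ℂ) (fderiv ℝ v x x) :=
    Complex.continuous_conj.comp v.continuous_fderiv_self
  have hop : ∀ (w : SchwartzMap (EuclideanSpace ℝ (Fin n)) ℂ) x,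
      (‖x‖ ^ 2 + ε) ^ (-1 / 2 : ℝ) * ‖fderiv ℝ w x x‖ ≤ ‖fderiv ℝ w x‖ := fun w x => by
    have h1 := mul_le_mul_of_nonneg_left ((fderiv ℝ w x).le_opNorm x) (hApos x).le
    nlinarith [mul_le_mul_of_nonneg_right (hAx x) (norm_nonneg (fderiv ℝ w x))]
  have b1 : ∀ (a b : SchwartzMap (EuclideanSpace ℝ (Fin n)) ℂ) (t : ℝ), 0 < t → ∀ x,
      (‖x‖ ^ 2 + ε) ^ (-1 / 2 : ℝ) * (‖a x‖ * ‖fderiv ℝ b x x‖) ≤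
        1 / 2 * (t * ‖a x‖ ^ 2 + t⁻¹ * ‖fderiv ℝ b x‖ ^ 2) := fun a b t ht x => by
    have h1 := mul_le_mul_of_nonneg_left (hop b x) (norm_nonneg (a x))
    have h2 := two_mul_le_weighted_sq ht ‖a x‖ ‖fderiv ℝ b x‖
    linarith
  have j1 : ∀ (a b : SchwartzMap (EuclideanSpace ℝ (Fin n)) ℂ) (t : ℝ),
      Integrable fun x => 1 / 2 * (t * ‖a x‖ ^ 2 + t⁻¹ * ‖fderiv ℝ b x‖ ^ 2) := fun a b t =>
    ((a.integrable_norm_sq'.const_mul t).add (b.integrable_norm_fderiv_sq.const_mul t⁻¹)).const_mul _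
  have i1 : Integrable fun x => (‖x‖ ^ 2 + ε) ^ (-1 / 2 : ℝ) •
      (fderiv ℝ u x x * (starRingEnd ℂ) (v x)) := by
    refine (j1 v u 1).mono' ((hc _).smul (cu'.mul cv)).aestronglyMeasurable
      (.of_forall fun x => ?_)
    rw [norm_smul, norm_mul, RCLike.norm_conj, Real.norm_of_nonneg (hApos x).le,
      mul_comm ‖fderiv ℝ u x x‖]
    exact b1 v u 1 one_pos x
  have b2 : ∀ x, ‖(‖x‖ ^ 2 + ε) ^ (-1 / 2 : ℝ) • (u x * (starRingEnd ℂ) (fderiv ℝ v x x))‖ ≤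
      1 / 2 * (t * ‖u x‖ ^ 2 + t⁻¹ * ‖fderiv ℝ v x‖ ^ 2) := fun x => by
    rw [norm_smul, norm_mul, RCLike.norm_conj, Real.norm_of_nonneg (hApos x).le]
    exact b1 u v t ht x
  have i2 : Integrable fun x => (‖x‖ ^ 2 + ε) ^ (-1 / 2 : ℝ) •
      (u x * (starRingEnd ℂ) (fderiv ℝ v x x)) :=
    (j1 u v t).mono' ((hc _).smul (cu.mul cv')).aestronglyMeasurable (.of_forall b2)
  have b3 : ∀ x, ‖(n * (‖x‖ ^ 2 + ε) ^ (-1 / 2 : ℝ) +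
      2 * (-1 / 2) * ‖x‖ ^ 2 * (‖x‖ ^ 2 + ε) ^ (-1 / 2 - 1 : ℝ)) •
        (u x * (starRingEnd ℂ) (v x))‖ ≤
      n / 2 * (t * ‖u x‖ ^ 2 + t⁻¹ * ((‖x‖ ^ 2 + ε) ^ (-1 : ℝ) * ‖v x‖ ^ 2)) := fun x => by
    rw [norm_smul, norm_mul, RCLike.norm_conj]
    have h1 : ‖n * (‖x‖ ^ 2 + ε) ^ (-1 / 2 : ℝ) +
        2 * (-1 / 2) * ‖x‖ ^ 2 * (‖x‖ ^ 2 + ε) ^ (-1 / 2 - 1 : ℝ)‖ ≤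
        n * (‖x‖ ^ 2 + ε) ^ (-1 / 2 : ℝ) := by
      have := mul_nonneg (hBpos x).le (sq_nonneg ‖x‖)
      rw [Real.norm_eq_abs, abs_le]
      constructor <;> nlinarith [hBx x, hApos x]
    have h2 := two_mul_le_weighted_sq ht ‖u x‖ ((‖x‖ ^ 2 + ε) ^ (-1 / 2 : ℝ) * ‖v x‖)
    rw [mul_pow, hA2] at h2
    have h3 := mul_le_mul_of_nonneg_right h1
      (mul_nonneg (norm_nonneg (u x)) (norm_nonneg (v x)))
    have h4 := mul_le_mul_of_nonneg_left h2 (by positivity : (0 : ℝ) ≤ n / 2)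
    linarith
  have j3 : Integrable fun x =>
      n / 2 * (t * ‖u x‖ ^ 2 + t⁻¹ * ((‖x‖ ^ 2 + ε) ^ (-1 : ℝ) * ‖v x‖ ^ 2)) :=
    ((u.integrable_norm_sq'.const_mul t).add (iH.const_mul t⁻¹)).const_mul _
  have key := integral_rpow_smul_radial_pairing (r := -1 / 2) hε le_rfl u v
  simp_rw [smul_add] at key
  rw [integral_add i1 i2] at key
  have n2 := norm_integral_le_of_norm_le (j1 u v t) (.of_forall b2)
  have n3 := norm_integral_le_of_norm_le j3 (.of_forall b3)
  rw [integral_const_mul, integral_add (u.integrable_norm_sq'.const_mul t)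
    (v.integrable_norm_fderiv_sq.const_mul t⁻¹), integral_const_mul, integral_const_mul] at n2
  rw [integral_const_mul, integral_add (u.integrable_norm_sq'.const_mul t)
    (iH.const_mul t⁻¹), integral_const_mul, integral_const_mul] at n3
  rw [eq_sub_of_add_eq key]
  refine (norm_sub_le _ _).trans ?_
  rw [norm_neg]
  have p1 : 0 ≤ t * ∫ x, ‖u x‖ ^ 2 := mul_nonneg ht.le (integral_nonneg fun x => sq_nonneg _)
  have p2 : 0 ≤ t⁻¹ * ∫ x, ‖fderiv ℝ v x‖ ^ 2 :=
    mul_nonneg (inv_pos.2 ht).le (integral_nonneg fun x => sq_nonneg _)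
  have p3 := mul_le_mul_of_nonneg_left hH (inv_pos.2 ht).le
  have p4 := mul_le_mul_of_nonneg_left p3 (by positivity : (0 : ℝ) ≤ n / 2)
  nlinarith

theorem norm_pairing_le_left {n : ℕ} (hn : 3 ≤ n)
    (u v : SchwartzMap (EuclideanSpace ℝ (Fin n)) ℂ) {t : ℝ} (ht : 0 < t) :
    ‖∫ x, radialDeriv u x * (starRingEnd ℂ) (v x)‖ ≤
      3 * n * (t * (∫ x, ‖u x‖ ^ 2) + t⁻¹ * ∫ x, ‖fderiv ℝ v x‖ ^ 2) := by
  have hs : ∀ (k : ℕ) (x : EuclideanSpace ℝ (Fin n)), 0 < ‖x‖ ^ 2 + 1 / ((k : ℝ) + 1) :=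
    fun k x => by positivity
  have hc : ∀ k : ℕ, Continuous fun x : EuclideanSpace ℝ (Fin n) =>
      (‖x‖ ^ 2 + 1 / ((k : ℝ) + 1)) ^ (-1 / 2 : ℝ) := fun k =>
    Continuous.rpow_const (by fun_prop) fun x => Or.inl (hs k x).ne'
  have hlim := tendsto_integral_of_dominated_convergence (μ := volume)
    (F := fun (k : ℕ) x => (‖x‖ ^ 2 + 1 / ((k : ℝ) + 1)) ^ (-1 / 2 : ℝ) •
      (fderiv ℝ u x x * (starRingEnd ℂ) (v x)))
    (f := fun x => radialDeriv u x * (starRingEnd ℂ) (v x))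
    (fun x => 1 * ‖v x‖ ^ 2 + 1⁻¹ * ‖fderiv ℝ u x‖ ^ 2)
    (fun k => ((hc k).smul (u.continuous_fderiv_self.mul
      (Complex.continuous_conj.comp v.continuous))).aestronglyMeasurable)
    ((v.integrable_norm_sq'.const_mul 1).add (u.integrable_norm_fderiv_sq.const_mul 1⁻¹))
    (fun k => .of_forall fun x => ?_) (.of_forall fun x => ?_)
  · exact le_of_tendsto hlim.norm
      (.of_forall fun k => norm_regularized_pairing_le_left hn (by positivity) u v ht)
  · refine le_trans ?_ (norm_radialDeriv_mul_conj_le u v one_pos x)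
    rcases eq_or_ne x 0 with rfl | hx
    · simpa using mul_nonneg (norm_nonneg (radialDeriv u 0)) (norm_nonneg (v 0))
    rw [radialDeriv_eq_smul, smul_mul_assoc, norm_smul, norm_smul]
    refine mul_le_mul_of_nonneg_right ?_ (norm_nonneg _)
    have hx' : 0 < ‖x‖ := norm_pos_iff.2 hx
    rw [Real.norm_of_nonneg (Real.rpow_nonneg (hs k x).le _), norm_inv, norm_norm,
      neg_div, Real.rpow_neg (hs k x).le, ← Real.sqrt_eq_rpow]
    exact inv_anti₀ hx' (Real.le_sqrt_of_sq_le (le_add_of_nonneg_right (by positivity)))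
  · rcases eq_or_ne x 0 with rfl | hx
    · simp [radialDeriv]
    have hx' : 0 < ‖x‖ := norm_pos_iff.2 hx
    have h1 : Filter.Tendsto (fun k : ℕ => ‖x‖ ^ 2 + 1 / ((k : ℝ) + 1)) Filter.atTop
        (nhds (‖x‖ ^ 2 + 0)) := tendsto_one_div_add_atTop_nhds_zero_nat.const_add _
    have h2 := h1.rpow_const (p := (-1 / 2 : ℝ)) (Or.inl (by positivity))
    have h3 : (‖x‖ ^ 2 + 0) ^ (-1 / 2 : ℝ) = ‖x‖⁻¹ := by
      rw [add_zero, neg_div, Real.rpow_neg (by positivity), ← Real.sqrt_eq_rpow,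
        Real.sqrt_sq hx'.le]
    rw [h3] at h2
    rw [radialDeriv_eq_smul, smul_mul_assoc]
    exact h2.smul_const _

open scoped FourierTransform LineDeriv in
theorem integral_norm_fderiv_sq_le {n : ℕ} (u : SchwartzMap (EuclideanSpace ℝ (Fin n)) ℂ) :
    ∫ x, ‖fderiv ℝ u x‖ ^ 2 ≤ ∫ ξ, (2 * Real.pi * ‖ξ‖) ^ 2 * ‖𝓕 u ξ‖ ^ 2 := by
  set e : Fin n → EuclideanSpace ℝ (Fin n) := fun i => EuclideanSpace.single i (1 : ℝ) with he
  have hcoord : ∀ x : EuclideanSpace ℝ (Fin n), x = ∑ i, x i • e i := fun x => by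
    have := (EuclideanSpace.basisFun (Fin n) ℝ).sum_repr x
    simpa [he] using this.symm
  have hop : ∀ x, ‖fderiv ℝ u x‖ ^ 2 ≤ ∑ i, ‖∂_{e i} u x‖ ^ 2 := fun x => by
    have h0 : 0 ≤ ∑ i, ‖∂_{e i} u x‖ ^ 2 := Finset.sum_nonneg fun i _ => sq_nonneg _
    refine (Real.le_sqrt (norm_nonneg _) h0).1
      (ContinuousLinearMap.opNorm_le_bound _ (Real.sqrt_nonneg _) fun y => ?_)
    have h1 : fderiv ℝ u x y = ∑ i, y i • ∂_{e i} u x := by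
      conv_lhs => rw [hcoord y, map_sum]
      simp [SchwartzMap.lineDerivOp_apply_eq_fderiv]
    rw [h1, EuclideanSpace.norm_eq, mul_comm]
    refine (norm_sum_le _ _).trans ?_
    simp_rw [norm_smul]
    exact Real.sum_mul_le_sqrt_mul_sqrt _ _ _
  have hF : ∀ i, ∫ x, ‖∂_{e i} u x‖ ^ 2 = ∫ ξ, (2 * Real.pi * ξ i) ^ 2 * ‖𝓕 u ξ‖ ^ 2 := fun i => by
    rw [← SchwartzMap.integral_norm_sq_fourier, SchwartzMap.fourier_lineDerivOp_eq]
    congr 1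
    ext ξ
    have : (inner ℝ · (e i)).HasTemperateGrowth := by fun_prop
    rw [smul_apply, SchwartzMap.smulLeftCLM_apply_apply this, norm_smul, norm_smul]
    simp [he, mul_pow, EuclideanSpace.inner_single_right]
    ring
  have hI : ∀ i, Integrable fun ξ : EuclideanSpace ℝ (Fin n) =>
      (2 * Real.pi * ξ i) ^ 2 * ‖𝓕 u ξ‖ ^ 2 := fun i => by
    have := ((2 * Real.pi * Complex.I) • SchwartzMap.smulLeftCLM ℂ (inner ℝ · (e i))
      (𝓕 u)).integrable_norm_sq'
    refine this.congr (.of_forall fun ξ => ?_)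
    have : (inner ℝ · (e i)).HasTemperateGrowth := by fun_prop
    simp only
    rw [smul_apply, SchwartzMap.smulLeftCLM_apply_apply this, norm_smul, norm_smul]
    simp [he, mul_pow, EuclideanSpace.inner_single_right]
    ring
  calc ∫ x, ‖fderiv ℝ u x‖ ^ 2 ≤ ∫ x, ∑ i, ‖∂_{e i} u x‖ ^ 2 :=
        integral_mono u.integrable_norm_fderiv_sq
          (integrable_finsetSum _ fun i _ => (∂_{e i} u).integrable_norm_sq') hop
    _ = ∑ i, ∫ ξ : EuclideanSpace ℝ (Fin n), (2 * Real.pi * ξ i) ^ 2 * ‖𝓕 u ξ‖ ^ 2 := by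
        rw [integral_finsetSum _ fun i _ => (∂_{e i} u).integrable_norm_sq']
        exact Finset.sum_congr rfl fun i _ => hF i
    _ = ∫ ξ, (2 * Real.pi * ‖ξ‖) ^ 2 * ‖𝓕 u ξ‖ ^ 2 := by
        rw [← integral_finsetSum _ fun i _ => hI i]
        congr 1
        ext ξ
        rw [← Finset.sum_mul, mul_pow, EuclideanSpace.real_norm_sq_eq, Finset.mul_sum]
        simp_rw [mul_pow]

/-- The quadratic form `∫ (∂_r u) ū dx` on Schwartz functions. -/
noncomputable def radialPairing {n : ℕ} (u : SchwartzMap (EuclideanSpace ℝ (Fin n)) ℂ) : ℂ :=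
  ∫ x, radialDeriv u x * (starRingEnd ℂ) (u x)

theorem norm_pairing_self_sub_le {n : ℕ} (hn : 3 ≤ n)
    (u w : SchwartzMap (EuclideanSpace ℝ (Fin n)) ℂ) {t : ℝ} (ht : 0 < t) :
    ‖radialPairing u - radialPairing w‖ ≤
      3 * n * (2 * t * (∫ x, ‖(u - w) x‖ ^ 2) +
        t⁻¹ * ((∫ x, ‖fderiv ℝ u x‖ ^ 2) + ∫ x, ‖fderiv ℝ w x‖ ^ 2)) := by
  have hn' : (3 : ℝ) ≤ n := by exact_mod_cast hn
  have hsplit : radialPairing u - radialPairing w =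
      (∫ x, radialDeriv (u - w) x * (starRingEnd ℂ) (u x)) +
        ∫ x, radialDeriv w x * (starRingEnd ℂ) ((u - w) x) := by
    have i1 := integrable_radialDeriv_mul_conj (u - w) u
    rw [radialPairing, radialPairing,
      ← integral_sub (integrable_radialDeriv_mul_conj u u) (integrable_radialDeriv_mul_conj w w),
      ← integral_add i1 (integrable_radialDeriv_mul_conj w (u - w))]
    congr 1
    ext x
    have : fderiv ℝ (u - w) x = fderiv ℝ u x - fderiv ℝ w x :=
      fderiv_sub u.differentiableAt w.differentiableAt
    simp only [radialDeriv, this, sub_apply, map_sub]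
    ring
  rw [hsplit]
  have h1 := norm_pairing_le_left hn (u - w) u ht
  have h2 := norm_pairing_le_right w (u - w) ht
  have p1 : 0 ≤ t * ∫ x, ‖(u - w) x‖ ^ 2 := mul_nonneg ht.le (integral_nonneg fun x => sq_nonneg _)
  have p2 : 0 ≤ t⁻¹ * ∫ x, ‖fderiv ℝ w x‖ ^ 2 :=
    mul_nonneg (inv_pos.2 ht).le (integral_nonneg fun x => sq_nonneg _)
  refine (norm_add_le _ _).trans ((add_le_add h1 h2).trans ?_)
  nlinarith

theorem integrable_norm_mul_sq {n : ℕ} (V : SchwartzMap (EuclideanSpace ℝ (Fin n)) ℂ) :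
    Integrable fun ξ => (2 * Real.pi * ‖ξ‖) ^ 2 * ‖V ξ‖ ^ 2 := by
  refine (((V.integrable_pow_mul volume 2).mul_bdd (g := fun ξ => ‖V ξ‖)
    (c := SchwartzMap.seminorm ℝ 0 0 V) V.continuous.norm.aestronglyMeasurable
    (.of_forall fun x => ?_)).const_mul ((2 * Real.pi) ^ 2)).congr (.of_forall fun ξ => ?_)
  · simpa using V.norm_le_seminorm ℝ x
  · simp only
    ring

open scoped FourierTransform in
theorem norm_pairing_fourierInv_sub_le {n : ℕ} (hn : 3 ≤ n)
    (U W : SchwartzMap (EuclideanSpace ℝ (Fin n)) ℂ) {t : ℝ} (ht : 0 < t) :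
    ‖radialPairing (𝓕⁻ U) - radialPairing (𝓕⁻ W)‖ ≤
      3 * n * ∫ ξ, (2 * t * ‖U ξ - W ξ‖ ^ 2 +
        t⁻¹ * ((2 * Real.pi * ‖ξ‖) ^ 2 * ‖U ξ‖ ^ 2 + (2 * Real.pi * ‖ξ‖) ^ 2 * ‖W ξ‖ ^ 2)) := by
  have hS : Integrable fun ξ => ‖U ξ - W ξ‖ ^ 2 := (U - W).integrable_norm_sq'
  have h := norm_pairing_self_sub_le hn (𝓕⁻ U) (𝓕⁻ W) ht
  have h1 : ∫ x, ‖(𝓕⁻ U - 𝓕⁻ W) x‖ ^ 2 = ∫ ξ, ‖U ξ - W ξ‖ ^ 2 := by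
    have : 𝓕⁻ U - 𝓕⁻ W = 𝓕⁻ (U - W) := (map_sub (FourierTransform.fourierInvCLM ℂ _) U W).symm
    rw [this, ← SchwartzMap.integral_norm_sq_fourier]
    simp
  have h2 : ∀ V : SchwartzMap (EuclideanSpace ℝ (Fin n)) ℂ,
      ∫ x, ‖fderiv ℝ (⇑(𝓕⁻ V : SchwartzMap (EuclideanSpace ℝ (Fin n)) ℂ)) x‖ ^ 2 ≤
        ∫ ξ, (2 * Real.pi * ‖ξ‖) ^ 2 * ‖V ξ‖ ^ 2 := fun V => by
    simpa using integral_norm_fderiv_sq_le (𝓕⁻ V)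
  refine h.trans (mul_le_mul_of_nonneg_left ?_ (by positivity))
  have hUW : Integrable fun ξ =>
      (2 * Real.pi * ‖ξ‖) ^ 2 * ‖U ξ‖ ^ 2 + (2 * Real.pi * ‖ξ‖) ^ 2 * ‖W ξ‖ ^ 2 :=
    (integrable_norm_mul_sq U).add (integrable_norm_mul_sq W)
  rw [integral_add (hS.const_mul _) (hUW.const_mul _), integral_const_mul, integral_const_mul,
    integral_add (integrable_norm_mul_sq U) (integrable_norm_mul_sq W), h1]
  exact add_le_add_right (mul_le_mul_of_nonneg_left (add_le_add (h2 U) (h2 W)) (by positivity)) _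

open scoped FourierTransform in
theorem sobolevNormSq_half_eq {n : ℕ} (u : SchwartzMap (EuclideanSpace ℝ (Fin n)) ℂ) :
    sobolevNormSq ((1 : ℝ) / 2) u =
      ∫ ξ, Real.sqrt (1 + (2 * Real.pi * ‖ξ‖) ^ 2) * ‖𝓕 u ξ‖ ^ 2 := by
  have hpi : 0 < 2 * Real.pi := by positivity
  have hT : ∀ ξ, fourierT u ξ = ((2 * Real.pi) ^ (-(n : ℝ) / 2) : ℝ) *
      𝓕 u ((2 * Real.pi)⁻¹ • ξ) := fun ξ => by
    rw [fourierT, SchwartzMap.fourier_coe, Real.fourier_eq']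
    congr 2
    ext x
    rw [smul_eq_mul, inner_smul_right]
    congr 2
    push_cast
    have : (Real.pi : ℂ) ≠ 0 := by exact_mod_cast Real.pi_ne_zero
    field_simp
  have hc := Measure.integral_comp_smul volume (fun η : EuclideanSpace ℝ (Fin n) =>
    Real.sqrt (1 + (2 * Real.pi * ‖η‖) ^ 2) * ‖𝓕 u η‖ ^ 2) (2 * Real.pi)⁻¹
  rw [finrank_euclideanSpace_fin, inv_pow, inv_inv, abs_of_pos (by positivity)] at hc
  have hcc : ((2 * Real.pi) ^ (-(n : ℝ) / 2)) ^ 2 * (2 * Real.pi) ^ n = 1 := by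
    rw [← Real.rpow_natCast, ← Real.rpow_natCast, ← Real.rpow_mul hpi.le, ← Real.rpow_add hpi]
    rw [show -(n : ℝ) / 2 * (2 : ℕ) + n = 0 by push_cast; ring, Real.rpow_zero]
  have : sobolevNormSq ((1 : ℝ) / 2) u = ((2 * Real.pi) ^ (-(n : ℝ) / 2)) ^ 2 *
      ∫ ξ : EuclideanSpace ℝ (Fin n), Real.sqrt (1 + (2 * Real.pi * ‖(2 * Real.pi)⁻¹ • ξ‖) ^ 2) *
        ‖𝓕 u ((2 * Real.pi)⁻¹ • ξ)‖ ^ 2 := by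
    rw [sobolevNormSq, ← integral_const_mul]
    congr 1
    ext ξ
    rw [hT, norm_mul, Complex.norm_real, Real.norm_of_nonneg (by positivity), mul_pow,
      ← Real.sqrt_eq_rpow, norm_smul, norm_inv, Real.norm_of_nonneg hpi.le,
      mul_inv_cancel_left₀ hpi.ne']
    ring
  rw [this, hc, smul_eq_mul, ← mul_assoc, hcc, one_mul]

/-- The comparison of consecutive dyadic resolvents that makes the scale sum telescope. -/
theorem resolvent_diff_sq_le {t a q : ℝ} (ht : 0 ≤ t) (ha : 0 < a) (hta : t ≤ a) (hq : 0 < q) :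
    2 * q * ((1 + (t / (2 * q)) ^ 2)⁻¹ - (1 + (t / q) ^ 2)⁻¹) ^ 2 +
      q⁻¹ * (t ^ 2 * ((1 + (t / (2 * q)) ^ 2)⁻¹) ^ 2 + t ^ 2 * ((1 + (t / q) ^ 2)⁻¹) ^ 2) ≤
    28 * (a * (2 * q) / (a + 2 * q) - a * q / (a + q)) := by
  have hm : (1 + (t / q) ^ 2)⁻¹ = q ^ 2 / (q ^ 2 + t ^ 2) := by field_simp
  have hm' : (1 + (t / (2 * q)) ^ 2)⁻¹ = 4 * q ^ 2 / (4 * q ^ 2 + t ^ 2) := by field_simp; ring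
  have hg : a * (2 * q) / (a + 2 * q) - a * q / (a + q) =
      q * (a ^ 2 / ((a + 2 * q) * (a + q))) := by field_simp; ring
  have hd : 4 * q ^ 2 / (4 * q ^ 2 + t ^ 2) - q ^ 2 / (q ^ 2 + t ^ 2) =
      3 * q ^ 2 / (4 * q ^ 2 + t ^ 2) * (t ^ 2 / (q ^ 2 + t ^ 2)) := by field_simp; ring
  rw [hm, hm', hg, hd]
  set s := t ^ 2 / (q ^ 2 + t ^ 2) with hs
  have hs0 : 0 ≤ s := by positivity
  have hs1 : s ≤ 1 := div_le_one_of_le₀ (by nlinarith) (by positivity)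
  have h1 : 3 * q ^ 2 / (4 * q ^ 2 + t ^ 2) ≤ 1 := div_le_one_of_le₀ (by nlinarith) (by positivity)
  have h1' : 0 ≤ 3 * q ^ 2 / (4 * q ^ 2 + t ^ 2) := by positivity
  have e1 : (3 * q ^ 2 / (4 * q ^ 2 + t ^ 2) * s) ^ 2 ≤ s := by
    have : 3 * q ^ 2 / (4 * q ^ 2 + t ^ 2) * s ≤ 1 * s := mul_le_mul_of_nonneg_right h1 hs0
    nlinarith [mul_nonneg h1' hs0]
  have e2 : q⁻¹ * (t ^ 2 * (q ^ 2 / (q ^ 2 + t ^ 2)) ^ 2) ≤ q * s := by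
    have : q⁻¹ * (t ^ 2 * (q ^ 2 / (q ^ 2 + t ^ 2)) ^ 2) =
      q * s * (q ^ 2 / (q ^ 2 + t ^ 2)) := by rw [hs]; field_simp
    rw [this]
    exact mul_le_of_le_one_right (by positivity) (div_le_one_of_le₀ (by nlinarith) (by positivity))
  have e3 : q⁻¹ * (t ^ 2 * (4 * q ^ 2 / (4 * q ^ 2 + t ^ 2)) ^ 2) ≤ 4 * (q * s) := by
    have h : t ^ 2 / (4 * q ^ 2 + t ^ 2) ≤ s := by rw [hs]; gcongr; nlinarith
    have : q⁻¹ * (t ^ 2 * (4 * q ^ 2 / (4 * q ^ 2 + t ^ 2)) ^ 2) =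
      4 * (q * (t ^ 2 / (4 * q ^ 2 + t ^ 2))) * (4 * q ^ 2 / (4 * q ^ 2 + t ^ 2)) := by
      field_simp
    rw [this]
    refine (mul_le_of_le_one_right (by positivity)
      (div_le_one_of_le₀ (by nlinarith) (by positivity))).trans ?_
    gcongr
  have e4 : s ≤ 4 * (a ^ 2 / ((a + 2 * q) * (a + q))) := by
    have hta2 : t ^ 2 ≤ a ^ 2 := by gcongr
    rw [hs, ← mul_div_assoc, div_le_div_iff₀ (by positivity) (by positivity)]
    have k1 : (a + 2 * q) * (a + q) ≤ 4 * (q ^ 2 + a ^ 2) := by nlinarith [sq_nonneg (a - q)]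
    have k2 := mul_le_mul_of_nonneg_left k1 (sq_nonneg t)
    nlinarith [mul_le_mul_of_nonneg_right hta2 (sq_nonneg q)]
  rw [mul_add]
  have e5 := mul_le_mul_of_nonneg_left e4 hq.le
  have e6 := mul_le_mul_of_nonneg_left e1 hq.le
  linarith [mul_nonneg hq.le hs0]


/-- Multiplication of a Schwartz function by the resolvent symbol `(1 + (2π‖ξ‖ / q)²)⁻¹`. -/
noncomputable def resolventCutoff {n : ℕ} (q : ℝ) (U : SchwartzMap (EuclideanSpace ℝ (Fin n)) ℂ) :
    SchwartzMap (EuclideanSpace ℝ (Fin n)) ℂ :=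
  SchwartzMap.smulLeftCLM ℂ
    (fun ξ : EuclideanSpace ℝ (Fin n) => (1 + ‖(2 * Real.pi / q) • ξ‖ ^ 2) ^ (-1 : ℝ)) U

theorem resolventCutoff_apply {n : ℕ} (q : ℝ) (U : SchwartzMap (EuclideanSpace ℝ (Fin n)) ℂ)
    (ξ : EuclideanSpace ℝ (Fin n)) :
    resolventCutoff q U ξ = (1 + (2 * Real.pi * ‖ξ‖ / q) ^ 2)⁻¹ • U ξ := by
  have h : (fun ξ : EuclideanSpace ℝ (Fin n) =>
      (1 + ‖(2 * Real.pi / q) • ξ‖ ^ 2) ^ (-1 : ℝ)).HasTemperateGrowth :=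
    (Function.hasTemperateGrowth_one_add_norm_sq_rpow (EuclideanSpace ℝ (Fin n)) (-1)).comp
      (f := fun ξ : EuclideanSpace ℝ (Fin n) => (2 * Real.pi / q) • ξ) (by fun_prop)
  rw [resolventCutoff, SchwartzMap.smulLeftCLM_apply_apply h, Real.rpow_neg_one, norm_smul, mul_pow,
    Real.norm_eq_abs, sq_abs, ← mul_pow, div_mul_eq_mul_div]

theorem integrable_mul_norm_sq_of_le {n : ℕ} (U : SchwartzMap (EuclideanSpace ℝ (Fin n)) ℂ)
    {g : EuclideanSpace ℝ (Fin n) → ℝ} (hg : Continuous g) (hg0 : ∀ ξ, 0 ≤ g ξ) {c : ℝ}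
    (hgc : ∀ ξ, g ξ ≤ c * (1 + (2 * Real.pi * ‖ξ‖) ^ 2)) :
    Integrable fun ξ => g ξ * ‖U ξ‖ ^ 2 := by
  refine ((U.integrable_norm_sq'.add (integrable_norm_mul_sq U)).const_mul c).mono'
    (hg.mul (U.continuous.norm.pow 2)).aestronglyMeasurable (.of_forall fun ξ => ?_)
  rw [Real.norm_of_nonneg (mul_nonneg (hg0 ξ) (sq_nonneg _))]
  refine (mul_le_mul_of_nonneg_right (hgc ξ) (sq_nonneg _)).trans_eq ?_
  simp only [Pi.add_apply]
  ring

/-- The weight `a q / (a + q)` with `a = √(1 + (2π‖ξ‖)²)`, a smooth version of `min a q`. -/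
noncomputable def cappedWeight {n : ℕ} (q : ℝ) (ξ : EuclideanSpace ℝ (Fin n)) : ℝ :=
  Real.sqrt (1 + (2 * Real.pi * ‖ξ‖) ^ 2) * q / (Real.sqrt (1 + (2 * Real.pi * ‖ξ‖) ^ 2) + q)

theorem sqrt_one_add_sq_le {t : ℝ} : Real.sqrt (1 + t ^ 2) ≤ 1 + t ^ 2 :=
  Real.sqrt_le_left (by positivity) |>.2 (by nlinarith [sq_nonneg t])

theorem integrable_sqrt_mul_norm_sq {n : ℕ} (U : SchwartzMap (EuclideanSpace ℝ (Fin n)) ℂ) :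
    Integrable fun ξ => Real.sqrt (1 + (2 * Real.pi * ‖ξ‖) ^ 2) * ‖U ξ‖ ^ 2 :=
  integrable_mul_norm_sq_of_le U (by fun_prop) (fun ξ => Real.sqrt_nonneg _) (c := 1) fun ξ => by
    rw [one_mul]
    exact sqrt_one_add_sq_le

theorem cappedWeight_le {n : ℕ} {q : ℝ} (hq : 0 < q) (ξ : EuclideanSpace ℝ (Fin n)) :
    cappedWeight q ξ ≤ Real.sqrt (1 + (2 * Real.pi * ‖ξ‖) ^ 2) := by
  have ha := Real.sqrt_nonneg (1 + (2 * Real.pi * ‖ξ‖) ^ 2)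
  rw [cappedWeight, div_le_iff₀ (by positivity)]
  nlinarith

theorem integrable_cappedWeight_mul_norm_sq {n : ℕ} {q : ℝ} (hq : 0 < q)
    (U : SchwartzMap (EuclideanSpace ℝ (Fin n)) ℂ) :
    Integrable fun ξ => cappedWeight q ξ * ‖U ξ‖ ^ 2 := by
  have hpos : ∀ ξ : EuclideanSpace ℝ (Fin n),
      0 < Real.sqrt (1 + (2 * Real.pi * ‖ξ‖) ^ 2) + q := fun ξ => by positivity
  refine integrable_mul_norm_sq_of_le U ?_ (fun ξ => ?_) (c := 1) fun ξ => ?_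
  · unfold cappedWeight
    exact (by fun_prop : Continuous _).div (by fun_prop) fun ξ => (hpos ξ).ne'
  · unfold cappedWeight
    positivity
  · rw [one_mul]
    exact (cappedWeight_le hq ξ).trans sqrt_one_add_sq_le

open scoped FourierTransform in
theorem norm_radialPairing_resolventCutoff_one_le {n : ℕ} (hn : 3 ≤ n)
    (U : SchwartzMap (EuclideanSpace ℝ (Fin n)) ℂ) :
    ‖radialPairing (𝓕⁻ (resolventCutoff 1 U))‖ ≤
      84 * n * ∫ ξ, cappedWeight 1 ξ * ‖U ξ‖ ^ 2 := by
  have h := norm_pairing_fourierInv_sub_le hn (resolventCutoff 1 U) 0 one_pos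
  have h0 : 𝓕⁻ (0 : SchwartzMap (EuclideanSpace ℝ (Fin n)) ℂ) = 0 :=
    map_zero (FourierTransform.fourierInvCLM ℂ _)
  have h0' : radialPairing (0 : SchwartzMap (EuclideanSpace ℝ (Fin n)) ℂ) = 0 := by
    simp [radialPairing]
  rw [h0, h0', sub_zero] at h
  refine h.trans ?_
  rw [show (84 : ℝ) * n = 3 * n * 28 by ring, mul_assoc (3 * (n : ℝ)), ← integral_const_mul 28]
  refine mul_le_mul_of_nonneg_left (integral_mono_of_nonneg (.of_forall fun ξ => ?_)
    ((integrable_cappedWeight_mul_norm_sq one_pos U).const_mul 28)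
    (.of_forall fun ξ => ?_)) (by positivity : (0 : ℝ) ≤ 3 * n)
  · simp only [Pi.zero_apply]
    positivity
  simp only [resolventCutoff_apply, norm_smul, zero_apply, sub_zero, norm_zero]
  rw [Real.norm_of_nonneg (by positivity)]
  have hg : 1 / 2 ≤ cappedWeight 1 ξ := by
    have : 1 ≤ Real.sqrt (1 + (2 * Real.pi * ‖ξ‖) ^ 2) :=
      Real.one_le_sqrt.2 (by nlinarith [sq_nonneg (2 * Real.pi * ‖ξ‖)])
    rw [cappedWeight, div_le_div_iff₀ two_pos (by linarith)]
    linarith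
  have hm : (2 + (2 * Real.pi * ‖ξ‖) ^ 2) * ((1 + (2 * Real.pi * ‖ξ‖ / 1) ^ 2)⁻¹) ^ 2 ≤ 2 := by
    rw [div_one, inv_pow, ← div_eq_mul_inv, div_le_iff₀ (by positivity)]
    nlinarith [sq_nonneg (2 * Real.pi * ‖ξ‖), sq_nonneg ((2 * Real.pi * ‖ξ‖) ^ 2)]
  have := mul_le_mul_of_nonneg_right (hm.trans (by linarith : 2 ≤ 28 * cappedWeight 1 ξ))
    (sq_nonneg ‖U ξ‖)
  linarith

open scoped FourierTransform in
theorem norm_radialPairing_resolventCutoff_sub_le {n : ℕ} (hn : 3 ≤ n)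
    (U : SchwartzMap (EuclideanSpace ℝ (Fin n)) ℂ) {q : ℝ} (hq : 0 < q) :
    ‖radialPairing (𝓕⁻ (resolventCutoff (2 * q) U)) - radialPairing (𝓕⁻ (resolventCutoff q U))‖ ≤
      84 * n * ((∫ ξ, cappedWeight (2 * q) ξ * ‖U ξ‖ ^ 2) -
        ∫ ξ, cappedWeight q ξ * ‖U ξ‖ ^ 2) := by
  have i1 := integrable_cappedWeight_mul_norm_sq hq U
  have i2 := integrable_cappedWeight_mul_norm_sq (mul_pos two_pos hq) U
  refine (norm_pairing_fourierInv_sub_le hn (resolventCutoff (2 * q) U) (resolventCutoff q U)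
    hq).trans ?_
  rw [← integral_sub i2 i1, show (84 : ℝ) * n = 3 * n * 28 by ring, mul_assoc (3 * (n : ℝ)),
    ← integral_const_mul 28]
  refine mul_le_mul_of_nonneg_left (integral_mono_of_nonneg (.of_forall fun ξ => ?_)
    ((i2.sub i1).const_mul 28)
    (.of_forall fun ξ => ?_)) (by positivity : (0 : ℝ) ≤ 3 * n)
  · simp only [Pi.zero_apply]
    positivity
  have ht : 0 ≤ 2 * Real.pi * ‖ξ‖ := by positivity
  have key := mul_le_mul_of_nonneg_right (resolvent_diff_sq_le ht
    (Real.sqrt_pos.2 (by positivity : 0 < 1 + (2 * Real.pi * ‖ξ‖) ^ 2))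
    (Real.le_sqrt_of_sq_le (by linarith)) hq) (sq_nonneg ‖U ξ‖)
  simp only [resolventCutoff_apply, ← sub_smul, norm_smul, mul_pow, Real.norm_eq_abs, sq_abs]
  simp only [cappedWeight]
  linarith

open scoped FourierTransform in
theorem norm_radialPairing_resolventCutoff_two_pow_le {n : ℕ} (hn : 3 ≤ n)
    (U : SchwartzMap (EuclideanSpace ℝ (Fin n)) ℂ) (N : ℕ) :
    ‖radialPairing (𝓕⁻ (resolventCutoff (2 ^ N) U))‖ ≤
      84 * n * ∫ ξ, cappedWeight (2 ^ N) ξ * ‖U ξ‖ ^ 2 := by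
  induction N with
  | zero => simpa using norm_radialPairing_resolventCutoff_one_le hn U
  | succ N ih =>
    have h := norm_radialPairing_resolventCutoff_sub_le hn U (pow_pos (two_pos (α := ℝ)) N)
    have h' := norm_sub_norm_le (radialPairing (𝓕⁻ (resolventCutoff (2 * 2 ^ N) U)))
      (radialPairing (𝓕⁻ (resolventCutoff (2 ^ N) U)))
    rw [pow_succ']
    linarith

open scoped FourierTransform in
theorem norm_radialPairing_sub_resolventCutoff_le {n : ℕ} (hn : 3 ≤ n)
    (U : SchwartzMap (EuclideanSpace ℝ (Fin n)) ℂ) {q : ℝ} (hq : 0 < q) :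
    ‖radialPairing (𝓕⁻ U) - radialPairing (𝓕⁻ (resolventCutoff q U))‖ ≤
      12 * n * (∫ ξ, (2 * Real.pi * ‖ξ‖) ^ 2 * ‖U ξ‖ ^ 2) * q⁻¹ := by
  refine (norm_pairing_fourierInv_sub_le hn U (resolventCutoff q U) hq).trans ?_
  have : 12 * n * (∫ ξ, (2 * Real.pi * ‖ξ‖) ^ 2 * ‖U ξ‖ ^ 2) * q⁻¹ =
      3 * n * ∫ ξ, 4 * q⁻¹ * ((2 * Real.pi * ‖ξ‖) ^ 2 * ‖U ξ‖ ^ 2) := by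
    rw [integral_const_mul]
    ring
  rw [this]
  refine mul_le_mul_of_nonneg_left (integral_mono_of_nonneg (.of_forall fun ξ => ?_)
    ((integrable_norm_mul_sq U).const_mul _)
    (.of_forall fun ξ => ?_)) (by positivity : (0 : ℝ) ≤ 3 * n)
  · simp only [Pi.zero_apply]
    positivity
  have hd : U ξ - resolventCutoff q U ξ =
      (1 - (1 + (2 * Real.pi * ‖ξ‖ / q) ^ 2)⁻¹) • U ξ := by
    rw [resolventCutoff_apply, sub_smul, one_smul]
  dsimp only
  rw [hd]
  simp only [resolventCutoff_apply, norm_smul, mul_pow _ ‖U ξ‖, Real.norm_eq_abs, sq_abs]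
  set s := (2 * Real.pi * ‖ξ‖ / q) ^ 2 with hs
  have hs0 : 0 ≤ s := sq_nonneg _
  have hsq : (2 * Real.pi * ‖ξ‖) ^ 2 = s * q ^ 2 := by rw [hs]; field_simp
  have hm : ((1 + s)⁻¹) ^ 2 ≤ 1 := pow_le_one₀ (by positivity) (inv_le_one_of_one_le₀ (by linarith))
  have hm' : (1 - (1 + s)⁻¹) ^ 2 ≤ s := by
    have : 1 - (1 + s)⁻¹ = s / (1 + s) := by field_simp; ring
    rw [this, div_pow, div_le_iff₀ (by positivity)]
    nlinarith [mul_nonneg hs0 hs0, mul_nonneg hs0 (mul_nonneg hs0 hs0)]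
  have hqq : q⁻¹ * (s * q ^ 2) = s * q := by field_simp
  rw [hsq]
  have hV := sq_nonneg ‖U ξ‖
  calc 2 * q * ((1 - (1 + s)⁻¹) ^ 2 * ‖U ξ‖ ^ 2) +
        q⁻¹ * (s * q ^ 2 * ‖U ξ‖ ^ 2 + s * q ^ 2 * (((1 + s)⁻¹) ^ 2 * ‖U ξ‖ ^ 2))
      = (2 * q * (1 - (1 + s)⁻¹) ^ 2 + q⁻¹ * (s * q ^ 2) * (1 + ((1 + s)⁻¹) ^ 2)) *
          ‖U ξ‖ ^ 2 := by ring
    _ ≤ (2 * q * s + q⁻¹ * (s * q ^ 2) * (1 + 1)) * ‖U ξ‖ ^ 2 := by gcongr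
    _ = 4 * q⁻¹ * (s * q ^ 2 * ‖U ξ‖ ^ 2) := by
        rw [hqq, show 4 * q⁻¹ * (s * q ^ 2 * ‖U ξ‖ ^ 2) =
          4 * (q⁻¹ * (s * q ^ 2)) * ‖U ξ‖ ^ 2 by ring, hqq]
        ring

open scoped FourierTransform in
theorem norm_radialPairing_fourierInv_le {n : ℕ} (hn : 3 ≤ n)
    (U : SchwartzMap (EuclideanSpace ℝ (Fin n)) ℂ) :
    ‖radialPairing (𝓕⁻ U)‖ ≤
      84 * n * ∫ ξ, Real.sqrt (1 + (2 * Real.pi * ‖ξ‖) ^ 2) * ‖U ξ‖ ^ 2 := by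
  set D : ℝ := 12 * n * ∫ ξ, (2 * Real.pi * ‖ξ‖) ^ 2 * ‖U ξ‖ ^ 2 with hD
  set S : ℝ := 84 * n * ∫ ξ, Real.sqrt (1 + (2 * Real.pi * ‖ξ‖) ^ 2) * ‖U ξ‖ ^ 2 with hS
  have hbound : ∀ N : ℕ, ‖radialPairing (𝓕⁻ U)‖ ≤ S + D * (2⁻¹ : ℝ) ^ N := fun N => by
    have hq : (0 : ℝ) < 2 ^ N := by positivity
    have h1 := norm_radialPairing_sub_resolventCutoff_le hn U hq
    have h2 := norm_radialPairing_resolventCutoff_two_pow_le hn U N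
    have h3 : 84 * n * ∫ ξ, cappedWeight (2 ^ N) ξ * ‖U ξ‖ ^ 2 ≤ S := by
      refine mul_le_mul_of_nonneg_left (integral_mono (integrable_cappedWeight_mul_norm_sq hq U)
        (integrable_sqrt_mul_norm_sq U) fun ξ => ?_) (by positivity)
      exact mul_le_mul_of_nonneg_right (cappedWeight_le hq ξ) (sq_nonneg _)
    have h4 := norm_sub_norm_le (radialPairing (𝓕⁻ U))
      (radialPairing (𝓕⁻ (resolventCutoff (2 ^ N) U)))
    rw [← hD, ← inv_pow] at h1
    linarith
  have hlim : Filter.Tendsto (fun N : ℕ => S + D * (2⁻¹ : ℝ) ^ N) Filter.atTop (nhds (S + D * 0)) :=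
    ((tendsto_pow_atTop_nhds_zero_of_lt_one (by norm_num) (by norm_num)).const_mul D).const_add S
  simpa using ge_of_tendsto' hlim hbound

/-- For `n ≥ 3` there is a constant `C = C(n)` such that for every Schwartz function `u`,
`|∫ (∂_r u) ū dx| ≤ C ‖u‖²_{H^{1/2}}`. -/
theorem radialDeriv_pairing_H_half (n : ℕ) (hn : 3 ≤ n) :
    ∃ C : ℝ, ∀ u : SchwartzMap (EuclideanSpace ℝ (Fin n)) ℂ,
      ‖∫ x, radialDeriv (⇑u) x * (starRingEnd ℂ) (u x)‖
        ≤ C * sobolevNormSq ((1 : ℝ) / 2) (⇑u) := by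
  refine ⟨84 * n, fun u => ?_⟩
  have h := norm_radialPairing_fourierInv_le hn (FourierTransform.fourier u)
  rwa [FourierTransform.fourierInv_fourier_eq, ← sobolevNormSq_half_eq] at h
end

section
/- Let n ≥ 3. There is a constant C (depending only on n) such that for every Schwartz function u ∈ 𝒮(ℝⁿ), ∫_{ℝⁿ} |u(x)|² / |x| dx ≤ C ‖u‖²_{H^{1/2}}. -/
open MeasureTheory
open scoped RealInnerProductSpace

open SchwartzMap LineDeriv FourierTransform

theorem hasTemperateGrowth_inv_one_add_mul_norm_sq {E : Type*} [NormedAddCommGroup E]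
    [InnerProductSpace ℝ E] {c : ℝ} (hc : 0 < c) :
    (fun x : E ↦ (1 + c * ‖x‖ ^ 2)⁻¹).HasTemperateGrowth := by
  have h := (Function.hasTemperateGrowth_one_add_norm_sq_rpow E (-1)).comp
    ((√c • ContinuousLinearMap.id ℝ E).hasTemperateGrowth)
  convert! h using 2 with x
  simp [norm_smul, mul_pow, Real.sq_sqrt hc.le, Real.rpow_neg_one]

theorem integrable_mul_norm_sq {n : ℕ} {g : EuclideanSpace ℝ (Fin n) → ℝ}
    (hg : g.HasTemperateGrowth) (f : 𝓢(EuclideanSpace ℝ (Fin n), ℂ)) :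
    Integrable fun x ↦ g x * ‖f x‖ ^ 2 := by
  have h := (bilinLeftCLM (innerSL ℝ) f.hasTemperateGrowth (smulLeftCLM ℂ g f)).integrable
    (μ := volume)
  have he (x : EuclideanSpace ℝ (Fin n)) :
      bilinLeftCLM (innerSL ℝ) f.hasTemperateGrowth (smulLeftCLM ℂ g f) x = g x * ‖f x‖ ^ 2 := by
    change innerSL ℝ (smulLeftCLM ℂ g f x) (f x) = _
    rw [smulLeftCLM_apply_apply hg, innerSL_apply_apply, real_inner_smul_left,
      real_inner_self_eq_norm_sq]
  exact h.congr (.of_forall he)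

theorem hasFDerivAt_inv_one_add_mul_norm_sq {E : Type*} [NormedAddCommGroup E]
    [InnerProductSpace ℝ E] {c : ℝ} (hc : 0 < c) (x : E) :
    HasFDerivAt (fun x : E ↦ (1 + c * ‖x‖ ^ 2)⁻¹)
      (-(2 * c * (1 + c * ‖x‖ ^ 2)⁻¹ ^ 2) • innerSL ℝ x) x := by
  have h0 : 1 + c * ‖x‖ ^ 2 ≠ 0 := by positivity
  have h1 := (hasDerivAt_inv h0).comp_hasFDerivAt x
    (((hasStrictFDerivAt_norm_sq x).hasFDerivAt.const_mul c).const_add 1)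
  convert! h1 using 1
  ext y
  simp
  field_simp

section Hardy

variable {n : ℕ}

local notation "V" => EuclideanSpace ℝ (Fin n)

theorem fderiv_coord_mul_weight_smul {c : ℝ} (hc : 0 < c) (v : 𝓢(V, ℂ)) (i : Fin n) (x : V) :
    fderiv ℝ (fun x : V ↦ (x i * (1 + c * ‖x‖ ^ 2)⁻¹) • v x) x (EuclideanSpace.single i 1) =
      ((1 + c * ‖x‖ ^ 2)⁻¹ - 2 * c * x i ^ 2 * (1 + c * ‖x‖ ^ 2)⁻¹ ^ 2) • v x +
        (x i * (1 + c * ‖x‖ ^ 2)⁻¹) • fderiv ℝ v x (EuclideanSpace.single i 1) := by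
  have h1 : HasFDerivAt (fun x : V ↦ x i * (1 + c * ‖x‖ ^ 2)⁻¹) _ x :=
    ((EuclideanSpace.proj i : V →L[ℝ] ℝ).hasFDerivAt (x := x)).mul
      (hasFDerivAt_inv_one_add_mul_norm_sq hc x)
  have h2 := h1.smul (v.differentiableAt (x := x)).hasFDerivAt
  rw [show fderiv ℝ (fun x : V ↦ (x i * (1 + c * ‖x‖ ^ 2)⁻¹) • v x) x = _ from h2.fderiv]
  simp [EuclideanSpace.inner_single_right]
  ring

/-- The contribution of one coordinate to the regularized Hardy inequality. -/
theorem integral_hardy_coord_le {c : ℝ} (hc : 0 < c) (v : 𝓢(V, ℂ)) (i : Fin n) :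
    ∫ x : V, ((1 + c * ‖x‖ ^ 2)⁻¹ - 5 / 2 * c * x i ^ 2 * (1 + c * ‖x‖ ^ 2)⁻¹ ^ 2) * ‖v x‖ ^ 2 ≤
      2 / c * ∫ x, ‖∂_{EuclideanSpace.single i (1 : ℝ)} v x‖ ^ 2 := by
  have hg : (fun x : V ↦ x i * (1 + c * ‖x‖ ^ 2)⁻¹).HasTemperateGrowth :=
    (EuclideanSpace.proj i : V →L[ℝ] ℝ).hasTemperateGrowth.mul
      (hasTemperateGrowth_inv_one_add_mul_norm_sq hc)
  set e : V := EuclideanSpace.single i (1 : ℝ)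
  set h : 𝓢(V, ℂ) := smulLeftCLM ℂ (fun x : V ↦ x i * (1 + c * ‖x‖ ^ 2)⁻¹) v
  have hcoe : ⇑h = fun x : V ↦ (x i * (1 + c * ‖x‖ ^ 2)⁻¹) • v x := smulLeftCLM_apply hg v
  have hd : ∀ x, ∂_{e} h x =
      ((1 + c * ‖x‖ ^ 2)⁻¹ - 2 * c * x i ^ 2 * (1 + c * ‖x‖ ^ 2)⁻¹ ^ 2) • v x +
        (x i * (1 + c * ‖x‖ ^ 2)⁻¹) • ∂_{e} v x := fun x ↦ by
    rw [lineDerivOp_apply_eq_fderiv, hcoe, fderiv_coord_mul_weight_smul hc]; rfl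
  have hibp := integral_bilinear_lineDerivOp_right_eq_neg_left h v (innerSL ℝ) e (μ := volume)
  have hint (f g : 𝓢(V, ℂ)) : Integrable (fun x ↦ innerSL ℝ (f x) (g x)) :=
    (bilinLeftCLM (innerSL ℝ) g.hasTemperateGrowth f).integrable
  have hsq (f : 𝓢(V, ℂ)) : Integrable (fun x ↦ ‖f x‖ ^ 2) := by
    simpa using hint f f
  have hA : Integrable fun x : V ↦
      ((1 + c * ‖x‖ ^ 2)⁻¹ - 5 / 2 * c * x i ^ 2 * (1 + c * ‖x‖ ^ 2)⁻¹ ^ 2) * ‖v x‖ ^ 2 := by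
    refine integrable_mul_norm_sq ?_ v
    have hw := hasTemperateGrowth_inv_one_add_mul_norm_sq (E := V) hc
    have hx : (fun x : V ↦ x i).HasTemperateGrowth :=
      (EuclideanSpace.proj i : V →L[ℝ] ℝ).hasTemperateGrowth
    exact hw.sub (((Function.HasTemperateGrowth.const _).mul (hx.pow 2)).mul (hw.pow 2))
  have hB := ((hsq (∂_{e} v)).const_mul (2 / c)).add ((hint h (∂_{e} v)).add (hint (∂_{e} h) v))
  refine (integral_mono hA hB fun x ↦ ?_).trans_eq ?_
  · simp only [Pi.add_apply, hd, hcoe, innerSL_apply_apply, inner_add_left, real_inner_smul_left,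
      real_inner_self_eq_norm_sq, real_inner_comm (v x) (∂_{e} v x)]
    have h0 : 0 ≤ 2 / c * ‖∂_{e} v x + (c * (x i * (1 + c * ‖x‖ ^ 2)⁻¹) / 2) • v x‖ ^ 2 := by
      positivity
    rw [norm_add_sq_real, real_inner_smul_right, norm_smul, mul_pow, Real.norm_eq_abs, sq_abs,
      real_inner_comm (v x) (∂_{e} v x)] at h0
    generalize (1 + c * ‖x‖ ^ 2)⁻¹ = w at *
    have hc' := hc.ne'
    field_simp at h0 ⊢
    linarith
  · simp only [Pi.add_apply]
    rw [integral_add ((hsq _).const_mul _) (by exact (hint h _).add (hint _ v)),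
      integral_add (hint _ _) (hint _ _), hibp, neg_add_cancel, add_zero, integral_const_mul]

theorem integral_norm_sq_lineDeriv (v : 𝓢(V, ℂ)) (i : Fin n) :
    ∫ x, ‖∂_{EuclideanSpace.single i (1 : ℝ)} v x‖ ^ 2 =
      ∫ ξ : V, (4 * Real.pi ^ 2) * (ξ i ^ 2 * ‖𝓕 v ξ‖ ^ 2) := by
  rw [← integral_norm_sq_fourier]
  congr with ξ
  rw [fourier_lineDerivOp_eq]
  have : (inner ℝ · (EuclideanSpace.single i (1 : ℝ)) : V → ℝ).HasTemperateGrowth := by fun_prop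
  rw [smul_apply, smulLeftCLM_apply_apply this]
  simp [EuclideanSpace.inner_single_right, mul_pow,
    abs_of_pos Real.pi_pos]
  ring_nf
  simp

/-- Hardy's inequality with the regularized weight `1 / (1 + c |x|²)`, on the Fourier side. -/
theorem integral_hardy_le_s4 (hn : 3 ≤ n) {c : ℝ} (hc : 0 < c) (v : 𝓢(V, ℂ)) :
    ∫ x, (1 + c * ‖x‖ ^ 2)⁻¹ * ‖v x‖ ^ 2 ≤
      16 * Real.pi ^ 2 / c * ∫ ξ, ‖ξ‖ ^ 2 * ‖𝓕 v ξ‖ ^ 2 := by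
  have hw := hasTemperateGrowth_inv_one_add_mul_norm_sq (E := V) hc
  have hx (i : Fin n) : (fun x : V ↦ x i).HasTemperateGrowth :=
    (EuclideanSpace.proj i : V →L[ℝ] ℝ).hasTemperateGrowth
  have hA (i : Fin n) : Integrable fun x : V ↦
      ((1 + c * ‖x‖ ^ 2)⁻¹ - 5 / 2 * c * x i ^ 2 * (1 + c * ‖x‖ ^ 2)⁻¹ ^ 2) * ‖v x‖ ^ 2 :=
    integrable_mul_norm_sq
      (hw.sub (((Function.HasTemperateGrowth.const _).mul ((hx i).pow 2)).mul (hw.pow 2))) v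
  have hsum := Finset.sum_le_sum fun i (_ : i ∈ Finset.univ) ↦ integral_hardy_coord_le hc v i
  simp only [integral_norm_sq_lineDeriv] at hsum
  rw [← integral_finsetSum _ fun i _ ↦ hA i, ← Finset.mul_sum, ← integral_finsetSum _ fun i _ ↦
    (by exact (integrable_mul_norm_sq ((hx i).pow 2) (𝓕 v)).const_mul _)] at hsum
  have hle : ∫ x, (1 / 2) * ((1 + c * ‖x‖ ^ 2)⁻¹ * ‖v x‖ ^ 2) ≤ ∫ x : V, ∑ i,
      ((1 + c * ‖x‖ ^ 2)⁻¹ - 5 / 2 * c * x i ^ 2 * (1 + c * ‖x‖ ^ 2)⁻¹ ^ 2) * ‖v x‖ ^ 2 := by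
    refine integral_mono ((integrable_mul_norm_sq hw v).const_mul _)
      (integrable_finsetSum _ fun i _ ↦ hA i) fun x ↦ ?_
    have hn' : (3 : ℝ) ≤ n := by exact_mod_cast hn
    have h0 : 0 < 1 + c * ‖x‖ ^ 2 := by positivity
    simp only [← Finset.sum_mul, Finset.sum_sub_distrib, ← Finset.mul_sum,
      ← EuclideanSpace.real_norm_sq_eq, Finset.sum_const, Finset.card_univ, Fintype.card_fin,
      nsmul_eq_mul]
    rw [← mul_assoc]
    gcongr
    field_simp
    nlinarith [mul_nonneg hc.le (sq_nonneg ‖x‖)]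
  have hR : (fun ξ : V ↦ ∑ i, (4 * Real.pi ^ 2) * (ξ i ^ 2 * ‖𝓕 v ξ‖ ^ 2)) =
      fun ξ ↦ (4 * Real.pi ^ 2) * (‖ξ‖ ^ 2 * ‖𝓕 v ξ‖ ^ 2) := by
    ext ξ
    rw [← Finset.mul_sum, ← Finset.sum_mul, EuclideanSpace.real_norm_sq_eq]
  rw [integral_const_mul] at hle
  rw [hR, integral_const_mul] at hsum
  calc _ ≤ 2 * (2 / c * (4 * Real.pi ^ 2 * ∫ ξ : V, ‖ξ‖ ^ 2 * ‖𝓕 v ξ‖ ^ 2)) := by linarith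
    _ = _ := by ring

theorem integrable_sq_mul_inv_add_sq_mul_norm_sq {c : ℝ} (hc : 0 < c) (f : 𝓢(V, ℂ)) :
    Integrable fun ξ : V ↦ ‖ξ‖ ^ 2 * (c + ‖ξ‖ ^ 2)⁻¹ * ‖f ξ‖ ^ 2 := by
  have hm := hasTemperateGrowth_inv_one_add_mul_norm_sq (E := V) (inv_pos.2 hc)
  convert integrable_mul_norm_sq ((Function.HasTemperateGrowth.const 1).sub hm) f using 3 with ξ
  have : 0 < c + ‖ξ‖ ^ 2 := by positivity
  simp only [Pi.sub_apply]
  field_simp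
  ring

/-- Splitting `u` by the Fourier multiplier `c / (c + |ξ|²)`, the high frequencies are controlled by
Plancherel's theorem and the low ones by Hardy's inequality. -/
theorem integral_weight_le (hn : 3 ≤ n) {c : ℝ} (hc : 0 < c) (u : 𝓢(V, ℂ)) :
    ∫ x, (1 + c * ‖x‖ ^ 2)⁻¹ * ‖u x‖ ^ 2 ≤
      32 * Real.pi ^ 2 * ∫ ξ, ‖ξ‖ ^ 2 * (c + ‖ξ‖ ^ 2)⁻¹ * ‖𝓕 u ξ‖ ^ 2 := by
  have hw := hasTemperateGrowth_inv_one_add_mul_norm_sq (E := V) hc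
  have hm := hasTemperateGrowth_inv_one_add_mul_norm_sq (E := V) (inv_pos.2 hc)
  set g : 𝓢(V, ℂ) := smulLeftCLM ℂ (fun ξ : V ↦ (1 + c⁻¹ * ‖ξ‖ ^ 2)⁻¹) (𝓕 u)
  have hg (ξ : V) : g ξ = (1 + c⁻¹ * ‖ξ‖ ^ 2)⁻¹ • 𝓕 u ξ := smulLeftCLM_apply_apply hm _ ξ
  set v : 𝓢(V, ℂ) := 𝓕⁻ g
  have hFv : 𝓕 v = g := FourierTransform.fourier_fourierInv_eq g
  have hsq (f : 𝓢(V, ℂ)) : Integrable (fun x ↦ ‖f x‖ ^ 2) := by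
    simpa using integrable_mul_norm_sq (.const 1) f
  have hnsq (f : 𝓢(V, ℂ)) : Integrable (fun x : V ↦ ‖x‖ ^ 2 * ‖f x‖ ^ 2) :=
    integrable_mul_norm_sq (Function.hasTemperateGrowth_norm_sq V) f
  calc
    _ ≤ ∫ x, (2 * ‖(u - v) x‖ ^ 2 + 2 * ((1 + c * ‖x‖ ^ 2)⁻¹ * ‖v x‖ ^ 2)) := by
      refine integral_mono (integrable_mul_norm_sq hw u)
        (((hsq _).const_mul _).add ((integrable_mul_norm_sq hw v).const_mul _)) fun x ↦ ?_
      have h1 : (1 + c * ‖x‖ ^ 2)⁻¹ ≤ 1 := inv_le_one_of_one_le₀ (by nlinarith [sq_nonneg ‖x‖])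
      have h0 : 0 ≤ (1 + c * ‖x‖ ^ 2)⁻¹ := by positivity
      have h2 : ‖u x‖ ^ 2 ≤ 2 * ‖(u - v) x‖ ^ 2 + 2 * ‖v x‖ ^ 2 := by
        have := norm_add_le ((u - v) x) (v x)
        rw [sub_apply, sub_add_cancel, ← sub_apply] at this
        nlinarith [sq_nonneg (‖(u - v) x‖ - ‖v x‖), norm_nonneg (u x)]
      dsimp only
      nlinarith [mul_le_mul_of_nonneg_left h2 h0,
        mul_le_mul_of_nonneg_right h1 (sq_nonneg ‖(u - v) x‖)]
    _ = 2 * (∫ x, ‖(u - v) x‖ ^ 2) + 2 * ∫ x, ((1 + c * ‖x‖ ^ 2)⁻¹ * ‖v x‖ ^ 2) := by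
      rw [integral_add ((hsq _).const_mul _) ((integrable_mul_norm_sq hw v).const_mul _),
        integral_const_mul, integral_const_mul]
    _ ≤ 2 * (∫ ξ, ‖(𝓕 u - g) ξ‖ ^ 2) + 2 * (16 * Real.pi ^ 2 / c * ∫ ξ, ‖ξ‖ ^ 2 * ‖g ξ‖ ^ 2) := by
      have h1 := integral_hardy_le_s4 hn hc v
      rw [hFv] at h1
      have h2 : 𝓕 (u - v) = 𝓕 u - g := by
        rw [← hFv]
        exact map_sub (fourierTransformCLM ℂ) u v
      rw [← integral_norm_sq_fourier (u - v), h2]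
      gcongr
    _ = ∫ ξ, (2 * ‖(𝓕 u - g) ξ‖ ^ 2 + 32 * Real.pi ^ 2 / c * (‖ξ‖ ^ 2 * ‖g ξ‖ ^ 2)) := by
      rw [integral_add ((hsq _).const_mul _) ((hnsq g).const_mul _),
        integral_const_mul, integral_const_mul]
      ring
    _ ≤ ∫ ξ, 32 * Real.pi ^ 2 * (‖ξ‖ ^ 2 * (c + ‖ξ‖ ^ 2)⁻¹ * ‖𝓕 u ξ‖ ^ 2) := by
      refine integral_mono_of_nonneg (.of_forall fun ξ ↦ by positivity)
        (.const_mul (integrable_sq_mul_inv_add_sq_mul_norm_sq hc _) _) (.of_forall fun ξ ↦ ?_)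
      have h0 : 0 < c + ‖ξ‖ ^ 2 := by positivity
      have hpi := Real.pi_gt_three
      have h1 : (𝓕 u - g) ξ = (‖ξ‖ ^ 2 * (c + ‖ξ‖ ^ 2)⁻¹) • 𝓕 u ξ := by
        rw [sub_apply, hg]
        nth_rewrite 1 [← one_smul ℝ (𝓕 u ξ)]
        rw [← sub_smul]
        congr 1
        field_simp
        ring
      simp only [h1, hg, norm_smul, mul_pow, Real.norm_eq_abs, sq_abs]
      rw [show (1 + c⁻¹ * ‖ξ‖ ^ 2)⁻¹ = c * (c + ‖ξ‖ ^ 2)⁻¹ by field_simp]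
      generalize ‖𝓕 u ξ‖ = t
      have h2 : 2 * (‖ξ‖ ^ 2) ^ 2 + 32 * Real.pi ^ 2 * c * ‖ξ‖ ^ 2 ≤
          32 * Real.pi ^ 2 * ‖ξ‖ ^ 2 * (c + ‖ξ‖ ^ 2) := by
        nlinarith [mul_nonneg (show 0 ≤ 32 * Real.pi ^ 2 - 2 by nlinarith)
          (sq_nonneg (‖ξ‖ ^ 2))]
      calc _ = (2 * (‖ξ‖ ^ 2) ^ 2 + 32 * Real.pi ^ 2 * c * ‖ξ‖ ^ 2) *
            ((c + ‖ξ‖ ^ 2)⁻¹ ^ 2 * t ^ 2) := by field_simp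
        _ ≤ 32 * Real.pi ^ 2 * ‖ξ‖ ^ 2 * (c + ‖ξ‖ ^ 2) * ((c + ‖ξ‖ ^ 2)⁻¹ ^ 2 * t ^ 2) := by
          gcongr
        _ = _ := by field_simp
    _ = _ := integral_const_mul _ _

end Hardy

theorem lintegral_Ioi_inv_one_add_sq_mul_sq {r : ℝ} (hr : 0 < r) :
    ∫⁻ s in Set.Ioi (0 : ℝ), ENNReal.ofReal (1 + s ^ 2 * r ^ 2)⁻¹ =
      ENNReal.ofReal (Real.pi / 2 * r⁻¹) := by
  have h1 : ∀ s : ℝ, (1 + s ^ 2 * r ^ 2)⁻¹ = (fun t : ℝ ↦ (1 + t ^ 2)⁻¹) (r * s) := fun s ↦ by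
    simp only; ring
  simp only [h1]
  rw [← ofReal_integral_eq_lintegral_ofReal,
    integral_comp_mul_left_Ioi (fun t : ℝ ↦ (1 + t ^ 2)⁻¹) _ hr, mul_zero,
    integral_Ioi_inv_one_add_sq, Real.arctan_zero, sub_zero, smul_eq_mul, mul_comm]
  · exact (integrable_inv_one_add_sq.comp_mul_left' hr.ne').integrableOn
  · exact .of_forall fun s ↦ by positivity

theorem fourierT_eq_smul_fourier {n : ℕ} (u : EuclideanSpace ℝ (Fin n) → ℂ)
    (ξ : EuclideanSpace ℝ (Fin n)) :
    fourierT u ξ = ((2 * Real.pi) ^ (-(n : ℝ) / 2) : ℝ) * 𝓕 u ((2 * Real.pi)⁻¹ • ξ) := by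
  rw [fourierT, Real.fourier_eq']
  congr 2 with x
  rw [real_inner_smul_right, smul_eq_mul]
  congr 2
  push_cast
  field_simp

theorem sobolevNormSq_eq {n : ℕ} (s : ℝ) (u : EuclideanSpace ℝ (Fin n) → ℂ) :
    sobolevNormSq s u =
      ∫ ξ : EuclideanSpace ℝ (Fin n), (1 + ‖(2 * Real.pi) • ξ‖ ^ 2) ^ s * ‖𝓕 u ξ‖ ^ 2 := by
  have h2 : (0 : ℝ) < 2 * Real.pi := by positivity
  have h (ξ : EuclideanSpace ℝ (Fin n)) : (1 + ‖ξ‖ ^ 2) ^ s * ‖fourierT u ξ‖ ^ 2 =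
      ((2 * Real.pi) ^ n)⁻¹ * (fun η : EuclideanSpace ℝ (Fin n) ↦
        (1 + ‖(2 * Real.pi) • η‖ ^ 2) ^ s * ‖𝓕 u η‖ ^ 2) ((2 * Real.pi)⁻¹ • ξ) := by
    have h3 : (((2 * Real.pi) ^ (-(n : ℝ) / 2) : ℝ)) ^ 2 = ((2 * Real.pi) ^ n)⁻¹ := by
      rw [← Real.rpow_natCast _ 2, ← Real.rpow_mul h2.le, ← Real.rpow_natCast _ n,
        ← Real.rpow_neg h2.le]
      congr 1
      push_cast
      ring
    simp only [smul_inv_smul₀ h2.ne']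
    rw [fourierT_eq_smul_fourier, norm_mul, mul_pow, Complex.norm_real, Real.norm_eq_abs, sq_abs,
      h3]
    ring
  simp only [sobolevNormSq]
  rw [integral_congr_ae (.of_forall h), integral_const_mul,
    Measure.integral_comp_smul volume (fun η : EuclideanSpace ℝ (Fin n) ↦
      (1 + ‖(2 * Real.pi) • η‖ ^ 2) ^ s * ‖𝓕 u η‖ ^ 2),
    finrank_euclideanSpace_fin, inv_pow, inv_inv, abs_of_pos (by positivity), smul_eq_mul,
    inv_mul_cancel_left₀ (by positivity)]

theorem integral_norm_mul_le_sobolevNormSq {n : ℕ} (u : 𝓢(EuclideanSpace ℝ (Fin n), ℂ)) :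
    Integrable (fun ξ ↦ ‖ξ‖ * ‖𝓕 u ξ‖ ^ 2) ∧
      ∫ ξ, ‖ξ‖ * ‖𝓕 u ξ‖ ^ 2 ≤ sobolevNormSq (1 / 2) u := by
  have hg : (fun ξ : EuclideanSpace ℝ (Fin n) ↦
      (1 + ‖(2 * Real.pi) • ξ‖ ^ 2) ^ (1 / 2 : ℝ)).HasTemperateGrowth :=
    (Function.hasTemperateGrowth_one_add_norm_sq_rpow _ (1 / 2)).comp
      ((2 * Real.pi) • ContinuousLinearMap.id ℝ (EuclideanSpace ℝ (Fin n))).hasTemperateGrowth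
  have hG := integrable_mul_norm_sq hg (𝓕 u)
  have hle (ξ : EuclideanSpace ℝ (Fin n)) : ‖ξ‖ * ‖𝓕 u ξ‖ ^ 2 ≤
      (1 + ‖(2 * Real.pi) • ξ‖ ^ 2) ^ (1 / 2 : ℝ) * ‖𝓕 u ξ‖ ^ 2 := by
    gcongr
    rw [← Real.sqrt_eq_rpow]
    apply Real.le_sqrt_of_sq_le
    rw [norm_smul, mul_pow, Real.norm_eq_abs, sq_abs]
    nlinarith [Real.pi_gt_three, mul_nonneg (show 0 ≤ (2 * Real.pi) ^ 2 - 1 by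
      nlinarith [Real.pi_gt_three]) (sq_nonneg ‖ξ‖)]
  have hI : Integrable (fun ξ ↦ ‖ξ‖ * ‖𝓕 u ξ‖ ^ 2) :=
    hG.mono' (by fun_prop) (.of_forall fun ξ ↦ by
      rw [Real.norm_of_nonneg (by positivity)]; exact hle ξ)
  refine ⟨hI, ?_⟩
  rw [sobolevNormSq_eq, ← fourier_coe]
  exact integral_mono hI hG hle

/-- The homogeneous inequality, obtained by integrating `integral_weight_le` with `c = s²` over
`s > 0`. -/
theorem lintegral_norm_sq_div_norm_le {n : ℕ} (hn : 3 ≤ n)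
    (u : 𝓢(EuclideanSpace ℝ (Fin n), ℂ)) :
    ∫⁻ x, ENNReal.ofReal (‖u x‖ ^ 2 / ‖x‖) ≤
      ENNReal.ofReal (32 * Real.pi ^ 2) * ∫⁻ ξ, ENNReal.ofReal (‖ξ‖ * ‖𝓕 u ξ‖ ^ 2) := by
  have hpi : ENNReal.ofReal (Real.pi / 2) ≠ 0 := by simp [Real.pi_pos]
  rw [← ENNReal.mul_le_mul_iff_right hpi ENNReal.ofReal_ne_top]
  calc
    _ = ∫⁻ x, ENNReal.ofReal (Real.pi / 2) * ENNReal.ofReal (‖u x‖ ^ 2 / ‖x‖) :=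
      (lintegral_const_mul' _ _ ENNReal.ofReal_ne_top).symm
    _ ≤ ∫⁻ x, ∫⁻ s in Set.Ioi (0 : ℝ),
        ENNReal.ofReal ((1 + s ^ 2 * ‖x‖ ^ 2)⁻¹ * ‖u x‖ ^ 2) := by
      refine lintegral_mono fun x ↦ ?_
      rcases (norm_nonneg x).eq_or_lt with hx | hx
      · simp [← hx]
      · simp_rw [ENNReal.ofReal_mul' (sq_nonneg ‖u x‖)]
        rw [lintegral_mul_const' _ _ ENNReal.ofReal_ne_top,
          lintegral_Ioi_inv_one_add_sq_mul_sq hx, ← ENNReal.ofReal_mul (by positivity),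
          ← ENNReal.ofReal_mul (by positivity)]
        exact le_of_eq (by ring_nf)
    _ = ∫⁻ s in Set.Ioi (0 : ℝ), ∫⁻ x,
        ENNReal.ofReal ((1 + s ^ 2 * ‖x‖ ^ 2)⁻¹ * ‖u x‖ ^ 2) :=
      lintegral_lintegral_swap (by fun_prop)
    _ ≤ ∫⁻ s in Set.Ioi (0 : ℝ), ∫⁻ ξ, ENNReal.ofReal (32 * Real.pi ^ 2) *
        ENNReal.ofReal (‖ξ‖ ^ 2 * (s ^ 2 + ‖ξ‖ ^ 2)⁻¹ * ‖𝓕 u ξ‖ ^ 2) := by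
      refine setLIntegral_mono_ae' measurableSet_Ioi (.of_forall fun s hs ↦ ?_)
      have hs : 0 < s ^ 2 := pow_pos hs 2
      rw [lintegral_const_mul' _ _ ENNReal.ofReal_ne_top,
        ← ofReal_integral_eq_lintegral_ofReal
          (integrable_mul_norm_sq (hasTemperateGrowth_inv_one_add_mul_norm_sq hs) u)
          (.of_forall fun x ↦ by positivity),
        ← ofReal_integral_eq_lintegral_ofReal (integrable_sq_mul_inv_add_sq_mul_norm_sq hs _)
          (.of_forall fun x ↦ by positivity), ← ENNReal.ofReal_mul (by positivity)]
      exact ENNReal.ofReal_le_ofReal (integral_weight_le hn hs u)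
    _ = ∫⁻ ξ, ∫⁻ s in Set.Ioi (0 : ℝ), ENNReal.ofReal (32 * Real.pi ^ 2) *
        ENNReal.ofReal (‖ξ‖ ^ 2 * (s ^ 2 + ‖ξ‖ ^ 2)⁻¹ * ‖𝓕 u ξ‖ ^ 2) :=
      lintegral_lintegral_swap (by fun_prop)
    _ ≤ ∫⁻ ξ, ENNReal.ofReal (Real.pi / 2) * (ENNReal.ofReal (32 * Real.pi ^ 2) *
        ENNReal.ofReal (‖ξ‖ * ‖𝓕 u ξ‖ ^ 2)) := by
      refine lintegral_mono fun ξ ↦ ?_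
      rcases (norm_nonneg ξ).eq_or_lt with hx | hx
      · simp [← hx]
      · have h (s : ℝ) : ‖ξ‖ ^ 2 * (s ^ 2 + ‖ξ‖ ^ 2)⁻¹ = (1 + s ^ 2 * ‖ξ‖⁻¹ ^ 2)⁻¹ := by
          have : 0 < s ^ 2 + ‖ξ‖ ^ 2 := by positivity
          field_simp
          ring
        simp_rw [h, ENNReal.ofReal_mul' (sq_nonneg ‖𝓕 u ξ‖)]
        rw [lintegral_const_mul' _ _ ENNReal.ofReal_ne_top,
          lintegral_mul_const' _ _ ENNReal.ofReal_ne_top,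
          lintegral_Ioi_inv_one_add_sq_mul_sq (inv_pos.2 hx), inv_inv,
          ENNReal.ofReal_mul (by positivity : 0 ≤ Real.pi / 2)]
        exact le_of_eq (by ring)
    _ = _ := by
      rw [lintegral_const_mul' _ _ ENNReal.ofReal_ne_top,
        lintegral_const_mul' _ _ ENNReal.ofReal_ne_top]

/-- For `n ≥ 3` there is a constant `C = C(n)` such that for every Schwartz function `u`,
`∫ |u(x)|²/|x| dx ≤ C ‖u‖²_{H^{1/2}}`. -/
theorem weighted_L2_H_half (n : ℕ) (hn : 3 ≤ n) :
    ∃ C : ℝ, ∀ u : SchwartzMap (EuclideanSpace ℝ (Fin n)) ℂ,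
      ∫ x, ‖u x‖ ^ 2 / ‖x‖ ≤ C * sobolevNormSq ((1 : ℝ) / 2) (⇑u) := by
  refine ⟨32 * Real.pi ^ 2, fun u ↦ ?_⟩
  obtain ⟨hI, hle⟩ := integral_norm_mul_le_sobolevNormSq u
  refine le_trans ?_ (mul_le_mul_of_nonneg_left hle (by positivity))
  have h0 : 0 ≤ ∫ ξ, ‖ξ‖ * ‖𝓕 u ξ‖ ^ 2 := integral_nonneg fun ξ ↦ by positivity
  have h := lintegral_norm_sq_div_norm_le hn u
  rw [← ofReal_integral_eq_lintegral_ofReal hI (.of_forall fun ξ ↦ by positivity),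
    ← ENNReal.ofReal_mul (by positivity)] at h
  rw [integral_eq_lintegral_of_nonneg_ae (.of_forall fun x ↦ by positivity)
    (by fun_prop : Measurable fun x ↦ ‖u x‖ ^ 2 / ‖x‖).aestronglyMeasurable]
  exact ENNReal.toReal_le_of_le_ofReal (by positivity) h
end

section
/- Let n ≥ 1, ψ₀ ∈ 𝒮(ℝⁿ), and let ψ be the solution of the free Schrödinger equation with initial data ψ₀. Then for every t ≠ 0 and every x ∈ ℝⁿ, the dispersive estimate |ψ(t,x)| ≤ (4π|t|)^{-n/2} ∫_{ℝⁿ} |ψ₀(y)| dy holds. -/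
open MeasureTheory
open scoped RealInnerProductSpace

/-- The solution of the free Schrödinger equation with initial data `ψ₀`:
`ψ(t,x) = (2π)^{-n/2} ∫ e^{i x·ξ} e^{-i t |ξ|²} ψ̂₀(ξ) dξ`. -/
noncomputable def schrodSol {n : ℕ} (ψ₀ : SchwartzMap (EuclideanSpace ℝ (Fin n)) ℂ)
    (t : ℝ) (x : EuclideanSpace ℝ (Fin n)) : ℂ :=
  ((2 * Real.pi) ^ (-(n : ℝ) / 2) : ℝ) *
    ∫ ξ, Complex.exp (Complex.I * (⟪x, ξ⟫ : ℝ)) *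
      Complex.exp (-Complex.I * (t : ℂ) * ((‖ξ‖ ^ 2 : ℝ) : ℂ)) * fourierT (⇑ψ₀) ξ

/-- `fourierT` is Mathlib's Fourier transform, up to a dilation and a constant. -/
lemma fourierT_eq_fourier {n : ℕ} (u : EuclideanSpace ℝ (Fin n) → ℂ)
    (ξ : EuclideanSpace ℝ (Fin n)) :
    fourierT u ξ = ((2 * Real.pi) ^ (-(n : ℝ) / 2) : ℝ) *
      FourierTransform.fourier u ((2 * Real.pi)⁻¹ • ξ) := by
  rw [fourierT, Real.fourier_eq']
  congr 2
  funext x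
  rw [smul_eq_mul, real_inner_smul_right]
  congr 2
  push_cast
  field_simp

lemma SchwartzMap.integrable_fourierT {n : ℕ} (u : SchwartzMap (EuclideanSpace ℝ (Fin n)) ℂ) :
    Integrable (fourierT u) := by
  have h : Integrable (FourierTransform.fourier (u : EuclideanSpace ℝ (Fin n) → ℂ)) := by
    rw [← SchwartzMap.fourier_coe]
    exact SchwartzMap.integrable _
  have := (h.comp_smul (R := (2 * Real.pi)⁻¹) (by positivity)).const_mul
    (((2 * Real.pi) ^ (-(n : ℝ) / 2) : ℝ) : ℂ)
  exact this.congr (.of_forall fun ξ => (fourierT_eq_fourier _ ξ).symm)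

/-- The multiplication formula for `fourierT`. -/
lemma integral_mul_fourierT {n : ℕ} {g u : EuclideanSpace ℝ (Fin n) → ℂ}
    (hg : Integrable g) (hu : Integrable u) :
    ∫ ξ, g ξ * fourierT u ξ = ∫ y, fourierT g y * u y := by
  set c : ℂ := (((2 * Real.pi) ^ (-(n : ℝ) / 2) : ℝ) : ℂ)
  have hint : Integrable (fun p : EuclideanSpace ℝ (Fin n) × EuclideanSpace ℝ (Fin n) =>
      Complex.exp (-Complex.I * (⟪p.1, p.2⟫ : ℝ)) * (g p.1 * u p.2))
      (volume.prod volume) := by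
    refine (hg.mul_prod hu).bdd_mul (c := 1) ?_ (.of_forall fun p => ?_)
    · exact Continuous.aestronglyMeasurable (by fun_prop)
    · simp [Complex.norm_exp]
  calc ∫ ξ, g ξ * fourierT u ξ
      = c * ∫ ξ, ∫ y, Complex.exp (-Complex.I * (⟪ξ, y⟫ : ℝ)) * (g ξ * u y) := by
        rw [← integral_const_mul]
        congr 1 with ξ
        rw [fourierT, mul_left_comm, ← integral_const_mul]
        congr 2 with y
        rw [real_inner_comm]
        ring
    _ = c * ∫ y, ∫ ξ, Complex.exp (-Complex.I * (⟪ξ, y⟫ : ℝ)) * (g ξ * u y) := by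
        rw [integral_integral_swap hint]
    _ = ∫ y, fourierT g y * u y := by
        rw [← integral_const_mul]
        congr 1 with y
        rw [fourierT, mul_assoc, ← integral_mul_const]
        simp only [mul_assoc]
        rfl

/-- The Fourier transform of a modulated complex Gaussian is bounded by its value at the
frequency of the modulation. -/
lemma norm_fourierT_gaussian_le {n : ℕ} {b : ℂ} (hb : 0 < b.re)
    (x y : EuclideanSpace ℝ (Fin n)) :
    ‖fourierT (fun ξ => Complex.exp (-b * (‖ξ‖ : ℂ) ^ 2 + Complex.I * (⟪x, ξ⟫ : ℝ))) y‖ ≤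
      (2 * Real.pi) ^ (-(n : ℝ) / 2) * (Real.pi / ‖b‖) ^ ((n : ℝ) / 2) := by
  have h := GaussianFourier.integral_cexp_neg_mul_sq_norm_add hb Complex.I (x - y)
  have hexp : ‖Complex.exp (Complex.I ^ 2 * (‖x - y‖ : ℂ) ^ 2 / (4 * b))‖ ≤ 1 := by
    rw [Complex.norm_exp, Real.exp_le_one_iff]
    have : Complex.I ^ 2 * (‖x - y‖ : ℂ) ^ 2 / (4 * b) = ((-(‖x - y‖ ^ 2 / 4) : ℝ) : ℂ) * b⁻¹ := by
      rw [Complex.I_sq]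
      push_cast
      ring
    rw [this, Complex.re_ofReal_mul, Complex.inv_re]
    exact mul_nonpos_of_nonpos_of_nonneg (by simp only [neg_nonpos]; positivity)
      (div_nonneg hb.le (Complex.normSq_nonneg b))
  have hfun : ∀ ξ : EuclideanSpace ℝ (Fin n), Complex.exp (-Complex.I * (⟪ξ, y⟫ : ℝ)) *
      Complex.exp (-b * (‖ξ‖ : ℂ) ^ 2 + Complex.I * (⟪x, ξ⟫ : ℝ)) =
      Complex.exp (-b * (‖ξ‖ : ℂ) ^ 2 + Complex.I * (⟪x - y, ξ⟫ : ℝ)) := fun ξ => by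
    rw [← Complex.exp_add, inner_sub_left, real_inner_comm ξ y]
    congr 1
    push_cast
    ring
  have hc : 0 ≤ (2 * Real.pi) ^ (-(n : ℝ) / 2) := by positivity
  rw [fourierT, integral_congr_ae (.of_forall hfun), h, norm_mul, Complex.norm_of_nonneg hc]
  refine mul_le_mul_of_nonneg_left ?_ hc
  have he : ((Module.finrank ℝ (EuclideanSpace ℝ (Fin n)) : ℂ) / 2) = ((n / 2 : ℝ) : ℂ) := by
    simp
  rw [norm_mul, he, Complex.norm_cpow_real, norm_div, Complex.norm_of_nonneg Real.pi_pos.le]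
  exact mul_le_of_le_one_right (by positivity) hexp

/-- The dispersive bound for the Gaussian-regularized propagator, uniform in `ε`. -/
lemma norm_regularized_schrodSol_le {n : ℕ} {u : EuclideanSpace ℝ (Fin n) → ℂ}
    (hu : Integrable u) {t : ℝ} (ht : t ≠ 0) {ε : ℝ} (hε : 0 < ε)
    (x : EuclideanSpace ℝ (Fin n)) :
    ‖((2 * Real.pi) ^ (-(n : ℝ) / 2) : ℝ) * ∫ ξ, Complex.exp (-(ε + t * Complex.I) *
      (‖ξ‖ : ℂ) ^ 2 + Complex.I * (⟪x, ξ⟫ : ℝ)) * fourierT u ξ‖ ≤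
      (4 * Real.pi * |t|) ^ (-(n : ℝ) / 2) * ∫ y, ‖u y‖ := by
  set b : ℂ := ε + t * Complex.I
  have hb : 0 < b.re := by simpa [b] using hε
  have hbt : |t| ≤ ‖b‖ := by simpa [b] using Complex.abs_im_le_norm b
  have ht' : 0 < |t| := abs_pos.mpr ht
  have hc : 0 ≤ (2 * Real.pi) ^ (-(n : ℝ) / 2) := by positivity
  have hconst : (2 * Real.pi) ^ (-(n : ℝ) / 2) *
      ((2 * Real.pi) ^ (-(n : ℝ) / 2) * (Real.pi / |t|) ^ ((n : ℝ) / 2)) =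
      (4 * Real.pi * |t|) ^ (-(n : ℝ) / 2) := by
    have hinv : (Real.pi / |t|) ^ ((n : ℝ) / 2) = (|t| / Real.pi) ^ (-(n : ℝ) / 2) := by
      rw [neg_div, Real.rpow_neg_eq_inv_rpow, inv_div]
    rw [hinv, ← Real.mul_rpow (by positivity) (by positivity),
      ← Real.mul_rpow (by positivity) (by positivity)]
    congr 1
    field_simp
    ring
  rw [integral_mul_fourierT
    (GaussianFourier.integrable_cexp_neg_mul_sq_norm_add hb Complex.I x) hu, norm_mul,
    Complex.norm_of_nonneg hc, ← hconst, mul_assoc, ← integral_const_mul]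
  refine mul_le_mul_of_nonneg_left ?_ hc
  refine norm_integral_le_of_norm_le (hu.norm.const_mul _) (.of_forall fun y => ?_)
  rw [norm_mul]
  refine mul_le_mul_of_nonneg_right ((norm_fourierT_gaussian_le hb x y).trans ?_) (norm_nonneg _)
  gcongr

/-- **Dispersive estimate** for the free Schrödinger equation: for Schwartz initial
data `ψ₀` and `t ≠ 0`, `|ψ(t,x)| ≤ (4π|t|)^{-n/2} ∫ |ψ₀(y)| dy`. -/
theorem schrodinger_dispersive (n : ℕ) (hn : 1 ≤ n)
    (ψ₀ : SchwartzMap (EuclideanSpace ℝ (Fin n)) ℂ)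
    (t : ℝ) (ht : t ≠ 0) (x : EuclideanSpace ℝ (Fin n)) :
    ‖schrodSol ψ₀ t x‖ ≤ (4 * Real.pi * |t|) ^ (-(n : ℝ) / 2) * ∫ y, ‖ψ₀ y‖ := by
  let F : ℝ → EuclideanSpace ℝ (Fin n) → ℂ := fun ε ξ => Complex.exp (-(ε + t * Complex.I) *
      (‖ξ‖ : ℂ) ^ 2 + Complex.I * (⟪x, ξ⟫ : ℝ)) * fourierT ψ₀ ξ
  have hlim : Filter.Tendsto (fun ε => ∫ ξ, F ε ξ) (nhdsWithin 0 (Set.Ioi 0))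
      (nhds (∫ ξ, F 0 ξ)) := by
    refine tendsto_integral_filter_of_dominated_convergence (fun ξ => ‖fourierT ψ₀ ξ‖)
      (.of_forall fun ε => ?_) ?_ ψ₀.integrable_fourierT.norm (.of_forall fun ξ => ?_)
    · exact (Continuous.aestronglyMeasurable (by fun_prop)).mul
        ψ₀.integrable_fourierT.aestronglyMeasurable
    · filter_upwards [self_mem_nhdsWithin] with ε hε
      refine .of_forall fun ξ => ?_
      rw [norm_mul, Complex.norm_exp]
      refine mul_le_of_le_one_left (norm_nonneg _) (Real.exp_le_one_iff.mpr ?_)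
      have : 0 ≤ ε * ‖ξ‖ ^ 2 := mul_nonneg (le_of_lt hε) (by positivity)
      simpa [← Complex.ofReal_pow] using this
    · have : Continuous fun ε : ℝ => F ε ξ := by fun_prop
      exact (this.tendsto 0).mono_left nhdsWithin_le_nhds
  have hsol : schrodSol ψ₀ t x = ((2 * Real.pi) ^ (-(n : ℝ) / 2) : ℝ) * ∫ ξ, F 0 ξ := by
    rw [schrodSol]
    congr 2 with ξ
    rw [← Complex.exp_add]
    congr 2
    push_cast
    ring
  rw [hsol]
  refine le_of_tendsto (hlim.const_mul _).norm ?_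
  filter_upwards [self_mem_nhdsWithin] with ε hε
  exact norm_regularized_schrodSol_le ψ₀.integrable ht hε x
end

section
/- Let n ≥ 4. There is a constant C (depending only on n) such that for every ψ₀ ∈ 𝒮(ℝⁿ), every T > 0, and ψ the solution of the free Schrödinger equation with initial data ψ₀, the weighted Morawetz estimate ∫_0^T ∫_{ℝⁿ} |ψ(t,x)|² / |x|³ dx dt ≤ C ‖ψ₀‖²_{H^{1/2}} holds (with C independent of T). -/
open MeasureTheory
open scoped RealInnerProductSpace

open Set in
/-- Integration of radial functions in polar coordinates. -/
lemma lintegral_fun_norm_addHaar {E : Type*} [NormedAddCommGroup E] [NormedSpace ℝ E]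
    [MeasurableSpace E] [BorelSpace E] [Nontrivial E] [FiniteDimensional ℝ E]
    (μ : Measure E) [μ.IsAddHaarMeasure] {f : ℝ → ENNReal} (hf : Measurable f) :
    ∫⁻ x, f ‖x‖ ∂μ = μ.toSphere univ *
      ∫⁻ y in Ioi (0 : ℝ), ENNReal.ofReal (y ^ (Module.finrank ℝ E - 1)) * f y := by
  calc
    ∫⁻ x, f ‖x‖ ∂μ = ∫⁻ x : ({(0)}ᶜ : Set E), f ‖x.1‖ ∂(μ.comap (↑)) := by
      rw [lintegral_subtype_comap (measurableSet_singleton _).compl fun x ↦ f ‖x‖,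
        restrict_compl_singleton]
    _ = ∫⁻ x, f x.2 ∂μ.toSphere.prod (.volumeIoiPow (Module.finrank ℝ E - 1)) := by
      simpa using (μ.measurePreserving_homeomorphUnitSphereProd.lintegral_comp
        (f := fun p => f p.2.1) (by fun_prop))
    _ = μ.toSphere univ * ∫⁻ x : Ioi (0 : ℝ), f x ∂.volumeIoiPow (Module.finrank ℝ E - 1) := by
      rw [lintegral_prod _ (by fun_prop)]; simp only [lintegral_const, mul_comm]
    _ = _ := by
      rw [Measure.volumeIoiPow, lintegral_withDensity_eq_lintegral_mul _ (by fun_prop)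
        (by fun_prop), ← lintegral_subtype_comap measurableSet_Ioi]
      rfl

/-- Frequency side of the Gaussian superposition defining a Riesz potential. -/
lemma lintegral_gaussian_superposition {a d : ℝ} (ha : 0 < a) (hd : 0 < d) :
    ∫⁻ σ in Set.Ioi (0 : ℝ), ENNReal.ofReal (σ ^ (a - 1) * Real.exp (-(d * σ)))
      = ENNReal.ofReal ((1 / d) ^ a * Real.Gamma a) := by
  rw [← Real.integral_rpow_mul_exp_neg_mul_Ioi ha hd]
  refine (ofReal_integral_eq_lintegral_ofReal ?_ ?_).symm
  · refine not_imp_comm.1 integral_undef ?_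
    rw [Real.integral_rpow_mul_exp_neg_mul_Ioi ha hd]
    have := Real.Gamma_pos_of_pos ha
    positivity
  · filter_upwards [ae_restrict_mem measurableSet_Ioi] with σ hσ
    have : (0 : ℝ) < σ := hσ
    positivity

/-- Position side: the superposition of Gaussians dominates an inverse power. -/
lemma inv_cube_le_lintegral {r : ℝ} (hr : 0 < r) :
    ENNReal.ofReal (1 / r ^ 3) ≤ ENNReal.ofReal (Real.exp 1 * 2 ^ (5 / 2 : ℝ)) *
      ∫⁻ σ in Set.Ioi (0 : ℝ), ENNReal.ofReal (σ ^ (-5 / 2 : ℝ) * Real.exp (-(1 / σ) * r ^ 2)) := by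
  have h2 : (0 : ℝ) < r ^ 2 := by positivity
  have key : ∫⁻ _σ in Set.Icc (r ^ 2) (2 * r ^ 2),
      ENNReal.ofReal ((2 * r ^ 2) ^ (-5 / 2 : ℝ) * Real.exp (-1)) ≤
      ∫⁻ σ in Set.Ioi (0 : ℝ), ENNReal.ofReal (σ ^ (-5 / 2 : ℝ) * Real.exp (-(1 / σ) * r ^ 2)) := by
    refine (setLIntegral_mono' measurableSet_Icc fun σ hσ => ?_).trans
      (lintegral_mono_set fun σ hσ => h2.trans_le hσ.1)
    have hσ0 : 0 < σ := h2.trans_le hσ.1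
    refine ENNReal.ofReal_le_ofReal (mul_le_mul ?_ ?_ (by positivity) (by positivity))
    · exact Real.rpow_le_rpow_of_nonpos hσ0 hσ.2 (by norm_num)
    · refine Real.exp_le_exp.2 ?_
      have : 1 / σ * r ^ 2 ≤ 1 := by
        rw [one_div, inv_mul_le_iff₀ hσ0]; simpa using hσ.1
      linarith
  refine le_trans (le_of_eq ?_) (mul_le_mul_right key _)
  rw [setLIntegral_const, Real.volume_Icc, ← ENNReal.ofReal_mul (by positivity),
    ← ENNReal.ofReal_mul (by positivity)]
  congr 1
  rw [Real.mul_rpow (by norm_num) h2.le, ← Real.rpow_natCast r 2, ← Real.rpow_mul hr.le,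
    Real.exp_neg, show (-5 / 2 : ℝ) = -(5 / 2) by norm_num, Real.rpow_neg (by norm_num)]
  rw [show ((2 : ℕ) : ℝ) * -(5 / 2) = -((5 : ℕ) : ℝ) by norm_num, Real.rpow_neg hr.le,
    Real.rpow_natCast, Real.rpow_natCast]
  have : (2 : ℝ) ^ (5 / 2 : ℝ) ≠ 0 := by positivity
  field_simp
  ring

lemma lintegral_ofReal_exp_neg_mul_sq {b : ℝ} (hb : 0 < b) :
    ∫⁻ x : ℝ, ENNReal.ofReal (Real.exp (-b * x ^ 2)) = ENNReal.ofReal (√(Real.pi / b)) := by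
  rw [← integral_gaussian b]
  exact (ofReal_integral_eq_lintegral_ofReal (integrable_exp_neg_mul_sq hb)
    (Filter.Eventually.of_forall fun x => (Real.exp_pos _).le)).symm

/-- Substituting `v = ρ ^ 2` in a half-line integral. -/
lemma lintegral_Ioi_mul_comp_sq_le (f : ℝ → ENNReal) :
    ∫⁻ ρ in Set.Ioi (0 : ℝ), ENNReal.ofReal ρ * f (ρ ^ 2) ≤ ∫⁻ v in Set.Ioi (0 : ℝ), f v := by
  have h := lintegral_image_eq_lintegral_abs_deriv_mul (s := Set.Ioi (0 : ℝ)) (f := fun x => x ^ 2)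
    (f' := fun x => 2 * x) measurableSet_Ioi
    (fun x _ => by simpa using (hasDerivAt_pow 2 x).hasDerivWithinAt)
    (fun x hx y hy hxy => (pow_left_inj₀ (le_of_lt hx) (le_of_lt hy) two_ne_zero).1 hxy) f
  calc _ ≤ ∫⁻ x in Set.Ioi (0 : ℝ), ENNReal.ofReal |2 * x| * f (x ^ 2) := by
        refine setLIntegral_mono' measurableSet_Ioi fun x hx => ?_
        gcongr
        refine le_trans ?_ (le_abs_self _)
        have : (0 : ℝ) < x := hx
        linarith
    _ = _ := h.symm
    _ ≤ _ := lintegral_mono_set (by rintro _ ⟨x, hx, rfl⟩; exact pow_pos (Set.mem_Ioi.1 hx) 2)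

/-- The Fourier transform of a Gaussian on a Euclidean space, in absolute value. -/
lemma norm_integral_gaussian_mul_cexp {V : Type*} [NormedAddCommGroup V] [InnerProductSpace ℝ V]
    [FiniteDimensional ℝ V] [MeasurableSpace V] [BorelSpace V] {b : ℝ} (hb : 0 < b) (w : V) :
    ‖∫ x : V, ((Real.exp (-b * ‖x‖ ^ 2) : ℝ) : ℂ) * Complex.exp ((⟪x, w⟫ : ℝ) * Complex.I)‖
      = (Real.pi / b) ^ ((Module.finrank ℝ V : ℝ) / 2) * Real.exp (-‖w‖ ^ 2 / (4 * b)) := by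
  have h := GaussianFourier.integral_cexp_neg_mul_sq_norm_add (V := V) (b := (b : ℂ))
    (by simpa using hb) Complex.I w
  have h1 : ∀ x : V, ((Real.exp (-b * ‖x‖ ^ 2) : ℝ) : ℂ) *
      Complex.exp ((⟪x, w⟫ : ℝ) * Complex.I) =
      Complex.exp (-(b : ℂ) * ‖x‖ ^ 2 + Complex.I * ⟪w, x⟫) := by
    intro x
    rw [Complex.exp_add, real_inner_comm, mul_comm Complex.I]
    push_cast
    rfl
  simp_rw [h1]
  rw [h, norm_mul]
  congr 1
  · have : ((Real.pi : ℂ) / b) ^ ((Module.finrank ℝ V : ℂ) / 2) =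
        (((Real.pi / b) ^ ((Module.finrank ℝ V : ℝ) / 2) : ℝ) : ℂ) := by
      rw [Complex.ofReal_cpow (by positivity)]
      push_cast
      rfl
    rw [this, Complex.norm_real, Real.norm_of_nonneg (by positivity)]
  · have : Complex.I ^ 2 * (‖w‖ : ℂ) ^ 2 / (4 * b) = ((-‖w‖ ^ 2 / (4 * b) : ℝ) : ℂ) := by
      push_cast
      rw [Complex.I_sq]
      ring
    rw [this, ← Complex.ofReal_exp, Complex.norm_real, Real.norm_of_nonneg (Real.exp_pos _).le]

/-- The space-time Fourier transform of a Gaussian, in absolute value. -/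
lemma norm_integral_spacetime_gaussian {V : Type*} [NormedAddCommGroup V] [InnerProductSpace ℝ V]
    [FiniteDimensional ℝ V] [MeasurableSpace V] [BorelSpace V] {ε s : ℝ} (hε : 0 < ε) (hs : 0 < s)
    (τ : ℝ) (w : V) :
    ‖∫ y : ℝ × V, ((Real.exp (-ε * y.1 ^ 2) * Real.exp (-s * ‖y.2‖ ^ 2) : ℝ) : ℂ) *
      Complex.exp (((⟪y.2, w⟫ - y.1 * τ : ℝ) : ℂ) * Complex.I)‖
      = √(Real.pi / ε) * Real.exp (-τ ^ 2 / (4 * ε)) *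
        ((Real.pi / s) ^ ((Module.finrank ℝ V : ℝ) / 2) * Real.exp (-‖w‖ ^ 2 / (4 * s))) := by
  have h1 := norm_integral_gaussian_mul_cexp (V := ℝ) hε (-τ)
  have h2 := norm_integral_gaussian_mul_cexp hs w
  rw [← h2, Real.sqrt_eq_rpow]
  simp only [Real.norm_eq_abs, sq_abs, abs_neg, Module.finrank_self, Nat.cast_one] at h1
  rw [← h1, ← norm_mul, ← integral_prod_mul, Measure.volume_eq_prod]
  congr 1
  refine integral_congr_ae (Filter.Eventually.of_forall fun y => ?_)
  have : Complex.exp (((⟪y.2, w⟫ - y.1 * τ : ℝ) : ℂ) * Complex.I) =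
      Complex.exp ((⟪y.1, -τ⟫ : ℝ) * Complex.I) * Complex.exp ((⟪y.2, w⟫ : ℝ) * Complex.I) := by
    rw [← Complex.exp_add]
    congr 1
    simp
    ring
  simp only [this]
  push_cast
  ring

/-- Splitting off the first coordinate of a Euclidean space. -/
lemma lintegral_euclideanSpace_succ {m : ℕ} {F : EuclideanSpace ℝ (Fin (m + 1)) → ENNReal}
    (hF : Measurable F) :
    ∫⁻ η, F η = ∫⁻ a : ℝ, ∫⁻ y : EuclideanSpace ℝ (Fin m),
      F (WithLp.toLp 2 (Fin.cons a (WithLp.ofLp y))) := by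
  have e1 := PiLp.volume_preserving_toLp (Fin (m + 1))
  have e2 := (volume_preserving_piFinSuccAbove (fun _ : Fin (m + 1) => ℝ) 0).symm
  have e3 : MeasurePreserving (WithLp.ofLp : EuclideanSpace ℝ (Fin m) → _) :=
    PiLp.volume_preserving_ofLp (Fin m)
  have hcons : ∀ p : ℝ × (Fin m → ℝ),
      (MeasurableEquiv.piFinSuccAbove (fun _ : Fin (m + 1) => ℝ) 0).symm p = Fin.cons p.1 p.2 :=
    fun p => by simp [MeasurableEquiv.piFinSuccAbove]; rfl
  have hc : Measurable fun p : ℝ × (Fin m → ℝ) => F (WithLp.toLp 2 (Fin.cons p.1 p.2)) := by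
    simpa only [Function.comp_def, hcons] using (hF.comp e1.measurable).comp e2.measurable
  rw [← e1.lintegral_comp hF, ← e2.lintegral_comp (f := fun x => F (WithLp.toLp 2 x))
    (hF.comp e1.measurable), Measure.volume_eq_prod]
  simp only [hcons]
  rw [lintegral_prod]
  · refine lintegral_congr fun a => ?_
    exact (e3.lintegral_comp (f := fun y => F (WithLp.toLp 2 (Fin.cons a y)))
      (hc.comp measurable_prodMk_left)).symm
  · exact hc.aemeasurable

lemma norm_toLp_cons_sq {m : ℕ} (a : ℝ) (y : Fin m → ℝ) :
    ‖(WithLp.toLp 2 (Fin.cons a y) : EuclideanSpace ℝ (Fin (m + 1)))‖ ^ 2 =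
      a ^ 2 + ‖(WithLp.toLp 2 y : EuclideanSpace ℝ (Fin m))‖ ^ 2 := by
  simp [EuclideanSpace.norm_sq_eq, Fin.sum_univ_succ]

lemma lintegral_sqrt_inv_mul_gaussian {ε : ℝ} (hε : 0 < ε) (b : ℝ) :
    ∫⁻ v : ℝ, ENNReal.ofReal (√(1 / ε) * Real.exp (-(b - v) ^ 2 / (4 * ε))) =
      ENNReal.ofReal √(4 * Real.pi) := by
  have : ∀ x : ℝ, -x ^ 2 / (4 * ε) = -(1 / (4 * ε)) * x ^ 2 := fun x => by ring
  simp_rw [ENNReal.ofReal_mul (Real.sqrt_nonneg _), this]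
  rw [lintegral_const_mul _ (by fun_prop),
    lintegral_sub_left_eq_self (fun v => ENNReal.ofReal (Real.exp (-(1 / (4 * ε)) * v ^ 2))) b,
    lintegral_ofReal_exp_neg_mul_sq (by positivity), ← ENNReal.ofReal_mul (by positivity),
    ← Real.sqrt_mul (by positivity)]
  congr 2
  field_simp

lemma lintegral_Ioi_shell_le {ε r : ℝ} (hε : 0 < ε) (hε1 : ε ≤ 1) (hr : 0 ≤ r) (a : ℝ) :
    ∫⁻ v in Set.Ioi (0 : ℝ),
      ENNReal.ofReal (√(1 / ε) * Real.exp (-(r ^ 2 - (a ^ 2 + v)) ^ 2 / (4 * ε))) ≤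
    ENNReal.ofReal √(4 * Real.pi) * ((Set.Icc (-(2 * r + 1)) (2 * r + 1)).indicator 1 a +
      ENNReal.ofReal (Real.exp (-(1 / 8) * a ^ 2))) := by
  by_cases ha : a ∈ Set.Icc (-(2 * r + 1)) (2 * r + 1)
  · rw [Set.indicator_of_mem ha]
    calc _ ≤ ∫⁻ v : ℝ,
          ENNReal.ofReal (√(1 / ε) * Real.exp (-((r ^ 2 - a ^ 2) - v) ^ 2 / (4 * ε))) := by
          simp_rw [sub_sub]
          exact setLIntegral_le_lintegral _ _
      _ = ENNReal.ofReal √(4 * Real.pi) * 1 := by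
          rw [lintegral_sqrt_inv_mul_gaussian hε, mul_one]
      _ ≤ _ := by gcongr; exact le_self_add
  · rw [Set.indicator_of_notMem ha, zero_add]
    have ha' : 2 * r + 1 ≤ |a| := by
      by_contra! h
      exact ha (abs_le.1 h.le)
    have h1 : 1 ≤ a ^ 2 := by rw [← sq_abs]; nlinarith
    have h2 : 4 * r ^ 2 ≤ a ^ 2 := by rw [← sq_abs a]; nlinarith
    calc _ ≤ ∫⁻ v in Set.Ioi (0 : ℝ), ENNReal.ofReal (Real.exp (-(1 / 8) * a ^ 2)) *
          ENNReal.ofReal (√(1 / ε) * Real.exp (-(0 - v) ^ 2 / (4 * ε))) := by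
          refine setLIntegral_mono' measurableSet_Ioi fun v hv => ?_
          have hv : 0 < v := hv
          rw [← ENNReal.ofReal_mul (Real.exp_pos _).le, mul_left_comm, ← Real.exp_add]
          refine ENNReal.ofReal_le_ofReal
            (mul_le_mul_of_nonneg_left (Real.exp_le_exp.2 ?_) (Real.sqrt_nonneg _))
          have h3 : (a ^ 2 - r ^ 2) ^ 2 + v ^ 2 ≤ (r ^ 2 - (a ^ 2 + v)) ^ 2 := by nlinarith
          have h4 : 1 / 2 * a ^ 2 ≤ (a ^ 2 - r ^ 2) ^ 2 := by nlinarith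
          have h5 : 1 / 8 * a ^ 2 * (4 * ε) ≤ 1 / 2 * a ^ 2 := by nlinarith
          rw [show -(1 / 8) * a ^ 2 + -(0 - v) ^ 2 / (4 * ε) =
            -(1 / 8 * a ^ 2 * (4 * ε) + v ^ 2) / (4 * ε) by field_simp; ring]
          gcongr
          linarith
      _ ≤ ∫⁻ v : ℝ, ENNReal.ofReal (Real.exp (-(1 / 8) * a ^ 2)) *
          ENNReal.ofReal (√(1 / ε) * Real.exp (-(0 - v) ^ 2 / (4 * ε))) :=
          setLIntegral_le_lintegral _ _
      _ = _ := by
          rw [lintegral_const_mul _ (by fun_prop), lintegral_sqrt_inv_mul_gaussian hε, mul_comm]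

/-- The potential of a thickened sphere through `ξ`, with respect to a radially decreasing
kernel `H` that is no more singular than `ρ ^ (2 - m)`, is `O(1 + ‖ξ‖)`. -/
lemma lintegral_shell_mul_le {m : ℕ} (hm : 2 ≤ m) {H : ℝ → ENNReal} (hH : Measurable H)
    (hanti : AntitoneOn H (Set.Ici 0)) {A : ENNReal}
    (hA : ∀ ρ : ℝ, 0 < ρ → ENNReal.ofReal (ρ ^ (m - 2)) * H ρ ≤ A)
    {ε : ℝ} (hε : 0 < ε) (hε1 : ε ≤ 1) (ξ : EuclideanSpace ℝ (Fin (m + 1))) :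
    ∫⁻ η, ENNReal.ofReal (√(1 / ε) * Real.exp (-(‖ξ‖ ^ 2 - ‖η‖ ^ 2) ^ 2 / (4 * ε))) * H ‖ξ - η‖
      ≤ (volume : Measure (EuclideanSpace ℝ (Fin m))).toSphere Set.univ * A *
        ENNReal.ofReal (√(4 * Real.pi) * (4 + √(8 * Real.pi)) * (1 + ‖ξ‖)) := by
  set r := ‖ξ‖
  set S := (volume : Measure (EuclideanSpace ℝ (Fin m))).toSphere Set.univ
  have hr : 0 ≤ r := norm_nonneg _
  set ξ₀ : EuclideanSpace ℝ (Fin (m + 1)) := WithLp.toLp 2 (Fin.cons r 0)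
  have hξ₀ : ‖ξ‖ = ‖ξ₀‖ := by
    rw [← sq_eq_sq₀ (norm_nonneg _) (norm_nonneg _), norm_toLp_cons_sq]
    simp [r]
  set R := (ℝ ∙ (ξ - ξ₀))ᗮ.reflection
  have hR : R ξ = ξ₀ := Submodule.reflection_sub hξ₀
  let k : ℝ → ℝ := fun u => √(1 / ε) * Real.exp (-(r ^ 2 - u) ^ 2 / (4 * ε))
  have hk : Measurable k := by fun_prop
  have : Nontrivial (EuclideanSpace ℝ (Fin m)) := by
    have : Nonempty (Fin m) := ⟨⟨0, by omega⟩⟩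
    infer_instance
  calc _ = ∫⁻ η, ENNReal.ofReal (k (‖R η‖ ^ 2)) * H ‖ξ₀ - R η‖ := by
        simp_rw [← hR, ← map_sub, LinearIsometryEquiv.norm_map]
        rfl
    _ = ∫⁻ η, ENNReal.ofReal (k (‖η‖ ^ 2)) * H ‖ξ₀ - η‖ :=
        R.measurePreserving.lintegral_comp
          (f := fun η => ENNReal.ofReal (k (‖η‖ ^ 2)) * H ‖ξ₀ - η‖) (by fun_prop)
    _ = ∫⁻ a : ℝ, ∫⁻ y : EuclideanSpace ℝ (Fin m), ENNReal.ofReal (k (a ^ 2 + ‖y‖ ^ 2)) *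
          H ‖ξ₀ - WithLp.toLp 2 (Fin.cons a (WithLp.ofLp y))‖ := by
        rw [lintegral_euclideanSpace_succ (by fun_prop)]
        simp_rw [norm_toLp_cons_sq]
    _ ≤ ∫⁻ a : ℝ, ∫⁻ y : EuclideanSpace ℝ (Fin m), ENNReal.ofReal (k (a ^ 2 + ‖y‖ ^ 2)) *
          H ‖y‖ := by
        refine lintegral_mono fun a => lintegral_mono fun y => ?_
        refine mul_le_mul_right (hanti (norm_nonneg _) (norm_nonneg _) ?_) _
        rw [← sq_le_sq₀ (norm_nonneg _) (norm_nonneg _)]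
        have : ξ₀ - WithLp.toLp 2 (Fin.cons a (WithLp.ofLp y)) =
            WithLp.toLp 2 (Fin.cons (r - a) (WithLp.ofLp (-y))) := by
          ext i
          refine Fin.cases ?_ (fun j => ?_) i <;> simp [ξ₀]
        rw [this, norm_toLp_cons_sq]
        simp
        positivity
    _ = ∫⁻ a : ℝ, S * ∫⁻ ρ in Set.Ioi (0 : ℝ), ENNReal.ofReal (ρ ^ (m - 1)) *
          (ENNReal.ofReal (k (a ^ 2 + ρ ^ 2)) * H ρ) := by
        refine lintegral_congr fun a => ?_
        rw [lintegral_fun_norm_addHaar volume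
          (f := fun ρ => ENNReal.ofReal (k (a ^ 2 + ρ ^ 2)) * H ρ) (by fun_prop)]
        simp [S]
    _ ≤ ∫⁻ a : ℝ, S * (A * (ENNReal.ofReal √(4 * Real.pi) *
          ((Set.Icc (-(2 * r + 1)) (2 * r + 1)).indicator 1 a +
            ENNReal.ofReal (Real.exp (-(1 / 8) * a ^ 2))))) := by
        refine lintegral_mono fun a => mul_le_mul_right ?_ _
        calc _ ≤ ∫⁻ ρ in Set.Ioi (0 : ℝ), A * (ENNReal.ofReal ρ *
              ENNReal.ofReal (k (a ^ 2 + ρ ^ 2))) := by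
              refine setLIntegral_mono' measurableSet_Ioi fun ρ hρ => ?_
              have hρ : 0 < ρ := hρ
              rw [show m - 1 = (m - 2) + 1 by omega, pow_succ, ENNReal.ofReal_mul (by positivity)]
              calc _ = (ENNReal.ofReal (ρ ^ (m - 2)) * H ρ) * (ENNReal.ofReal ρ *
                    ENNReal.ofReal (k (a ^ 2 + ρ ^ 2))) := by ring
                _ ≤ _ := mul_le_mul_left (hA ρ hρ) _
          _ = A * ∫⁻ ρ in Set.Ioi (0 : ℝ), ENNReal.ofReal ρ *
              ENNReal.ofReal (k (a ^ 2 + ρ ^ 2)) := lintegral_const_mul _ (by fun_prop)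
          _ ≤ _ := mul_le_mul_right ((lintegral_Ioi_mul_comp_sq_le
              (fun v => ENNReal.ofReal (k (a ^ 2 + v)))).trans
              (lintegral_Ioi_shell_le hε hε1 hr a)) _
    _ = S * A * ENNReal.ofReal (√(4 * Real.pi) * (4 * r + 2 + √(8 * Real.pi))) := by
        have hi : Measurable ((Set.Icc (-(2 * r + 1)) (2 * r + 1)).indicator
            (1 : ℝ → ENNReal)) := measurable_one.indicator measurableSet_Icc
        rw [lintegral_const_mul _ (by fun_prop), lintegral_const_mul _ (by fun_prop),
          lintegral_const_mul _ (by fun_prop), lintegral_add_left hi,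
          lintegral_indicator_one measurableSet_Icc, Real.volume_Icc,
          lintegral_ofReal_exp_neg_mul_sq (by norm_num),
          ← ENNReal.ofReal_add (by linarith) (by positivity),
          ← ENNReal.ofReal_mul (by positivity), mul_assoc]
        congr 4
        congr 1
        · ring
        · congr 1; ring
    _ ≤ _ := by
        refine mul_le_mul_right (ENNReal.ofReal_le_ofReal ?_) _
        rw [mul_assoc]
        refine mul_le_mul_of_nonneg_left ?_ (Real.sqrt_nonneg _)
        nlinarith [mul_nonneg (Real.sqrt_nonneg (8 * Real.pi)) hr]

/-- A weighted `L²` norm of an oscillatory integral is controlled by the quadratic form of the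
Fourier kernel of the weight. -/
lemma lintegral_weight_mul_sq_oscillatory_le {Y X : Type*} [MeasurableSpace Y] [MeasurableSpace X]
    {μ : Measure Y} {ν : Measure X} [SFinite μ] [SFinite ν]
    {g : Y → ℝ} (hg : Integrable g μ) (hg0 : ∀ y, 0 ≤ g y)
    {θ : Y → X → ℝ} (hθ : Measurable (Function.uncurry θ))
    {φ : X → ℂ} (hφ : Integrable φ ν) {k : X → X → ℝ}
    (hk : ∀ ξ η, ‖∫ y, (g y : ℂ) * Complex.exp (((θ y ξ - θ y η : ℝ) : ℂ) * Complex.I) ∂μ‖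
      ≤ k ξ η) :
    ∫⁻ y, ENNReal.ofReal (g y * ‖∫ ξ, Complex.exp (θ y ξ * Complex.I) * φ ξ ∂ν‖ ^ 2) ∂μ
      ≤ ∫⁻ z, ‖φ z.1‖ₑ * ‖φ z.2‖ₑ * ENNReal.ofReal (k z.1 z.2) ∂(ν.prod ν) := by
  set e : Y → X → ℂ := fun y ξ => Complex.exp (θ y ξ * Complex.I)
  have he : Measurable (Function.uncurry e) := by
    have : Function.uncurry e = fun p : Y × X =>
        Complex.exp (((Function.uncurry θ p : ℝ) : ℂ) * Complex.I) := rfl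
    rw [this]; fun_prop
  have hen : ∀ y ξ, ‖e y ξ‖ = 1 := fun y ξ => Complex.norm_exp_ofReal_mul_I _
  let F : Y → X × X → ℂ := fun y z =>
    g y * ((e y z.1 * φ z.1) * (starRingEnd ℂ) (e y z.2 * φ z.2))
  have hF : Integrable (Function.uncurry F) (μ.prod (ν.prod ν)) := by
    have h1 : Integrable (fun z : X × X => φ z.1 * (starRingEnd ℂ) (φ z.2)) (ν.prod ν) := by
      refine hφ.mul_prod (g := fun x => (starRingEnd ℂ) (φ x)) ?_
      exact (RCLike.conjLIE (K := ℂ)).toContinuousLinearEquiv.toContinuousLinearMap.integrable_comp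
        hφ
    have h2 := (hg.ofReal (𝕜 := ℂ)).mul_prod h1
    have hm : Measurable fun p : Y × X × X => e p.1 p.2.1 * (starRingEnd ℂ) (e p.1 p.2.2) := by
      have a1 : Measurable fun p : Y × X × X => e p.1 p.2.1 :=
        he.comp (measurable_fst.prodMk measurable_snd.fst)
      have a2 : Measurable fun p : Y × X × X => e p.1 p.2.2 :=
        he.comp (measurable_fst.prodMk measurable_snd.snd)
      exact a1.mul (Complex.continuous_conj.measurable.comp a2)
    refine (h2.bdd_mul (c := 1) hm.aestronglyMeasurable ?_).congr ?_
    · filter_upwards with p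
      simp [hen]
    · filter_upwards with p
      simp [Function.uncurry, F]
      ring
  have hFy : ∀ y, ∫ z, F y z ∂(ν.prod ν) =
      ((g y * ‖∫ ξ, e y ξ * φ ξ ∂ν‖ ^ 2 : ℝ) : ℂ) := by
    intro y
    simp only [F]
    rw [integral_const_mul, integral_prod_mul (fun x => e y x * φ x)
      (fun x => (starRingEnd ℂ) (e y x * φ x)), integral_conj, Complex.mul_conj']
    push_cast
    rfl
  have hint := hF.integral_prod_left
  simp only [Function.uncurry_apply_pair, hFy] at hint
  have hint' : Integrable (fun y => g y * ‖∫ ξ, e y ξ * φ ξ ∂ν‖ ^ 2) μ := by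
    exact (integrable_congr (Filter.Eventually.of_forall fun y => Complex.ofReal_re _)).1 hint.re
  have h0 : ∀ y, 0 ≤ g y * ‖∫ ξ, e y ξ * φ ξ ∂ν‖ ^ 2 := fun y =>
    mul_nonneg (hg0 y) (by positivity)
  calc _ = ENNReal.ofReal (∫ y, g y * ‖∫ ξ, e y ξ * φ ξ ∂ν‖ ^ 2 ∂μ) :=
        (ofReal_integral_eq_lintegral_ofReal hint' (Filter.Eventually.of_forall h0)).symm
    _ = ‖∫ y, ∫ z, F y z ∂(ν.prod ν) ∂μ‖ₑ := by
        simp only [hFy]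
        rw [integral_complex_ofReal, ← ofReal_norm, Complex.norm_real,
          Real.norm_of_nonneg (integral_nonneg h0)]
    _ = ‖∫ z, ∫ y, F y z ∂μ ∂(ν.prod ν)‖ₑ := by rw [integral_integral_swap hF]
    _ ≤ ∫⁻ z, ‖∫ y, F y z ∂μ‖ₑ ∂(ν.prod ν) := enorm_integral_le_lintegral_enorm _
    _ ≤ ∫⁻ z, ‖φ z.1‖ₑ * ‖φ z.2‖ₑ * ENNReal.ofReal (k z.1 z.2) ∂(ν.prod ν) := by
        refine lintegral_mono fun z => ?_
        have : ∫ y, F y z ∂μ = φ z.1 * (starRingEnd ℂ) (φ z.2) * ∫ y, (g y : ℂ) *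
            Complex.exp (((θ y z.1 - θ y z.2 : ℝ) : ℂ) * Complex.I) ∂μ := by
          rw [← integral_const_mul]
          refine integral_congr_ae (Filter.Eventually.of_forall fun y => ?_)
          simp only [F, e, map_mul, ← Complex.exp_conj, Complex.conj_ofReal, Complex.conj_I]
          push_cast
          rw [sub_mul, sub_eq_add_neg, Complex.exp_add, mul_neg]
          ring
        rw [this, enorm_mul, enorm_mul]
        gcongr
        · exact (RCLike.enorm_conj _).le
        · rw [← ofReal_norm]
          exact ENNReal.ofReal_le_ofReal (hk _ _)

/-- Schur's test for a symmetric nonnegative kernel. -/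
lemma lintegral_prod_mul_symm_kernel_le {X : Type*} [MeasurableSpace X] {ν : Measure X} [SFinite ν]
    {f : X → ENNReal} (hf : Measurable f) {W : X → X → ENNReal}
    (hW : Measurable (Function.uncurry W)) (hsymm : ∀ ξ η, W ξ η = W η ξ) {B : X → ENNReal}
    (hB : ∀ ξ, ∫⁻ η, W ξ η ∂ν ≤ B ξ) :
    ∫⁻ z, f z.1 * f z.2 * W z.1 z.2 ∂(ν.prod ν) ≤ 2 * ∫⁻ ξ, f ξ ^ 2 * B ξ ∂ν := by
  have hW' : Measurable fun z : X × X => W z.1 z.2 := hW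
  have hamgm : ∀ a b : ENNReal, a * b ≤ a ^ 2 + b ^ 2 := fun a b => by
    rcases le_total a b with h | h
    · exact (mul_le_mul_left h b).trans (by rw [← sq]; exact le_add_self)
    · exact (mul_le_mul_right h a).trans (by rw [← sq]; exact le_self_add)
  have hrow : ∫⁻ ξ, ∫⁻ η, f ξ ^ 2 * W ξ η ∂ν ∂ν ≤ ∫⁻ ξ, f ξ ^ 2 * B ξ ∂ν := by
    refine lintegral_mono fun ξ => ?_
    rw [lintegral_const_mul _ (f := fun η => W ξ η) (hW'.comp measurable_prodMk_left)]
    exact mul_le_mul_right (hB ξ) _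
  calc _ ≤ ∫⁻ z, (f z.1 ^ 2 * W z.1 z.2 + f z.2 ^ 2 * W z.1 z.2) ∂(ν.prod ν) := by
        refine lintegral_mono fun z => ?_
        rw [← add_mul]
        exact mul_le_mul_left (hamgm _ _) _
    _ = (∫⁻ ξ, ∫⁻ η, f ξ ^ 2 * W ξ η ∂ν ∂ν) + ∫⁻ η, ∫⁻ ξ, f η ^ 2 * W ξ η ∂ν ∂ν := by
        rw [lintegral_add_left (by fun_prop), lintegral_prod _ (by fun_prop),
          lintegral_prod_symm _ (by fun_prop)]
    _ ≤ _ := by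
        rw [two_mul]
        refine add_le_add hrow ?_
        simp_rw [fun ξ η => hsymm η ξ]
        exact hrow

/-- The kernel on the frequency side of the inverse cube `1 / ‖x‖ ^ 3`, as a superposition of
Gaussians. -/
noncomputable def rieszKernel (n : ℕ) (ρ : ℝ) : ENNReal :=
  ∫⁻ σ in Set.Ioi (0 : ℝ), ENNReal.ofReal
    (σ ^ (-5 / 2 : ℝ) * ((Real.pi / (1 / σ)) ^ ((n : ℝ) / 2) * Real.exp (-ρ ^ 2 / (4 * (1 / σ)))))

lemma measurable_rieszKernel (n : ℕ) : Measurable (rieszKernel n) := by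
  unfold rieszKernel
  exact Measurable.lintegral_prod_right (by fun_prop)

lemma antitoneOn_rieszKernel (n : ℕ) : AntitoneOn (rieszKernel n) (Set.Ici 0) := by
  intro x hx y _ hxy
  have hx : 0 ≤ x := hx
  refine setLIntegral_mono' measurableSet_Ioi fun σ hσ => ENNReal.ofReal_le_ofReal ?_
  have : 0 < σ := hσ
  gcongr

lemma ofReal_pow_mul_rieszKernel_le {m : ℕ} (hm : 3 ≤ m) {ρ : ℝ} (hρ : 0 < ρ) :
    ENNReal.ofReal (ρ ^ (m - 2)) * rieszKernel (m + 1) ρ ≤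
      ENNReal.ofReal (Real.pi ^ (((m + 1 : ℕ) : ℝ) / 2) * 4 ^ (((m : ℝ) - 2) / 2) *
        Real.Gamma (((m : ℝ) - 2) / 2)) := by
  have hm' : (3 : ℝ) ≤ m := by exact_mod_cast hm
  have ha : 0 < ((m : ℝ) - 2) / 2 := by linarith
  have hd : 0 < ρ ^ 2 / 4 := by positivity
  have : rieszKernel (m + 1) ρ = ENNReal.ofReal (Real.pi ^ (((m + 1 : ℕ) : ℝ) / 2)) *
      ENNReal.ofReal ((1 / (ρ ^ 2 / 4)) ^ (((m : ℝ) - 2) / 2) *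
        Real.Gamma (((m : ℝ) - 2) / 2)) := by
    rw [← lintegral_gaussian_superposition ha hd, ← lintegral_const_mul _ (by fun_prop)]
    refine setLIntegral_congr_fun measurableSet_Ioi fun σ hσ => ?_
    have hσ : 0 < σ := hσ
    rw [← ENNReal.ofReal_mul (by positivity), div_div_eq_mul_div, div_one,
      Real.mul_rpow Real.pi_pos.le hσ.le,
      show ((m : ℝ) - 2) / 2 - 1 = -5 / 2 + ((m + 1 : ℕ) : ℝ) / 2 by push_cast; ring,
      Real.rpow_add hσ]
    rw [show -ρ ^ 2 / (4 * (1 / σ)) = -(ρ ^ 2 / 4 * σ) by field_simp]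
    congr 1
    ring
  rw [this, ← ENNReal.ofReal_mul (by positivity), ← ENNReal.ofReal_mul (by positivity)]
  refine le_of_eq (congrArg _ ?_)
  have h1 : ρ ^ (m - 2) = (ρ ^ 2) ^ (((m : ℝ) - 2) / 2) := by
    rw [← Real.rpow_natCast ρ 2, ← Real.rpow_mul hρ.le, ← Real.rpow_natCast,
      Nat.cast_sub (by omega)]
    congr 1
    push_cast
    ring
  rw [h1, one_div_div, Real.div_rpow (by norm_num) (by positivity)]
  have h2 : (ρ ^ 2) ^ (((m : ℝ) - 2) / 2) ≠ 0 := by positivity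
  field_simp

/-- The Morawetz estimate for the superposition of plane waves with profile `Φ`. -/
lemma lintegral_free_wave_div_cube_le {m : ℕ} (hm : 3 ≤ m) : ∃ C : ENNReal, C ≠ ⊤ ∧
    ∀ (Φ : EuclideanSpace ℝ (Fin (m + 1)) → ℂ), Measurable Φ → Integrable Φ → ∀ T : ℝ, 0 < T →
    ∫⁻ t in Set.Ioc (0 : ℝ) T, ∫⁻ x : EuclideanSpace ℝ (Fin (m + 1)),
      ENNReal.ofReal (‖∫ ξ, Complex.exp (((⟪x, ξ⟫ - t * ‖ξ‖ ^ 2 : ℝ) : ℂ) * Complex.I) * Φ ξ‖ ^ 2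
        / ‖x‖ ^ 3)
      ≤ C * ∫⁻ ξ, ‖Φ ξ‖ₑ ^ 2 * ENNReal.ofReal (1 + ‖ξ‖) := by
  set E := EuclideanSpace ℝ (Fin (m + 1))
  set A := ENNReal.ofReal (Real.pi ^ (((m + 1 : ℕ) : ℝ) / 2) * 4 ^ (((m : ℝ) - 2) / 2) *
        Real.Gamma (((m : ℝ) - 2) / 2))
  set S := (volume : Measure (EuclideanSpace ℝ (Fin m))).toSphere Set.univ
  set c₁ := ENNReal.ofReal (√(4 * Real.pi) * (4 + √(8 * Real.pi)))
  set κ := ENNReal.ofReal (Real.exp 1) * ENNReal.ofReal (Real.exp 1 * 2 ^ (5 / 2 : ℝ))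
  refine ⟨κ * (ENNReal.ofReal √Real.pi * (2 * (S * A * c₁))), ?_, ?_⟩
  · have hS : S ≠ ⊤ := measure_ne_top _ _
    finiteness
  intro Φ hΦm hΦ T hT
  let θ : ℝ × E → E → ℝ := fun y ξ => ⟪y.2, ξ⟫ - y.1 * ‖ξ‖ ^ 2
  have hθ : Measurable (Function.uncurry θ) := by
    have : Continuous (Function.uncurry θ) := by
      change Continuous fun p : (ℝ × E) × E => ⟪p.1.2, p.2⟫ - p.1.1 * ‖p.2‖ ^ 2
      fun_prop
    exact this.measurable
  let U : ℝ × E → ℂ := fun y => ∫ ξ, Complex.exp (θ y ξ * Complex.I) * Φ ξ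
  have hU : Measurable U := by
    refine (StronglyMeasurable.integral_prod_right
      (f := fun y ξ => Complex.exp (θ y ξ * Complex.I) * Φ ξ) ?_).measurable
    refine Measurable.stronglyMeasurable ?_
    change Measurable fun p : (ℝ × E) × E =>
      Complex.exp (((Function.uncurry θ p : ℝ) : ℂ) * Complex.I) * Φ p.2
    fun_prop
  set ε : ℝ := min 1 (1 / T ^ 2)
  have hε : 0 < ε := lt_min one_pos (by positivity)
  have hε1 : ε ≤ 1 := min_le_left _ _
  let g : ℝ → ℝ × E → ℝ := fun σ y =>
    Real.exp (-ε * y.1 ^ 2) * Real.exp (-(1 / σ) * ‖y.2‖ ^ 2)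
  have hg : Measurable (Function.uncurry g) := by
    change Measurable fun p : ℝ × ℝ × E =>
      Real.exp (-ε * p.2.1 ^ 2) * Real.exp (-(1 / p.1) * ‖p.2.2‖ ^ 2)
    fun_prop
  let K : E → E → ENNReal := fun ξ η =>
    ENNReal.ofReal (√(1 / ε) * Real.exp (-(‖ξ‖ ^ 2 - ‖η‖ ^ 2) ^ 2 / (4 * ε))) *
      rieszKernel (m + 1) ‖ξ - η‖
  have hR := measurable_rieszKernel (m + 1)
  have hK : Measurable (Function.uncurry K) := by
    change Measurable fun p : E × E =>
      ENNReal.ofReal (√(1 / ε) * Real.exp (-(‖p.1‖ ^ 2 - ‖p.2‖ ^ 2) ^ 2 / (4 * ε))) *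
        rieszKernel (m + 1) ‖p.1 - p.2‖
    fun_prop
  let k : ℝ → E → E → ℝ := fun σ ξ η =>
    √(Real.pi / ε) * Real.exp (-(‖ξ‖ ^ 2 - ‖η‖ ^ 2) ^ 2 / (4 * ε)) *
      ((Real.pi / (1 / σ)) ^ (((m + 1 : ℕ) : ℝ) / 2) *
        Real.exp (-‖ξ - η‖ ^ 2 / (4 * (1 / σ))))
  have hquad : ∀ σ : ℝ, 0 < σ → ∫⁻ y, ENNReal.ofReal (g σ y * ‖U y‖ ^ 2) ≤
      ∫⁻ z : E × E, ‖Φ z.1‖ₑ * ‖Φ z.2‖ₑ * ENNReal.ofReal (k σ z.1 z.2) := by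
    intro σ hσ
    refine lintegral_weight_mul_sq_oscillatory_le (μ := volume) (ν := volume) (g := g σ) ?_ ?_ hθ hΦ
      fun ξ η => ?_
    · refine (integrable_exp_neg_mul_sq hε).mul_prod
        (g := fun x : E => Real.exp (-(1 / σ) * ‖x‖ ^ 2)) ?_
      have := GaussianFourier.integrable_cexp_neg_mul_sq_norm_add (V := E)
        (b := ((1 / σ : ℝ) : ℂ)) (by rw [Complex.ofReal_re]; positivity) 0 0
      refine (integrable_congr (Filter.Eventually.of_forall fun x => ?_)).1 this.norm
      rw [Complex.norm_exp]
      congr 1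
      simp [← Complex.ofReal_pow]
    · exact fun y => mul_nonneg (Real.exp_pos _).le (Real.exp_pos _).le
    · have := norm_integral_spacetime_gaussian (V := E) hε (s := 1 / σ) (by positivity)
        (‖ξ‖ ^ 2 - ‖η‖ ^ 2) (ξ - η)
      rw [finrank_euclideanSpace_fin] at this
      refine le_of_eq (Eq.trans ?_ this)
      congr 1
      refine integral_congr_ae (Filter.Eventually.of_forall fun y => ?_)
      simp only [g, θ]
      rw [inner_sub_right]
      congr 4
      ring
  have hker : ∀ ξ η, ∫⁻ σ in Set.Ioi (0 : ℝ), ENNReal.ofReal (σ ^ (-5 / 2 : ℝ)) *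
      ENNReal.ofReal (k σ ξ η) = ENNReal.ofReal √Real.pi * K ξ η := by
    intro ξ η
    simp only [K, rieszKernel]
    rw [← mul_assoc, ← lintegral_const_mul _ (by fun_prop)]
    refine setLIntegral_congr_fun measurableSet_Ioi fun σ hσ => ?_
    have hσ : 0 < σ := hσ
    simp only [k]
    rw [← ENNReal.ofReal_mul (by positivity), ← ENNReal.ofReal_mul (by positivity),
      ← ENNReal.ofReal_mul (by positivity), div_eq_mul_one_div Real.pi ε,
      Real.sqrt_mul Real.pi_pos.le]
    congr 1
    ring
  have hpoint : ∀ t ∈ Set.Ioc (0 : ℝ) T, ∀ x : E, ENNReal.ofReal (‖U (t, x)‖ ^ 2 / ‖x‖ ^ 3) ≤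
      κ * ∫⁻ σ in Set.Ioi (0 : ℝ), ENNReal.ofReal (σ ^ (-5 / 2 : ℝ)) *
        ENNReal.ofReal (g σ (t, x) * ‖U (t, x)‖ ^ 2) := by
    intro t ht x
    rcases eq_or_ne x 0 with rfl | hx
    · simp
    have h1 : ENNReal.ofReal (‖U (t, x)‖ ^ 2) ≤ ENNReal.ofReal (Real.exp 1) *
        ENNReal.ofReal (Real.exp (-ε * t ^ 2) * ‖U (t, x)‖ ^ 2) := by
      rw [← ENNReal.ofReal_mul (Real.exp_pos _).le, ← mul_assoc, ← Real.exp_add]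
      refine ENNReal.ofReal_le_ofReal (le_mul_of_one_le_left (by positivity) ?_)
      refine Real.one_le_exp ?_
      have : ε * t ^ 2 ≤ 1 / T ^ 2 * T ^ 2 := by
        have := ht.1.le
        have := ht.2
        gcongr
        exact min_le_right _ _
      rw [one_div_mul_cancel (by positivity)] at this
      linarith
    have h2 := inv_cube_le_lintegral (norm_pos_iff.2 hx)
    rw [div_eq_mul_one_div, ENNReal.ofReal_mul (by positivity)]
    refine (mul_le_mul' h1 h2).trans (le_of_eq ?_)
    rw [mul_mul_mul_comm]
    congr 1
    rw [← lintegral_const_mul _ (by fun_prop)]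
    refine setLIntegral_congr_fun measurableSet_Ioi fun σ hσ => ?_
    have hσ : 0 < σ := hσ
    simp only [g]
    rw [← ENNReal.ofReal_mul (by positivity), ← ENNReal.ofReal_mul (by positivity)]
    congr 1
    ring
  have hG : Measurable fun p : (ℝ × E) × ℝ => ENNReal.ofReal (p.2 ^ (-5 / 2 : ℝ)) *
      ENNReal.ofReal (g p.2 p.1 * ‖U p.1‖ ^ 2) := by
    have : Measurable fun p : (ℝ × E) × ℝ => g p.2 p.1 :=
      hg.comp (measurable_snd.prodMk measurable_fst)
    fun_prop
  have hG1 : Measurable fun y : ℝ × E => ∫⁻ σ in Set.Ioi (0 : ℝ),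
      ENNReal.ofReal (σ ^ (-5 / 2 : ℝ)) * ENNReal.ofReal (g σ y * ‖U y‖ ^ 2) :=
    hG.lintegral_prod_right'
  have hkm : Measurable fun p : ℝ × E × E => ENNReal.ofReal (p.1 ^ (-5 / 2 : ℝ)) *
      (‖Φ p.2.1‖ₑ * ‖Φ p.2.2‖ₑ * ENNReal.ofReal (k p.1 p.2.1 p.2.2)) := by
    simp only [k]
    fun_prop
  calc _ ≤ ∫⁻ t in Set.Ioc (0 : ℝ) T, ∫⁻ x : E, κ * ∫⁻ σ in Set.Ioi (0 : ℝ),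
          ENNReal.ofReal (σ ^ (-5 / 2 : ℝ)) * ENNReal.ofReal (g σ (t, x) * ‖U (t, x)‖ ^ 2) :=
        setLIntegral_mono' measurableSet_Ioc fun t ht => lintegral_mono (hpoint t ht)
    _ ≤ ∫⁻ t : ℝ, ∫⁻ x : E, κ * ∫⁻ σ in Set.Ioi (0 : ℝ),
          ENNReal.ofReal (σ ^ (-5 / 2 : ℝ)) * ENNReal.ofReal (g σ (t, x) * ‖U (t, x)‖ ^ 2) :=
        setLIntegral_le_lintegral _ _
    _ = κ * ∫⁻ y : ℝ × E, ∫⁻ σ in Set.Ioi (0 : ℝ),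
          ENNReal.ofReal (σ ^ (-5 / 2 : ℝ)) * ENNReal.ofReal (g σ y * ‖U y‖ ^ 2) := by
        rw [← lintegral_const_mul _ hG1, Measure.volume_eq_prod,
          lintegral_prod _ (hG1.const_mul κ).aemeasurable]
    _ = κ * ∫⁻ σ in Set.Ioi (0 : ℝ), ∫⁻ y : ℝ × E,
          ENNReal.ofReal (σ ^ (-5 / 2 : ℝ)) * ENNReal.ofReal (g σ y * ‖U y‖ ^ 2) := by
        rw [lintegral_lintegral_swap hG.aemeasurable]
    _ ≤ κ * ∫⁻ σ in Set.Ioi (0 : ℝ), ∫⁻ z : E × E, ENNReal.ofReal (σ ^ (-5 / 2 : ℝ)) *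
          (‖Φ z.1‖ₑ * ‖Φ z.2‖ₑ * ENNReal.ofReal (k σ z.1 z.2)) := by
        refine mul_le_mul_right (setLIntegral_mono' measurableSet_Ioi fun σ hσ => ?_) _
        rw [lintegral_const_mul' _ _ ENNReal.ofReal_ne_top,
          lintegral_const_mul' _ _ ENNReal.ofReal_ne_top]
        exact mul_le_mul_right (hquad σ hσ) _
    _ = κ * ∫⁻ z : E × E, ∫⁻ σ in Set.Ioi (0 : ℝ), ENNReal.ofReal (σ ^ (-5 / 2 : ℝ)) *
          (‖Φ z.1‖ₑ * ‖Φ z.2‖ₑ * ENNReal.ofReal (k σ z.1 z.2)) := by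
        rw [lintegral_lintegral_swap hkm.aemeasurable]
    _ = κ * (ENNReal.ofReal √Real.pi * ∫⁻ z : E × E, ‖Φ z.1‖ₑ * ‖Φ z.2‖ₑ * K z.1 z.2) := by
        rw [← lintegral_const_mul' _ _ ENNReal.ofReal_ne_top]
        congr 1
        refine lintegral_congr fun z => ?_
        simp_rw [mul_left_comm (ENNReal.ofReal (_ ^ (-5 / 2 : ℝ)))]
        rw [lintegral_const_mul' _ _ (by finiteness), hker]
        ring
    _ ≤ κ * (ENNReal.ofReal √Real.pi *
          (2 * ∫⁻ ξ, ‖Φ ξ‖ₑ ^ 2 * (S * A * (c₁ * ENNReal.ofReal (1 + ‖ξ‖))))) := by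
        gcongr
        refine lintegral_prod_mul_symm_kernel_le hΦm.enorm hK (fun ξ η => ?_) fun ξ => ?_
        · simp only [K]
          rw [norm_sub_rev, sub_sq_comm]
        · rw [← ENNReal.ofReal_mul (by positivity)]
          exact lintegral_shell_mul_le (by omega) hR (antitoneOn_rieszKernel _)
            (fun ρ hρ => ofReal_pow_mul_rieszKernel_le hm hρ) hε hε1 ξ
    _ = _ := by
        have : ∀ ξ, ‖Φ ξ‖ₑ ^ 2 * (S * A * (c₁ * ENNReal.ofReal (1 + ‖ξ‖))) =
            (S * A * c₁) * (‖Φ ξ‖ₑ ^ 2 * ENNReal.ofReal (1 + ‖ξ‖)) := fun ξ => by ring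
        simp_rw [this]
        rw [lintegral_const_mul _ (by fun_prop)]
        ring

open FourierTransform in
/-- The Fourier transform of a Schwartz function, in the symmetric normalization, is Schwartz. -/
lemma exists_schwartzMap_eq_fourierT {n : ℕ} (ψ : SchwartzMap (EuclideanSpace ℝ (Fin n)) ℂ) :
    ∃ Φ : SchwartzMap (EuclideanSpace ℝ (Fin n)) ℂ, ⇑Φ = fourierT ⇑ψ := by
  have h : (2 * Real.pi)⁻¹ ≠ 0 := by positivity
  refine ⟨(((2 * Real.pi) ^ (-(n : ℝ) / 2) : ℝ) : ℂ) •
    SchwartzMap.compCLMOfContinuousLinearEquiv ℂ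
      (ContinuousLinearEquiv.smulLeft (R₁ := ℝ) (Units.mk0 _ h)) (𝓕 ψ), ?_⟩
  ext ξ
  simp only [smul_apply, SchwartzMap.compCLMOfContinuousLinearEquiv_apply,
    Function.comp_apply, SchwartzMap.fourier_coe, fourierT, smul_eq_mul]
  congr 1
  rw [Real.fourier_eq']
  refine integral_congr_ae (Filter.Eventually.of_forall fun x => ?_)
  simp only [smul_eq_mul]
  congr 2
  rw [ContinuousLinearEquiv.smulLeft_apply_apply, Units.smul_mk0, real_inner_smul_right]
  push_cast
  field_simp

lemma one_add_norm_le_two_mul_rpow {E : Type*} [SeminormedAddCommGroup E] (ξ : E) :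
    1 + ‖ξ‖ ≤ 2 * (1 + ‖ξ‖ ^ 2) ^ (1 / 2 : ℝ) := by
  rw [← Real.sqrt_eq_rpow]
  have h1 : 1 ≤ √(1 + ‖ξ‖ ^ 2) := Real.one_le_sqrt.2 (by nlinarith [sq_nonneg ‖ξ‖])
  have h2 : ‖ξ‖ ≤ √(1 + ‖ξ‖ ^ 2) := Real.le_sqrt_of_sq_le (by linarith)
  linarith

lemma integrable_rpow_half_mul_sq {n : ℕ} (Φ : SchwartzMap (EuclideanSpace ℝ (Fin n)) ℂ) :
    Integrable fun ξ => (1 + ‖ξ‖ ^ 2) ^ (1 / 2 : ℝ) * ‖Φ ξ‖ ^ 2 := by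
  set B := SchwartzMap.seminorm ℝ 0 0 Φ
  have hB : ∀ ξ, ‖Φ ξ‖ ≤ B := SchwartzMap.norm_le_seminorm ℝ Φ
  have h : Integrable fun ξ => B * (‖Φ ξ‖ + ‖ξ‖ ^ 1 * ‖Φ ξ‖) :=
    (Φ.integrable.norm.add (Φ.integrable_pow_mul volume 1)).const_mul B
  refine h.mono' (Continuous.aestronglyMeasurable ?_) (Filter.Eventually.of_forall fun ξ => ?_)
  · simp_rw [← Real.sqrt_eq_rpow]
    fun_prop
  · rw [Real.norm_of_nonneg (by positivity), ← Real.sqrt_eq_rpow]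
    have h1 : √(1 + ‖ξ‖ ^ 2) ≤ 1 + ‖ξ‖ :=
      Real.sqrt_le_iff.2 ⟨by positivity, by nlinarith [norm_nonneg ξ]⟩
    calc _ ≤ (1 + ‖ξ‖) * (B * ‖Φ ξ‖) := by
          rw [sq ‖Φ ξ‖]
          have := hB ξ
          gcongr
      _ = _ := by ring

/-- **Weighted Morawetz estimate** for the free Schrödinger equation in dimension `n ≥ 4`:
there is `C = C(n)` such that for all Schwartz data `ψ₀` and all `T > 0`,
`∫₀^T ∫ |ψ(t,x)|²/|x|³ dx dt ≤ C ‖ψ₀‖²_{H^{1/2}}`. -/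
theorem morawetz_weighted_estimate (n : ℕ) (hn : 4 ≤ n) :
    ∃ C : ℝ, ∀ (ψ₀ : SchwartzMap (EuclideanSpace ℝ (Fin n)) ℂ) (T : ℝ), 0 < T →
      (∫ t in Set.Ioc (0 : ℝ) T, ∫ x, ‖schrodSol ψ₀ t x‖ ^ 2 / ‖x‖ ^ 3)
        ≤ C * sobolevNormSq ((1 : ℝ) / 2) (⇑ψ₀) := by
  obtain ⟨m, rfl⟩ : ∃ m, n = m + 1 := ⟨n - 1, by omega⟩
  obtain ⟨C, hC, hmain⟩ := lintegral_free_wave_div_cube_le (m := m) (by omega)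
  set c : ℝ := (2 * Real.pi) ^ (-((m + 1 : ℕ) : ℝ) / 2) with hc
  refine ⟨c ^ 2 * (C.toReal * 2), fun ψ₀ T hT => ?_⟩
  obtain ⟨Φ, hΦ⟩ := exists_schwartzMap_eq_fourierT ψ₀
  have hint := integrable_rpow_half_mul_sq Φ
  have hnonneg : ∀ ξ : EuclideanSpace ℝ (Fin (m + 1)),
      0 ≤ (1 + ‖ξ‖ ^ 2) ^ (1 / 2 : ℝ) * ‖Φ ξ‖ ^ 2 := fun ξ => by positivity
  have hsob : sobolevNormSq (1 / 2) ψ₀ = ∫ ξ, (1 + ‖ξ‖ ^ 2) ^ (1 / 2 : ℝ) * ‖Φ ξ‖ ^ 2 := by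
    rw [sobolevNormSq, hΦ]
  have hsob0 : 0 ≤ sobolevNormSq (1 / 2) ψ₀ := hsob ▸ integral_nonneg hnonneg
  have hbound : ∫⁻ ξ, ‖Φ ξ‖ₑ ^ 2 * ENNReal.ofReal (1 + ‖ξ‖) ≤
      ENNReal.ofReal (2 * sobolevNormSq (1 / 2) ψ₀) := by
    rw [hsob, ← integral_const_mul, ofReal_integral_eq_lintegral_ofReal (hint.const_mul 2)
      (Filter.Eventually.of_forall fun ξ => mul_nonneg zero_le_two (hnonneg ξ))]
    refine lintegral_mono fun ξ => ?_
    rw [← ofReal_norm, ← ENNReal.ofReal_pow (norm_nonneg _), ← ENNReal.ofReal_mul (by positivity)]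
    refine ENNReal.ofReal_le_ofReal ?_
    have := mul_le_mul_of_nonneg_left (one_add_norm_le_two_mul_rpow ξ) (sq_nonneg ‖Φ ξ‖)
    linarith
  have hsol : ∀ (t : ℝ) (x : EuclideanSpace ℝ (Fin (m + 1))),
      ‖‖schrodSol ψ₀ t x‖ ^ 2 / ‖x‖ ^ 3‖ₑ = ENNReal.ofReal (c ^ 2) *
      ENNReal.ofReal (‖∫ ξ, Complex.exp (((⟪x, ξ⟫ - t * ‖ξ‖ ^ 2 : ℝ) : ℂ) * Complex.I) * Φ ξ‖ ^ 2
        / ‖x‖ ^ 3) := by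
    intro t x
    rw [← ENNReal.ofReal_mul (by positivity), Real.enorm_of_nonneg (by positivity), schrodSol,
      norm_mul, Complex.norm_real, Real.norm_of_nonneg (by positivity), mul_pow, mul_div_assoc,
      ← hc, hΦ]
    refine congrArg (fun z : ℂ => ENNReal.ofReal (c ^ 2 * (‖z‖ ^ 2 / ‖x‖ ^ 3)))
      (integral_congr_ae (Filter.Eventually.of_forall fun ξ => ?_))
    simp only [← Complex.exp_add]
    congr 2
    push_cast
    ring
  have hkey : ‖∫ t in Set.Ioc (0 : ℝ) T, ∫ x : EuclideanSpace ℝ (Fin (m + 1)),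
      ‖schrodSol ψ₀ t x‖ ^ 2 / ‖x‖ ^ 3‖ₑ ≤
        ENNReal.ofReal (c ^ 2 * (C.toReal * 2) * sobolevNormSq (1 / 2) ψ₀) := by
    calc _ ≤ ∫⁻ t in Set.Ioc (0 : ℝ) T, ∫⁻ x : EuclideanSpace ℝ (Fin (m + 1)),
            ‖‖schrodSol ψ₀ t x‖ ^ 2 / ‖x‖ ^ 3‖ₑ :=
          (enorm_integral_le_lintegral_enorm _).trans
            (lintegral_mono fun t => enorm_integral_le_lintegral_enorm _)
      _ ≤ ENNReal.ofReal (c ^ 2) * (C * ENNReal.ofReal (2 * sobolevNormSq (1 / 2) ψ₀)) := by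
          simp_rw [hsol, lintegral_const_mul' _ _ ENNReal.ofReal_ne_top]
          gcongr
          exact (hmain Φ Φ.continuous.measurable Φ.integrable T hT).trans (by gcongr)
      _ = _ := by
          conv_lhs => rw [← ENNReal.ofReal_toReal hC]
          rw [← ENNReal.ofReal_mul (by positivity), ← ENNReal.ofReal_mul (by positivity)]
          congr 1
          ring
  rw [← ofReal_norm, ENNReal.ofReal_le_ofReal_iff (by positivity)] at hkey
  exact (Real.le_norm_self _).trans hkey
end
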